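/- arXiv:1107.4818 — 2 statements merged into one kernel-verified Lean document; each statement's English description precedes it below -/
import Mathlib

section
/- Let S be a tightly connected fundamental inverse semigroup with no isolated nontrivial subgroups, let T be an inverse semigroup, and let Ψ be a lattice isomorphism of S onto T whose associated E-bijection ψ_E is a semilattice isomorphism of E_S onto E_T. Then there exists an isomorphism φ of S onto T whose restriction to E_S is ψ_E; in particular, S and T are isomorphic. -/
/-- An inverse semigroup: a semigroup in which every element `a` has a unique
element `a⁻¹` with `a * a⁻¹ * a = a` and `a⁻¹ * a * a⁻¹ = a⁻¹`. -/
class InverseSemigroup (S : Type*) extends Semigroup S, Inv S where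
  mul_inv_mul : ∀ a : S, a * a⁻¹ * a = a
  inv_mul_inv : ∀ a : S, a⁻¹ * a * a⁻¹ = a⁻¹
  inv_unique : ∀ a b : S, a * b * a = a → b * a * b = b → b = a⁻¹

section InvSgDefs

variable (S : Type*) [InverseSemigroup S]

/-- The set of idempotents of `S`. -/
def ES : Set S := {e : S | IsIdempotentElem e}

/-- The set of nongroup elements of `S`. -/
def NS : Set S := {x : S | x * x⁻¹ ≠ x⁻¹ * x}

/-- `N_S ∪ E_S`. -/
def NE : Set S := NS S ∪ ES S

variable {S}

/-- The order on idempotents: `e ≤ f` iff `e * f = e`. -/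
def idemLe (e f : S) : Prop := e * f = e

/-- Strict order on idempotents. -/
def idemLt (e f : S) : Prop := idemLe e f ∧ e ≠ f

/-- The natural partial order on an inverse semigroup: `a ≤ b` iff `a = e * b`
for some idempotent `e`. -/
def natLe (a b : S) : Prop := ∃ e : S, IsIdempotentElem e ∧ a = e * b

/-- Green's relation `𝓡`. -/
def rRel (a b : S) : Prop := a * a⁻¹ = b * b⁻¹

/-- Green's relation `𝓛`. -/
def lRel (a b : S) : Prop := a⁻¹ * a = b⁻¹ * b

/-- Green's relation `𝓗`. -/
def hRel (a b : S) : Prop := rRel a b ∧ lRel a b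

/-- Green's relation `𝓓`. -/
def dRel (a b : S) : Prop := ∃ c : S, rRel a c ∧ lRel c b

/-- `U` is an inverse subsemigroup of `S`: closed under multiplication and inversion. -/
def IsInvSub (U : Set S) : Prop :=
  (∀ a ∈ U, ∀ b ∈ U, a * b ∈ U) ∧ ∀ a ∈ U, a⁻¹ ∈ U

/-- The inverse subsemigroup generated by `X`: the smallest subset of `S`
containing `X` and closed under multiplication and inversion. -/
def genInv (X : Set S) : Set S := ⋂₀ {U : Set S | IsInvSub U ∧ X ⊆ U}

/-- `e` is `x`-covered by `x * x⁻¹`: `e < x * x⁻¹` and no idempotent `f` of `⟨x⟩`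
satisfies `e < f < x * x⁻¹`. -/
def XCov (x e : S) : Prop :=
  idemLt e (x * x⁻¹) ∧
    ∀ f ∈ genInv ({x} : Set S), IsIdempotentElem f →
      ¬(idemLt e f ∧ idemLt f (x * x⁻¹))

/-- `e` is tightly `x`-covered by `x * x⁻¹`. -/
def TightXCov (x e : S) : Prop :=
  XCov x e ∧ (e * x ∈ NS S ∨ IsIdempotentElem (e * x))

/-- A short bypass from `e` to `x * x⁻¹`. -/
def ShortBypass (x e : S) : Prop :=
  ∃ n : ℕ, 1 ≤ n ∧ ∃ es : ℕ → S,
    es 0 = e ∧ es n = x * x⁻¹ ∧ (∀ k ≤ n, IsIdempotentElem (es k)) ∧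
    ∀ k : ℕ, 1 ≤ k → k ≤ n → idemLt (es (k - 1)) (es k) ∧ XCov (es k * x) (es (k - 1))

/-- A tight bypass from `e` to `x * x⁻¹`. -/
def TightBypass (x e : S) : Prop :=
  ∃ n : ℕ, 1 ≤ n ∧ ∃ es : ℕ → S,
    es 0 = e ∧ es n = x * x⁻¹ ∧ (∀ k ≤ n, IsIdempotentElem (es k)) ∧
    ∀ k : ℕ, 1 ≤ k → k ≤ n → idemLt (es (k - 1)) (es k) ∧ TightXCov (es k * x) (es (k - 1))

variable (S)

/-- `S` is shortly connected. -/
def ShortlyConnected : Prop :=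
  ∀ x : S, ∀ e : S, IsIdempotentElem e → idemLt e (x * x⁻¹) → ShortBypass x e

/-- `S` is tightly connected. -/
def TightlyConnected : Prop :=
  ∀ x ∈ NE S, ∀ e : S, IsIdempotentElem e → idemLt e (x * x⁻¹) → TightBypass x e

/-- `S` is fundamental. -/
def Fundamental : Prop :=
  ∀ x y : S, (∀ e : S, IsIdempotentElem e → x⁻¹ * e * x = y⁻¹ * e * y) → x = y

/-- `S` is combinatorial. -/
def Combinatorial : Prop :=
  ∀ a b : S, a * a⁻¹ = b * b⁻¹ → a⁻¹ * a = b⁻¹ * b → a = b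

/-- `S` has no isolated nontrivial subgroups: for every idempotent `e` whose
`𝓗`-class is nontrivial there is an idempotent `f ≠ e` with `e 𝓓 f`. -/
def NoIsolatedNontrivial : Prop :=
  ∀ e : S, IsIdempotentElem e → (∃ h : S, h ≠ e ∧ hRel h e) →
    ∃ f : S, IsIdempotentElem f ∧ f ≠ e ∧ dRel e f

/-- `S` is completely semisimple. -/
def CompletelySemisimple : Prop :=
  ∀ e f : S, IsIdempotentElem e → IsIdempotentElem f → idemLe e f → dRel e f → e = f

end InvSgDefs

namespace ISG

/-! ### Basic theory of inverse semigroups -/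

section Basics
variable {S : Type*} [InverseSemigroup S]

theorem mim (a : S) : a * (a⁻¹ * a) = a := by
  rw [← mul_assoc]; exact InverseSemigroup.mul_inv_mul a

theorem imi (a : S) : a⁻¹ * (a * a⁻¹) = a⁻¹ := by
  rw [← mul_assoc]; exact InverseSemigroup.inv_mul_inv a

theorem mim' (a b : S) : a * (a⁻¹ * (a * b)) = a * b := by
  rw [← mul_assoc, ← mul_assoc, InverseSemigroup.mul_inv_mul a]

theorem imi' (a b : S) : a⁻¹ * (a * (a⁻¹ * b)) = a⁻¹ * b := by
  rw [← mul_assoc, ← mul_assoc, InverseSemigroup.inv_mul_inv a]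

theorem ii (a : S) : (a⁻¹)⁻¹ = a :=
  (InverseSemigroup.inv_unique a⁻¹ a (InverseSemigroup.inv_mul_inv a)
    (InverseSemigroup.mul_inv_mul a)).symm

theorem idem_inv {e : S} (h : IsIdempotentElem e) : e⁻¹ = e := by
  have h' : e * e = e := h
  exact (InverseSemigroup.inv_unique e e (by rw [h', h']) (by rw [h', h'])).symm

theorem idem_mul {e f : S} (he : IsIdempotentElem e) (hf : IsIdempotentElem f) :
    IsIdempotentElem (e * f) := by
  have he' : e * e = e := he
  have hf' : f * f = f := hf
  have he2 : ∀ x, e * (e * x) = e * x := fun x => by rw [← mul_assoc, he']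
  have hf2 : ∀ x, f * (f * x) = f * x := fun x => by rw [← mul_assoc, hf']
  have k1 := mim (e * f)
  have k2 := imi (e * f)
  have k3 := imi' (e * f)
  have hz : f * (e * f)⁻¹ * e = (e * f)⁻¹ := by
    apply InverseSemigroup.inv_unique
    · simp only [mul_assoc, he2, hf2] at k1 ⊢
      exact k1
    · simp only [mul_assoc, he2, hf2] at k3 ⊢
      rw [k3]
  have hzi : IsIdempotentElem ((e * f)⁻¹) := by
    change (e * f)⁻¹ * (e * f)⁻¹ = (e * f)⁻¹
    nth_rewrite 1 [← hz]
    nth_rewrite 2 [← hz]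
    nth_rewrite 3 [← hz]
    simp only [mul_assoc] at k3 ⊢
    rw [k3]
  have := idem_inv hzi
  rw [ii] at this
  rw [this]; exact hzi

theorem idem_comm {e f : S} (he : IsIdempotentElem e) (hf : IsIdempotentElem f) :
    e * f = f * e := by
  have h1 : (e * f) * (e * f) = e * f := idem_mul he hf
  have h2 : (f * e) * (f * e) = f * e := idem_mul hf he
  have he' : e * e = e := he
  have hf' : f * f = f := hf
  have he2 : ∀ x, e * (e * x) = e * x := fun x => by rw [← mul_assoc, he']
  have hf2 : ∀ x, f * (f * x) = f * x := fun x => by rw [← mul_assoc, hf']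
  have : f * e = (e * f)⁻¹ := by
    apply InverseSemigroup.inv_unique
    · simp only [mul_assoc, he2, hf2] at h1 ⊢
      exact h1
    · simp only [mul_assoc, he2, hf2] at h2 ⊢
      exact h2
  rw [this, idem_inv (idem_mul he hf)]

theorem idem_r (a : S) : IsIdempotentElem (a * a⁻¹) := by
  change a * a⁻¹ * (a * a⁻¹) = a * a⁻¹
  rw [mul_assoc, imi]

theorem idem_d (a : S) : IsIdempotentElem (a⁻¹ * a) := by
  change a⁻¹ * a * (a⁻¹ * a) = a⁻¹ * a
  rw [mul_assoc, mim]

theorem mir (a b : S) : (a * b)⁻¹ = b⁻¹ * a⁻¹ := by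
  have c := idem_comm (idem_r b) (idem_d a)
  have c2 : ∀ x, b * (b⁻¹ * (a⁻¹ * (a * x))) = a⁻¹ * (a * (b * (b⁻¹ * x))) := fun x => by
    have := congrArg (· * x) c
    simpa only [mul_assoc] using this
  symm
  apply InverseSemigroup.inv_unique
  · simp only [mul_assoc]
    rw [c2, mim', mim]
  · simp only [mul_assoc]
    rw [← c2, imi', imi]

end Basics

/-! ### The semilattice of idempotents -/

/-- The idempotents as a bundled type. -/
abbrev E (S : Type*) [InverseSemigroup S] : Type _ := {e : S // IsIdempotentElem e}

section Idem
variable {S : Type*} [InverseSemigroup S]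

instance instSemilattice : SemilatticeInf (E S) where
  le e f := e.1 * f.1 = e.1
  le_refl e := e.2
  le_trans e f g h1 h2 := by
    change e.1 * f.1 = e.1 at h1
    change f.1 * g.1 = f.1 at h2
    rw [← h1, mul_assoc, h2]
  le_antisymm e f h1 h2 := by
    change e.1 * f.1 = e.1 at h1
    change f.1 * e.1 = f.1 at h2
    apply Subtype.ext
    rw [← h1, idem_comm e.2 f.2, h2]
  inf e f := ⟨e.1 * f.1, idem_mul e.2 f.2⟩
  inf_le_left e f := by
    change e.1 * f.1 * e.1 = e.1 * f.1
    rw [idem_comm e.2 f.2, mul_assoc, e.2]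
  inf_le_right e f := by
    change e.1 * f.1 * f.1 = e.1 * f.1
    rw [mul_assoc, f.2]
  le_inf e f g h1 h2 := by
    change e.1 * f.1 = e.1 at h1
    change e.1 * g.1 = e.1 at h2
    change e.1 * (f.1 * g.1) = e.1
    rw [← mul_assoc, h1, h2]

theorem le_def {e f : E S} : e ≤ f ↔ e.1 * f.1 = e.1 := Iff.rfl
theorem coe_inf (e f : E S) : (e ⊓ f).1 = e.1 * f.1 := rfl

/-- The range idempotent `a * a⁻¹`. -/
def rr (a : S) : E S := ⟨a * a⁻¹, idem_r a⟩

theorem idem_cj (a : S) {t : S} (h : IsIdempotentElem t) : IsIdempotentElem (a * t * a⁻¹) := by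
  have ht : t * t = t := h
  have c := idem_comm (idem_d a) h
  change a * t * a⁻¹ * (a * t * a⁻¹) = a * t * a⁻¹
  calc a * t * a⁻¹ * (a * t * a⁻¹) = a * t * (a⁻¹ * a * t) * a⁻¹ := by simp only [mul_assoc]
    _ = a * (t * t) * (a⁻¹ * (a * a⁻¹)) := by rw [c]; simp only [mul_assoc]
    _ = _ := by rw [imi, ht]

/-- The conjugation action on idempotents. -/
def cj (a : S) (t : E S) : E S := ⟨a * t.1 * a⁻¹, idem_cj a t.2⟩

theorem inv_coe (e : E S) : (e.1)⁻¹ = e.1 := idem_inv e.2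

theorem rr_coe (e : E S) : rr e.1 = e := by
  apply Subtype.ext
  change e.1 * (e.1)⁻¹ = e.1
  rw [inv_coe, e.2]

theorem cj_mul (a b : S) (t : E S) : cj (a * b) t = cj a (cj b t) := by
  apply Subtype.ext
  change a * b * t.1 * (a * b)⁻¹ = a * (b * t.1 * b⁻¹) * a⁻¹
  rw [mir]; simp only [mul_assoc]

theorem rr_mul (a b : S) : rr (a * b) = cj a (rr b) := by
  apply Subtype.ext
  change a * b * (a * b)⁻¹ = a * (b * b⁻¹) * a⁻¹
  rw [mir]; simp only [mul_assoc]

theorem cj_coe (e t : E S) : cj e.1 t = e ⊓ t := by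
  apply Subtype.ext
  change e.1 * t.1 * (e.1)⁻¹ = e.1 * t.1
  rw [inv_coe, idem_comm e.2 t.2, mul_assoc, e.2]

theorem cj_le (a : S) (t : E S) : cj a t ≤ rr a := by
  rw [le_def]
  change a * t.1 * a⁻¹ * (a * a⁻¹) = a * t.1 * a⁻¹
  rw [mul_assoc, imi]

theorem cj_inf (a : S) (s t : E S) : cj a (s ⊓ t) = cj a s ⊓ cj a t := by
  apply Subtype.ext
  change a * (s.1 * t.1) * a⁻¹ = a * s.1 * a⁻¹ * (a * t.1 * a⁻¹)
  have c := idem_comm (idem_d a) t.2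
  calc a * (s.1 * t.1) * a⁻¹ = a * s.1 * t.1 * (a⁻¹ * (a * a⁻¹)) := by
        rw [imi]; simp only [mul_assoc]
    _ = a * s.1 * (t.1 * (a⁻¹ * a)) * a⁻¹ := by simp only [mul_assoc]
    _ = _ := by rw [← c]; simp only [mul_assoc]

theorem cj_mono (a : S) {s t : E S} (h : s ≤ t) : cj a s ≤ cj a t := by
  rw [← inf_eq_left] at h ⊢
  rw [← cj_inf, h]

theorem r_mul (a : S) : (rr a).1 * a = a := InverseSemigroup.mul_inv_mul a

theorem mul_r (a : S) : a * (rr a⁻¹).1 = a := by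
  change a * (a⁻¹ * a⁻¹⁻¹) = a
  rw [ii, mim]

theorem mul_inv_eq (a : S) : a * a⁻¹ = (rr a).1 := rfl
theorem inv_mul_eq (a : S) : a⁻¹ * a = (rr a⁻¹).1 := by
  change _ = a⁻¹ * a⁻¹⁻¹
  rw [ii]

theorem cj_cj_inv (a : S) (t : E S) : cj a (cj a⁻¹ t) = rr a ⊓ t := by
  rw [← cj_mul, mul_inv_eq, cj_coe]

theorem cj_inv_cj (a : S) (t : E S) : cj a⁻¹ (cj a t) = rr a⁻¹ ⊓ t := by
  rw [← cj_mul, inv_mul_eq, cj_coe]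

theorem cj_r (a : S) : cj a (rr a⁻¹) = rr a := by
  rw [← rr_mul, mul_inv_eq, rr_coe]

theorem cj_r' (a : S) : cj a⁻¹ (rr a) = rr a⁻¹ := by
  have := cj_r a⁻¹
  rwa [ii] at this

theorem cj_inf_r (a : S) (t : E S) : cj a (rr a⁻¹ ⊓ t) = cj a t := by
  rw [cj_inf, cj_r, inf_eq_right]; exact cj_le a t

theorem cj_inf_r' (a : S) (t : E S) : cj a⁻¹ (rr a ⊓ t) = cj a⁻¹ t := by
  have := cj_inf_r a⁻¹ t
  rwa [ii] at this

theorem cj_le' (a : S) (t : E S) : cj a⁻¹ t ≤ rr a⁻¹ := cj_le _ _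

theorem rr_gmul (g : E S) (a : S) : rr (g.1 * a) = g ⊓ rr a := by rw [rr_mul, cj_coe]

theorem rr_gmul_inv (g : E S) (a : S) : rr (g.1 * a)⁻¹ = cj a⁻¹ g := by
  rw [mir, rr_mul, inv_coe, rr_coe]

theorem rr_mul_le (a b : S) : rr (a * b) ≤ rr a := by rw [rr_mul]; exact cj_le _ _

/-- absorbing an idempotent on the left -/
theorem gmul_of_le {g : E S} {a : S} (h : rr a ≤ g) : g.1 * a = a := by
  rw [← r_mul a, ← mul_assoc, ← coe_inf, inf_eq_right.2 h]

theorem mulg_of_le {g : E S} {a : S} (h : rr a⁻¹ ≤ g) : a * g.1 = a := by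
  nth_rewrite 1 [← mul_r a]
  rw [mul_assoc, ← coe_inf, inf_eq_left.2 h, mul_r]

theorem mul_g (a : S) (g : E S) : a * g.1 = (cj a g).1 * a := by
  change a * g.1 = a * g.1 * a⁻¹ * a
  have c := idem_comm (idem_d a) g.2
  rw [mul_assoc, mul_assoc, ← c, ← mul_assoc, ← mul_assoc, InverseSemigroup.mul_inv_mul]

theorem idem_iff {a : S} : IsIdempotentElem a ↔ a = (rr a).1 := by
  constructor
  · intro h
    exact (congrArg Subtype.val (rr_coe ⟨a, h⟩)).symm
  · intro h; rw [h]; exact (rr a).2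

end Idem

end ISG

namespace ISG

/-! ### Inverse subsemigroups and generation -/

/-- Bundled inverse subsemigroups. -/
abbrev Sb (S : Type*) [InverseSemigroup S] : Type _ := {U : Set S // IsInvSub U}

section Gen
variable {S : Type*} [InverseSemigroup S]

theorem genInv_sub (X : Set S) : IsInvSub (genInv X) := by
  refine ⟨fun a ha b hb U hU => hU.1.1 a (ha U hU) b (hb U hU), fun a ha U hU => ?_⟩
  exact hU.1.2 a (ha U hU)

/-- Bundled generated inverse subsemigroup. -/
def gen (X : Set S) : Sb S := ⟨genInv X, genInv_sub X⟩

theorem subset_gen (X : Set S) : X ⊆ (gen X).1 := fun _ ha _ hU => hU.2 ha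

theorem gen_le {X : Set S} {U : Sb S} : gen X ≤ U ↔ X ⊆ U.1 :=
  ⟨fun h _ ha => h (subset_gen X ha), fun h _ ha => ha U.1 ⟨U.2, h⟩⟩

theorem gen1_le {x : S} {U : Sb S} : gen {x} ≤ U ↔ x ∈ U.1 := by
  rw [gen_le, Set.singleton_subset_iff]

theorem mem_gen1 (x : S) : x ∈ (gen {x}).1 := subset_gen _ rfl

theorem rr_mem {U : Sb S} {a : S} (h : a ∈ U.1) : (rr a).1 ∈ U.1 :=
  U.2.1 a h _ (U.2.2 a h)

theorem cj_mem {U : Sb S} {a : S} {t : E S} (h : a ∈ U.1) (ht : t.1 ∈ U.1) : (cj a t).1 ∈ U.1 :=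
  U.2.1 _ (U.2.1 a h _ ht) _ (U.2.2 a h)

theorem inv_mem {U : Sb S} {a : S} (h : a ∈ U.1) : a⁻¹ ∈ U.1 := U.2.2 a h
theorem inv_mem' {U : Sb S} {a : S} (h : a⁻¹ ∈ U.1) : a ∈ U.1 := by
  have := U.2.2 _ h; rwa [ii] at this
theorem mul_mem {U : Sb S} {a b : S} (h : a ∈ U.1) (h' : b ∈ U.1) : a * b ∈ U.1 := U.2.1 a h b h'

theorem gen_inv (x : S) : gen {x⁻¹} = gen {x} := by
  apply le_antisymm
  · rw [gen1_le]; exact inv_mem (mem_gen1 x)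
  · rw [gen1_le]; exact inv_mem' (mem_gen1 x⁻¹)

/-- Words. -/
inductive Gn (X : Set S) : S → Prop
  | base (c : S) (h : c ∈ X ∨ c⁻¹ ∈ X) : Gn X c
  | step (s c : S) (hs : Gn X s) (h : c ∈ X ∨ c⁻¹ ∈ X) : Gn X (s * c)

theorem Gn.mul {X : Set S} {a b : S} (ha : Gn X a) (hb : Gn X b) : Gn X (a * b) := by
  induction hb with
  | base c h => exact Gn.step _ _ ha h
  | step s c hs h ih => rw [← mul_assoc]; exact Gn.step _ _ ih h

theorem letter_inv {X : Set S} {c : S} (h : c ∈ X ∨ c⁻¹ ∈ X) : c⁻¹ ∈ X ∨ c⁻¹⁻¹ ∈ X := by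
  rw [ii]; exact h.symm

theorem Gn.inv {X : Set S} {a : S} (ha : Gn X a) : Gn X a⁻¹ := by
  induction ha with
  | base c h => exact Gn.base _ (letter_inv h)
  | step s c hs h ih => rw [mir]; exact Gn.mul (Gn.base _ (letter_inv h)) ih

theorem gen_Gn {X : Set S} {a : S} (h : a ∈ (gen X).1) : Gn X a := by
  have : gen X ≤ ⟨{a | Gn X a}, ⟨fun a ha b hb => Gn.mul ha hb, fun a ha => Gn.inv ha⟩⟩ := by
    rw [gen_le]; intro c hc; exact Gn.base c (Or.inl hc)
  exact this h

/-- The walk lemma: description of an `𝓡`-class of a generated inverse subsemigroup. -/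
theorem walk (X : Set S) (g : E S) (K : S → Prop) (K0 : K g.1)
    (Kc : ∀ k c, K k → rr k = g → (c ∈ X ∨ c⁻¹ ∈ X) → rr (k * c) = g → K (k * c))
    {s : S} (hs : s ∈ (gen X).1) (hgs : g ≤ rr s) : K (g.1 * s) := by
  have h := gen_Gn hs
  clear hs
  induction h with
  | base c h =>
    refine Kc _ _ K0 (rr_coe g) h ?_
    rw [rr_gmul, inf_eq_left.2 hgs]
  | step s c hs h ih =>
    have h1 : g ≤ rr s := hgs.trans (rr_mul_le _ _)
    rw [← mul_assoc]
    refine Kc _ _ (ih h1) ?_ h ?_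
    · rw [rr_gmul, inf_eq_left.2 h1]
    · rw [mul_assoc, rr_gmul, inf_eq_left.2 hgs]

theorem walk_eq (X : Set S) (g : E S) (K : S → Prop) (K0 : K g.1)
    (Kc : ∀ k c, K k → rr k = g → (c ∈ X ∨ c⁻¹ ∈ X) → rr (k * c) = g → K (k * c))
    {s : S} (hs : s ∈ (gen X).1) (hgs : rr s = g) : K s := by
  have := walk X g K K0 Kc hs hgs.ge
  rwa [gmul_of_le hgs.le] at this

/-- letters for one generator -/
theorem letter1 {x c : S} (h : c ∈ ({x} : Set S) ∨ c⁻¹ ∈ ({x} : Set S)) : c = x ∨ c = x⁻¹ := by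
  rcases h with h | h
  · left; exact h
  · right
    have h : c⁻¹ = x := h
    rw [← h, ii]

theorem letter2 {x c : S} {g : E S} (h : c ∈ ({x, g.1} : Set S) ∨ c⁻¹ ∈ ({x, g.1} : Set S)) :
    c = x ∨ c = x⁻¹ ∨ c = g.1 := by
  have key : ∀ {d : S}, c⁻¹ = d → c = d⁻¹ := fun h => by rw [← h, ii]
  rcases h with (h | h) | (h | h)
  · left; exact h
  · right; right; exact h
  · right; left; exact key h
  · right; right; rw [key h, inv_coe]

/-- Induction for the idempotents of a monogenic inverse subsemigroup. -/
theorem idem_ind {x : S} (Q : E S → Prop) (h1 : Q (rr x)) (h2 : Q (rr x⁻¹))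
    (h3 : ∀ t, Q t → Q (cj x t)) (h4 : ∀ t, Q t → Q (cj x⁻¹ t))
    {t : E S} (ht : t.1 ∈ (gen {x}).1) : Q t := by
  have key : ∀ s, Gn {x} s → Q (rr s⁻¹) := by
    intro s hs
    induction hs with
    | base c h =>
      rcases letter1 h with rfl | rfl
      · exact h2
      · rw [ii]; exact h1
    | step s c hs h ih =>
      rw [mir, rr_mul]
      rcases letter1 h with rfl | rfl
      · exact h4 _ ih
      · rw [ii]; exact h3 _ ih
  have := key _ (gen_Gn ht)
  rwa [inv_coe, rr_coe] at this

end Gen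

/-! ### Monogenic inverse semigroups -/

section Mono
variable {S : Type*} [InverseSemigroup S]

/-- Nongroup elements. -/
def NG (x : S) : Prop := rr x ≠ rr x⁻¹
/-- `x x⁻¹` and `x⁻¹ x` incomparable. -/
def Inc (x : S) : Prop := ¬ rr x ≤ rr x⁻¹ ∧ ¬ rr x⁻¹ ≤ rr x
/-- `x⁻¹ x < x x⁻¹`. -/
def Bic (x : S) : Prop := rr x⁻¹ < rr x

theorem tri {x : S} (h : NG x) : Inc x ∨ Bic x ∨ Bic x⁻¹ := by
  unfold Inc Bic
  rw [ii]
  by_cases h1 : rr x ≤ rr x⁻¹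
  · right; right; exact lt_of_le_of_ne h1 h
  · by_cases h2 : rr x⁻¹ ≤ rr x
    · right; left; exact lt_of_le_of_ne h2 (Ne.symm h)
    · left; exact ⟨h1, h2⟩

theorem Inc.inv {x : S} (h : Inc x) : Inc x⁻¹ := by
  unfold Inc; rw [ii]; exact ⟨h.2, h.1⟩
theorem NG.inv {x : S} (h : NG x) : NG x⁻¹ := by
  unfold NG; rw [ii]; exact h.symm
theorem Inc.ng {x : S} (h : Inc x) : NG x := fun k => h.1 k.le
theorem Bic.ng {x : S} (h : Bic x) : NG x := ne_of_gt h

/-- `cj x e ≥ e` implies `f ≤ e` -/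
theorem ge_of_cj {x : S} {t : E S} (h : rr x ≤ cj x t) : rr x⁻¹ ≤ t := by
  have := cj_mono x⁻¹ h
  rw [cj_r', cj_inv_cj] at this
  exact this.trans inf_le_right

/-- the set `g * xⁿ` -/
def rp (g x : S) : ℕ → S
  | 0 => g
  | n + 1 => rp g x n * x

theorem inc_R {x s : S} (h : Inc x) (hs : s ∈ (gen {x}).1) (hr : rr x ≤ rr s) :
    (rr x).1 * s = (rr x).1 ∨ (rr x).1 * s = x := by
  refine walk {x} (rr x) (fun k => k = (rr x).1 ∨ k = x) (Or.inl rfl) ?_ hs hr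
  rintro k c hk - hc hr
  rcases hk with rfl | rfl <;> rcases letter1 hc with rfl | rfl
  · right; exact r_mul _
  · exfalso
    rw [rr_gmul] at hr
    exact h.1 (inf_eq_left.1 hr)
  · exfalso
    rw [rr_mul] at hr
    exact h.2 (ge_of_cj hr.ge)
  · left; rfl

theorem cj_of_bic {x : S} (h : Bic x) : cj x (rr x) = rr x := by
  have := cj_mono x h.le
  rw [cj_r] at this
  exact le_antisymm (cj_le _ _) this

theorem bic_mul {x : S} (h : Bic x) : x * (rr x).1 = x := mulg_of_le h.le

theorem rp_mul_inv {x : S} (h : Bic x) {g : E S} (hg : g ≤ rr x) (n : ℕ) :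
    rp g.1 x (n + 1) * x⁻¹ = rp g.1 x n := by
  change rp g.1 x n * x * x⁻¹ = _
  rw [mul_assoc, mul_inv_eq]
  cases n with
  | zero => change g.1 * _ = g.1; exact hg
  | succ n => change rp g.1 x n * x * _ = rp g.1 x n * x; rw [mul_assoc, bic_mul h]

theorem bic_R {x s : S} (h : Bic x) (hs : s ∈ (gen {x}).1) (hr : rr s = rr x) :
    ∃ n, s = rp (rr x).1 x n := by
  refine walk_eq {x} (rr x) (fun k => ∃ n, k = rp (rr x).1 x n) ⟨0, rfl⟩ ?_ hs hr
  rintro k c ⟨n, rfl⟩ - hc hr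
  rcases letter1 hc with rfl | rfl
  · exact ⟨n + 1, rfl⟩
  · cases n with
    | zero =>
      exfalso
      change rr ((rr x).1 * x⁻¹) = _ at hr
      rw [rr_gmul, inf_eq_left] at hr
      exact absurd h (not_lt_of_ge hr)
    | succ n => exact ⟨n, rp_mul_inv h le_rfl n⟩

theorem rp_r_le {x : S} (g : S) (n : ℕ) : rr (rp g x (n + 1))⁻¹ ≤ rr x⁻¹ := by
  change rr (rp g x n * x)⁻¹ ≤ _
  rw [mir, rr_mul]; exact cj_le _ _

/-- `⟨x⟩ ∩ H_{xx⁻¹}` is trivial for nongroup `x`. -/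
theorem HT {x s : S} (h : NG x) (hs : s ∈ (gen {x}).1) (h1 : rr s = rr x) (h2 : rr s⁻¹ = rr x) :
    s = (rr x).1 := by
  have bic : ∀ {x s : S}, Bic x → s ∈ (gen {x}).1 → rr s = rr x → rr s⁻¹ = rr x →
      s = (rr x).1 := by
    intro x s h hs h1 h2
    obtain ⟨n, rfl⟩ := bic_R h hs h1
    cases n with
    | zero => rfl
    | succ n =>
      exfalso
      have := rp_r_le (x := x) (rr x).1 n
      rw [h2] at this
      exact absurd h (not_lt_of_ge this)
  rcases tri h with h | h | h
  · rcases inc_R h hs h1.ge with k | k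
    · rwa [gmul_of_le h1.le] at k
    · rw [gmul_of_le h1.le] at k
      subst k
      exact absurd h2.symm h.ng
  · exact bic h hs h1 h2
  · have hx := mem_gen1 x
    have e1 : rr (x⁻¹ * s * x) = rr x⁻¹ := by
      rw [rr_mul, cj_mul, ← h2, cj_r, h1, cj_r']
    have e2 : rr (x⁻¹ * s * x)⁻¹ = rr x⁻¹ := by
      rw [mir, mir, ii, ← mul_assoc, rr_mul, cj_mul, ← h1, cj_r', h2, cj_r']
    have := bic (x := x⁻¹) (s := x⁻¹ * s * x) h
      (by rw [gen_inv]; exact mul_mem (mul_mem (inv_mem hx) hs) hx) e1 e2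
    have h3 : (rr x).1 * s * (rr x).1 = x * (x⁻¹ * s * x) * x⁻¹ := by
      change x * x⁻¹ * s * (x * x⁻¹) = _
      simp only [mul_assoc]
    rw [gmul_of_le h1.le, mulg_of_le h2.le, this] at h3
    rw [h3]
    exact congrArg Subtype.val (cj_r x)

/-- A general tool: equality in an `𝓗`-class. -/
theorem eq_of_H {g : E S} {U : Sb S} (hU : ∀ s ∈ U.1, rr s = g → rr s⁻¹ = g → s = g.1)
    {a b : S} (ha : a ∈ U.1) (hb : b ∈ U.1) (h1 : rr a = g) (h2 : rr b = g)
    (h3 : rr a⁻¹ = rr b⁻¹) : a = b := by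
  have k := hU (a * b⁻¹) (mul_mem ha (inv_mem hb))
    (by rw [rr_mul, ← h3, cj_r, h1])
    (by rw [mir, ii, rr_mul, h3, cj_r, h2])
  calc a = a * (rr b⁻¹).1 := by rw [← h3, mul_r]
    _ = a * b⁻¹ * b := by rw [← inv_mul_eq, mul_assoc]
    _ = g.1 * b := by rw [k]
    _ = b := gmul_of_le h2.le

theorem gen_uniq {x s : S} (h : NG x) (hs : s ∈ (gen {x}).1) (h1 : rr s = rr x)
    (h2 : rr s⁻¹ = rr x⁻¹) : s = x :=
  eq_of_H (g := rr x) (U := gen {x}) (fun _ hs h1 h2 => HT h hs h1 h2) hs (mem_gen1 x) h1 rfl h2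

end Mono

end ISG

namespace ISG

section EU
variable {S : Type*} [InverseSemigroup S]

/-- iterated conjugates -/
def ic (x : S) (t : E S) : ℕ → E S
  | 0 => t
  | n + 1 => cj x⁻¹ (ic x t n)

theorem inc_E {x : S} {t : E S} (ht : t.1 ∈ (gen {x}).1) :
    t = rr x ∨ t = rr x⁻¹ ∨ t ≤ rr x ⊓ rr x⁻¹ ∨ t ≤ cj x (rr x) ∨ t ≤ cj x⁻¹ (rr x⁻¹) := by
  have aux : ∀ (x : S) (t : E S), (t = rr x ∨ t = rr x⁻¹ ∨ t ≤ rr x ⊓ rr x⁻¹ ∨ t ≤ cj x (rr x) ∨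
      t ≤ cj x⁻¹ (rr x⁻¹)) → (cj x t = rr x ∨ cj x t = rr x⁻¹ ∨ cj x t ≤ rr x ⊓ rr x⁻¹ ∨
      cj x t ≤ cj x (rr x) ∨ cj x t ≤ cj x⁻¹ (rr x⁻¹)) := by
    intro x t ht
    rcases ht with rfl | rfl | h | h | h
    · right; right; right; left; exact le_rfl
    · left; exact cj_r x
    · right; right; right; left; exact cj_mono x (h.trans inf_le_left)
    · right; right; right; left; exact cj_mono x (h.trans (cj_le _ _))
    · right; right; left
      have := cj_mono x h
      rwa [cj_cj_inv] at this
  refine idem_ind _ ?_ ?_ (aux x) ?_ ht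
  · left; rfl
  · right; left; rfl
  · intro t ht
    have := aux x⁻¹ t (by rw [ii, inf_comm]; tauto)
    rw [ii, inf_comm] at this
    tauto

theorem inc_E' {x : S} (h : Inc x) {t : E S} (ht : t.1 ∈ (gen {x}).1) (h1 : t ≤ rr x⁻¹)
    (h2 : t ≠ rr x⁻¹) : t ≤ rr x ⊓ rr x⁻¹ ∨ t ≤ cj x⁻¹ (rr x⁻¹) := by
  rcases inc_E ht with rfl | rfl | h3 | h3 | h3
  · exact absurd h1 h.1
  · exact absurd rfl h2
  · left; exact h3
  · left; exact le_inf (h3.trans (cj_le _ _)) h1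
  · right; exact h3

theorem ic_le {x : S} (n : ℕ) : ic x (cj x⁻¹ (rr x⁻¹)) n ≤ cj x⁻¹ (rr x⁻¹) := by
  induction n with
  | zero => exact le_rfl
  | succ n ih => exact (cj_mono x⁻¹ ih).trans (cj_mono x⁻¹ (cj_le _ _))

theorem cj_ef (x : S) : cj x (rr x ⊓ rr x⁻¹) = cj x (rr x) := by
  rw [inf_comm, cj_inf_r]

theorem cj_ef' (x : S) : cj x⁻¹ (rr x ⊓ rr x⁻¹) = cj x⁻¹ (rr x⁻¹) := by
  rw [cj_inf_r']

theorem ef_le_p {x : S} (hq : cj x⁻¹ (rr x⁻¹) ≤ rr x ⊓ rr x⁻¹) :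
    rr x ⊓ rr x⁻¹ ≤ cj x (rr x) := by
  have := cj_mono x hq
  rwa [cj_cj_inv, cj_ef] at this

theorem inc_E2 {x : S} (hq : cj x⁻¹ (rr x⁻¹) ≤ rr x ⊓ rr x⁻¹) {t : E S}
    (ht : t.1 ∈ (gen {x}).1) :
    t = rr x ∨ t = rr x⁻¹ ∨ t = cj x (rr x) ∨ t = rr x ⊓ rr x⁻¹ ∨
      ∃ n, t = ic x (cj x⁻¹ (rr x⁻¹)) n := by
  have hp := ef_le_p hq
  refine idem_ind (x := x) (fun t => t = rr x ∨ t = rr x⁻¹ ∨ t = cj x (rr x) ∨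
    t = rr x ⊓ rr x⁻¹ ∨ ∃ n, t = ic x (cj x⁻¹ (rr x⁻¹)) n) ?_ ?_ ?_ ?_ ht
  · left; rfl
  · right; left; rfl
  · rintro t (rfl | rfl | rfl | rfl | ⟨n, rfl⟩)
    · right; right; left; rfl
    · left; exact cj_r x
    · right; right; left
      refine le_antisymm (cj_mono x (cj_le _ _)) ?_
      have := cj_mono x hp
      rwa [cj_ef] at this
    · right; right; left; exact cj_ef x
    · cases n with
      | zero => right; right; right; left; exact cj_cj_inv _ _
      | succ n =>
        right; right; right; right
        refine ⟨n, ?_⟩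
        change cj x (cj x⁻¹ _) = _
        rw [cj_cj_inv, inf_eq_right]
        exact (ic_le n).trans (hq.trans inf_le_left)
  · rintro t (rfl | rfl | rfl | rfl | ⟨n, rfl⟩)
    · right; left; exact cj_r' x
    · right; right; right; right; exact ⟨0, rfl⟩
    · right; right; right; left; rw [cj_inv_cj, inf_comm]
    · right; right; right; right; exact ⟨0, cj_ef' x⟩
    · right; right; right; right; exact ⟨n + 1, rfl⟩

theorem ic_le_r {x : S} (h : Bic x) (n : ℕ) : ic x (rr x) n ≤ rr x := by
  cases n with
  | zero => exact le_rfl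
  | succ n => exact (cj_le _ _).trans h.le

theorem cj_ic {x : S} (h : Bic x) (n : ℕ) : cj x (ic x (rr x) (n + 1)) = ic x (rr x) n := by
  change cj x (cj x⁻¹ _) = _
  rw [cj_cj_inv, inf_eq_right]
  exact ic_le_r h n

theorem bic_E {x : S} (h : Bic x) {t : E S} (ht : t.1 ∈ (gen {x}).1) :
    ∃ n, t = ic x (rr x) n := by
  refine idem_ind (x := x) (fun t => ∃ n, t = ic x (rr x) n) ⟨0, rfl⟩ ⟨1, (cj_r' x).symm⟩ ?_ ?_ ht
  · rintro t ⟨n, rfl⟩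
    cases n with
    | zero => exact ⟨0, cj_of_bic h⟩
    | succ n => exact ⟨n, cj_ic h n⟩
  · rintro t ⟨n, rfl⟩
    exact ⟨n + 1, rfl⟩

theorem ic_mem (x : S) (n : ℕ) : (ic x (rr x) n).1 ∈ (gen {x}).1 := by
  induction n with
  | zero => exact rr_mem (mem_gen1 x)
  | succ n ih => exact cj_mem (inv_mem (mem_gen1 x)) ih

theorem ic_anti {x : S} (h : Bic x) : StrictAnti (ic x (rr x)) := by
  apply strictAnti_nat_of_succ_lt
  intro n
  induction n with
  | zero => change cj x⁻¹ (rr x) < rr x; rw [cj_r']; exact h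
  | succ n ih =>
    refine lt_of_le_of_ne (cj_mono x⁻¹ ih.le) ?_
    intro k
    have := congrArg (cj x) k
    rw [cj_ic h, cj_ic h] at this
    exact ih.ne this

end EU

/-! ### Lattice isomorphisms -/

/-- Lattice isomorphisms with semilattice isomorphism on idempotents. -/
structure LI (S T : Type*) [InverseSemigroup S] [InverseSemigroup T] where
  F : Sb S ≃o Sb T
  ψ : E S ≃o E T
  mem : ∀ (e : E S) (U : Sb S), e.1 ∈ U.1 ↔ (ψ e).1 ∈ (F U).1

namespace LI
variable {S T : Type*} [InverseSemigroup S] [InverseSemigroup T]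

/-- The inverse lattice isomorphism. -/
def symm (L : LI S T) : LI T S where
  F := L.F.symm
  ψ := L.ψ.symm
  mem e U := by
    have := L.mem (L.ψ.symm e) (L.F.symm U)
    rw [OrderIso.apply_symm_apply, OrderIso.apply_symm_apply] at this
    exact this.symm

theorem sub {L : LI S T} {U V : Sb S} (h : U ≤ V) : L.F U ≤ L.F V := L.F.monotone h

theorem mem_of {L : LI S T} {U : Sb S} {f : E T} (h : f.1 ∈ (L.F U).1) :
    ∃ t : E S, t.1 ∈ U.1 ∧ f = L.ψ t := by
  refine ⟨L.ψ.symm f, ?_, (L.ψ.apply_symm_apply f).symm⟩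
  rw [L.mem, L.ψ.apply_symm_apply]; exact h

theorem F_single (L : LI S T) (e : E S) : L.F (gen {e.1}) = gen {(L.ψ e).1} := by
  apply le_antisymm
  · rw [← OrderIso.le_symm_apply, gen1_le]
    rw [L.mem, OrderIso.apply_symm_apply]
    exact mem_gen1 _
  · rw [gen1_le, ← L.mem]
    exact mem_gen1 _

theorem gen_idem (e : E S) {s : S} (h : s ∈ (gen {e.1}).1) : s = e.1 := by
  have : gen {e.1} ≤ ⟨{e.1}, ⟨by rintro a rfl b rfl; exact e.2, by rintro a rfl; exact inv_coe e⟩⟩ :=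
    gen1_le.2 rfl
  exact this h

/-- Triviality of maximal subgroups is preserved. -/
theorem group_transfer (L : LI S T) {U : Sb S} {t : E S}
    (h : ∀ s ∈ U.1, rr s = t → rr s⁻¹ = t → s = t.1) :
    ∀ v ∈ (L.F U).1, rr v = L.ψ t → rr v⁻¹ = L.ψ t → v = (L.ψ t).1 := by
  intro v hv h1 h2
  have hG : ∀ f : E T, f.1 ∈ (gen {v}).1 → f = L.ψ t := by
    intro f hf
    refine idem_ind (x := v) (fun f => f = L.ψ t) h1 h2 ?_ ?_ hf
    · rintro f rfl
      nth_rewrite 1 [← h2]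
      rw [cj_r, h1]
    · rintro f rfl
      nth_rewrite 1 [← h1]
      rw [cj_r', h2]
  have hle : L.F.symm (gen {v}) ≤ gen {t.1} := by
    intro s hs
    have key : ∀ f : E S, f.1 ∈ (L.F.symm (gen {v})).1 → f = t := by
      intro f hf
      rw [L.mem, OrderIso.apply_symm_apply] at hf
      exact L.ψ.injective (hG _ hf)
    have hsU : s ∈ U.1 := by
      have : L.F.symm (gen {v}) ≤ U := by
        rw [OrderIso.symm_apply_le, gen1_le]; exact hv
      exact this hs
    rw [h s hsU (key _ (rr_mem hs)) (key _ (rr_mem (inv_mem hs)))]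
    exact mem_gen1 _
  rw [OrderIso.symm_apply_le, F_single, gen1_le] at hle
  exact gen_idem _ hle

theorem F_gen2 (L : LI S T) {x : S} {y : T} (h : L.F (gen {x}) = gen {y}) (g : E S) :
    L.F (gen {x, g.1}) = gen {y, (L.ψ g).1} := by
  apply le_antisymm
  · rw [← OrderIso.le_symm_apply, gen_le]
    rintro s (rfl | rfl)
    · rw [← gen1_le, OrderIso.le_symm_apply, h, gen1_le]
      exact subset_gen _ (Or.inl rfl)
    · rw [L.mem, OrderIso.apply_symm_apply]
      exact subset_gen _ (Or.inr rfl)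
  · rw [gen_le]
    rintro s (rfl | rfl)
    · rw [← gen1_le, ← h]
      apply L.F.monotone
      rw [gen1_le]
      exact subset_gen _ (Or.inl rfl)
    · rw [← L.mem]
      exact subset_gen _ (Or.inr rfl)

/-- The correspondence on nongroup elements. -/
def Rel (L : LI S T) (x : S) (y : T) : Prop :=
  NG x ∧ L.F (gen {x}) = gen {y} ∧ rr y = L.ψ (rr x) ∧ rr y⁻¹ = L.ψ (rr x⁻¹)

variable {L : LI S T} {x : S} {y : T}

theorem Rel.inv (h : L.Rel x y) : L.Rel x⁻¹ y⁻¹ := by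
  refine ⟨h.1.inv, ?_, h.2.2.2, ?_⟩
  · rw [gen_inv, gen_inv]; exact h.2.1
  · rw [ii, ii]; exact h.2.2.1

theorem Rel.ng (h : L.Rel x y) : NG y := by
  intro k
  rw [h.2.2.1, h.2.2.2] at k
  exact h.1 (L.ψ.injective k)

theorem Rel.symm (h : L.Rel x y) : L.symm.Rel y x := by
  refine ⟨h.ng, ?_, ?_, ?_⟩
  · change L.F.symm _ = _
    rw [← h.2.1, OrderIso.symm_apply_apply]
  · change _ = L.ψ.symm _
    rw [h.2.2.1, OrderIso.symm_apply_apply]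
  · change _ = L.ψ.symm _
    rw [h.2.2.2, OrderIso.symm_apply_apply]

theorem Rel.inc (h : L.Rel x y) (k : Inc x) : Inc y := by
  unfold Inc
  rw [h.2.2.1, h.2.2.2, L.ψ.le_iff_le, L.ψ.le_iff_le]; exact k

theorem Rel.bic (h : L.Rel x y) (k : Bic x) : Bic y := by
  unfold Bic
  rw [h.2.2.1, h.2.2.2, L.ψ.lt_iff_lt]; exact k

theorem Rel.ef (h : L.Rel x y) : rr y ⊓ rr y⁻¹ = L.ψ (rr x ⊓ rr x⁻¹) := by
  rw [h.2.2.1, h.2.2.2, map_inf]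

theorem Rel.uniq {y' : T} (h : L.Rel x y) (h' : L.Rel x y') : y = y' := by
  apply gen_uniq h'.ng
  · rw [← h'.2.1, h.2.1]; exact mem_gen1 _
  · rw [h.2.2.1, h'.2.2.1]
  · rw [h.2.2.2, h'.2.2.2]

theorem Rel.ex (h : L.Rel x y) {f : E T} (hf : f.1 ∈ (gen {y}).1) :
    ∃ t : E S, t.1 ∈ (gen {x}).1 ∧ f = L.ψ t := by
  rw [← h.2.1] at hf
  exact mem_of hf

theorem q_mem (x : S) : (cj x⁻¹ (rr x⁻¹)).1 ∈ (gen {x}).1 :=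
  cj_mem (inv_mem (mem_gen1 x)) (rr_mem (inv_mem (mem_gen1 x)))

theorem Rel.q1 (h : L.Rel x y) (hi : Inc x) (hq : ¬ cj y⁻¹ (rr y⁻¹) ≤ rr y ⊓ rr y⁻¹) :
    cj y⁻¹ (rr y⁻¹) ≤ L.ψ (cj x⁻¹ (rr x⁻¹)) := by
  obtain ⟨t, ht, hft⟩ := h.ex (q_mem y)
  have h1 : t ≤ rr x⁻¹ := by
    rw [← L.ψ.le_iff_le, ← hft, ← h.2.2.2]; exact cj_le _ _
  have h2 : t ≠ rr x⁻¹ := by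
    rintro rfl
    rw [← h.2.2.2] at hft
    have := ge_of_cj hft.ge
    rw [ii] at this
    exact (h.inc hi).1 this
  rcases inc_E' hi ht h1 h2 with k | k
  · rw [← L.ψ.le_iff_le, ← h.ef, ← hft] at k
    exact absurd k hq
  · rw [hft, L.ψ.le_iff_le]; exact k

theorem Rel.qA (h : L.Rel x y) (hi : Inc x) (hq : cj x⁻¹ (rr x⁻¹) ≤ rr x ⊓ rr x⁻¹) :
    cj y⁻¹ (rr y⁻¹) ≤ rr y ⊓ rr y⁻¹ := by
  by_contra k
  apply k
  refine (h.q1 hi k).trans ?_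
  rw [h.ef, L.ψ.le_iff_le]; exact hq

theorem Rel.q2 (h : L.Rel x y) (hi : Inc x) (hq : cj x⁻¹ (rr x⁻¹) ≤ rr x ⊓ rr x⁻¹) :
    cj y⁻¹ (rr y⁻¹) ≤ L.ψ (cj x⁻¹ (rr x⁻¹)) := by
  have hq' := h.qA hi hq
  obtain ⟨t, ht, hft⟩ := h.ex (q_mem y)
  have h1 : t ≤ rr x ⊓ rr x⁻¹ := by
    rw [← L.ψ.le_iff_le, ← hft, ← h.ef]; exact hq'
  have key : t = rr x ⊓ rr x⁻¹ → cj y⁻¹ (rr y⁻¹) ≤ L.ψ (cj x⁻¹ (rr x⁻¹)) := by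
    rintro rfl
    rw [← h.ef] at hft
    have hp : cj y (rr y) = rr y ⊓ rr y⁻¹ := by
      rw [← cj_ef, ← hft, cj_cj_inv, hft]
    have h3 := h.inv.symm.qA (h.inc hi).inv (by rw [ii, inf_comm]; exact hp.le)
    rw [ii, inf_comm] at h3
    have h4 := le_antisymm h3 (ef_le_p hq)
    have h5 := congrArg (cj x⁻¹) h4
    rw [cj_inv_cj, cj_ef', inf_comm] at h5
    rw [hft, ← h5, h.ef]
  rcases inc_E2 hq ht with rfl | rfl | rfl | rfl | ⟨n, rfl⟩
  · exact absurd (h1.trans inf_le_right) hi.1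
  · exact absurd (h1.trans inf_le_left) hi.2
  · exact key (le_antisymm h1 (ef_le_p hq))
  · exact key rfl
  · rw [hft, L.ψ.le_iff_le]; exact ic_le n

theorem Rel.q_inc_le (h : L.Rel x y) (hi : Inc x) :
    cj y⁻¹ (rr y⁻¹) ≤ L.ψ (cj x⁻¹ (rr x⁻¹)) := by
  by_cases hq : cj x⁻¹ (rr x⁻¹) ≤ rr x ⊓ rr x⁻¹
  · exact h.q2 hi hq
  · refine h.q1 hi (fun k => hq ?_)
    exact h.symm.qA (h.inc hi) k

theorem Rel.q_inc (h : L.Rel x y) (hi : Inc x) :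
    cj y⁻¹ (rr y⁻¹) = L.ψ (cj x⁻¹ (rr x⁻¹)) := by
  apply le_antisymm (h.q_inc_le hi)
  have := h.symm.q_inc_le (h.inc hi)
  exact (OrderIso.le_symm_apply _).1 this

theorem Rel.q_bic_le (h : L.Rel x y) (hi : Bic x) :
    cj y⁻¹ (rr y⁻¹) ≤ L.ψ (cj x⁻¹ (rr x⁻¹)) := by
  obtain ⟨t, ht, hft⟩ := h.ex (q_mem y)
  have h1 : t < rr x⁻¹ := by
    rw [← L.ψ.lt_iff_lt, ← hft, ← h.2.2.2]
    have := ic_anti (h.bic hi) (show 1 < 2 by norm_num)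
    change cj y⁻¹ (cj y⁻¹ (rr y)) < cj y⁻¹ (rr y) at this
    rwa [cj_r'] at this
  rw [hft, L.ψ.le_iff_le]
  obtain ⟨n, rfl⟩ := bic_E hi ht
  have e1 : ic x (rr x) 1 = rr x⁻¹ := cj_r' x
  have e2 : ic x (rr x) 2 = cj x⁻¹ (rr x⁻¹) := by rw [← e1]; rfl
  rw [← e1, (ic_anti hi).lt_iff_gt] at h1
  rw [← e2, (ic_anti hi).le_iff_ge]
  exact h1

theorem Rel.q_bic (h : L.Rel x y) (hi : Bic x) :
    cj y⁻¹ (rr y⁻¹) = L.ψ (cj x⁻¹ (rr x⁻¹)) := by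
  apply le_antisymm (h.q_bic_le hi)
  have := h.symm.q_bic_le (h.bic hi)
  exact (OrderIso.le_symm_apply _).1 this

end LI

end ISG

namespace ISG

section Chain
variable {T : Type*} [InverseSemigroup T]

/-- `v` is an element of `V` going from the `i`-th to the `j`-th idempotent. -/
def Mv (V : Sb T) (gg : ℕ → E T) (v : T) (i j : ℕ) : Prop :=
  v ∈ V.1 ∧ rr v = gg i ∧ rr v⁻¹ = gg j

variable {V : Sb T} {gg : ℕ → E T}

theorem Mv.inv {v : T} {i j : ℕ} (h : Mv V gg v i j) : Mv V gg v⁻¹ j i :=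
  ⟨inv_mem h.1, h.2.2, by rw [ii]; exact h.2.1⟩

theorem Mv.comp {v w : T} {i j l : ℕ} (h : Mv V gg v i j) (h' : Mv V gg w j l) :
    Mv V gg (v * w) i l := by
  refine ⟨mul_mem h.1 h'.1, ?_, ?_⟩
  · rw [rr_mul, h'.2.1, ← h.2.2, cj_r, h.2.1]
  · rw [mir, rr_mul, h.2.2, ← h'.2.1, cj_r', h'.2.2]

theorem Mv.shift_le (ha : StrictAnti gg) (hE : ∀ f : E T, f.1 ∈ V.1 → ∃ n, f = gg n)
    (hE' : ∀ n, (gg n).1 ∈ V.1) {v : T} {i j : ℕ} (h : Mv V gg v i j) (k : ℕ) :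
    cj v⁻¹ (gg (i + k)) ≤ gg (j + k) := by
  induction k with
  | zero => change cj v⁻¹ (gg i) ≤ gg j; rw [← h.2.1, cj_r', h.2.2]
  | succ k ih =>
    obtain ⟨m, hm⟩ := hE _ (cj_mem (inv_mem h.1) (hE' (i + (k + 1))))
    have h1 : cj v⁻¹ (gg (i + (k + 1))) ≤ cj v⁻¹ (gg (i + k)) :=
      cj_mono _ (ha.antitone (by omega))
    have h2 := h1.trans ih
    rw [hm] at h2 ⊢
    rw [ha.le_iff_ge] at h2 ⊢
    by_contra hlt
    have hmk : m = j + k := by omega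
    subst hmk
    rw [← hm] at ih
    have h3 := cj_mono v ih
    rw [cj_cj_inv, cj_cj_inv, h.2.1, inf_eq_right.2 (ha.antitone (by omega)),
      inf_eq_right.2 (ha.antitone (by omega)), ha.le_iff_ge] at h3
    omega

theorem Mv.shift (ha : StrictAnti gg) (hE : ∀ f : E T, f.1 ∈ V.1 → ∃ n, f = gg n)
    (hE' : ∀ n, (gg n).1 ∈ V.1) {v : T} {i j : ℕ} (h : Mv V gg v i j) (k : ℕ) :
    cj v⁻¹ (gg (i + k)) = gg (j + k) := by
  apply le_antisymm (h.shift_le ha hE hE' k)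
  have h1 := cj_mono v⁻¹ (h.inv.shift_le ha hE hE' k)
  rw [ii, cj_inv_cj, h.2.2, inf_eq_right.2 (ha.antitone (by omega))] at h1
  exact h1

theorem Mv.restrict (ha : StrictAnti gg) (hE : ∀ f : E T, f.1 ∈ V.1 → ∃ n, f = gg n)
    (hE' : ∀ n, (gg n).1 ∈ V.1) {v : T} {i j : ℕ} (h : Mv V gg v i j) (k : ℕ) :
    Mv V gg ((gg (i + k)).1 * v) (i + k) (j + k) := by
  refine ⟨mul_mem (hE' _) h.1, ?_, ?_⟩
  · rw [rr_gmul, h.2.1, inf_eq_left]; exact ha.antitone (by omega)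
  · rw [rr_gmul_inv]; exact h.shift ha hE hE' k

theorem chain_gen (ha : StrictAnti gg) (hE : ∀ f : E T, f.1 ∈ V.1 → ∃ n, f = gg n)
    (hE' : ∀ n, (gg n).1 ∈ V.1)
    (hH : ∀ n, ∀ v ∈ V.1, rr v = gg n → rr v⁻¹ = gg n → v = (gg n).1)
    {y : T} {n : ℕ} (hn : 1 ≤ n) (hy : Mv V gg y 0 n)
    (hmin : ∀ m, 1 ≤ m → (∃ v, Mv V gg v 0 m) → n ≤ m) :
    ∀ v ∈ V.1, v ∈ (gen ({y} ∪ {t | ∃ k, t = (gg k).1})).1 := by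
  set G := gen ({y} ∪ {t | ∃ k, t = (gg k).1}) with hG
  have hyG : y ∈ G.1 := subset_gen _ (Or.inl rfl)
  have hgG : ∀ k, (gg k).1 ∈ G.1 := fun k => subset_gen _ (Or.inr ⟨k, rfl⟩)
  have pw : ∀ k, ∃ u ∈ G.1, Mv V gg u 0 (k * n) := by
    intro k
    induction k with
    | zero =>
      refine ⟨(gg 0).1, hgG 0, hE' 0, rr_coe _, ?_⟩
      rw [inv_coe, rr_coe]; simp
    | succ k ih =>
      obtain ⟨u, hu, hM⟩ := ih
      have h1 := hy.restrict ha hE hE' (k * n)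
      refine ⟨u * ((gg (0 + k * n)).1 * y), mul_mem hu (mul_mem (hgG _) hyG), ?_⟩
      have e1 : (k + 1) * n = n + k * n := by ring
      rw [e1]
      refine Mv.comp hM ?_
      rw [zero_add] at h1 ⊢
      exact h1
  have dv : ∀ d, ∀ v, Mv V gg v 0 d → n ∣ d := by
    intro d
    induction d using Nat.strong_induction_on with
    | _ d ih =>
      intro v hv
      rcases Nat.eq_zero_or_pos d with rfl | hd
      · exact dvd_zero n
      · have hle := hmin d hd ⟨v, hv⟩
        have h1 := hy.inv.restrict ha hE hE' (d - n)
        rw [Nat.add_sub_cancel' hle, zero_add] at h1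
        have h2 := ih (d - n) (by omega) _ (hv.comp h1)
        have := Nat.dvd_add h2 (dvd_refl n)
        rwa [Nat.sub_add_cancel hle] at this
  have main : ∀ i j v, i ≤ j → Mv V gg v i j → v ∈ G.1 := by
    intro i j v hij hv
    obtain ⟨u, hu, hM⟩ := pw i
    have hin : i ≤ i * n := Nat.le_mul_of_pos_right i hn
    obtain ⟨k, hk⟩ := Nat.exists_eq_add_of_le hin
    obtain ⟨l, rfl⟩ := Nat.exists_eq_add_of_le hij
    have h1 := hv.restrict ha hE hE' k
    rw [← hk] at h1
    have h2 := hM.comp h1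
    have h3 := hM.inv.restrict ha hE hE' l
    have e1 : i + l + k = i * n + l := by omega
    rw [e1] at h2
    have h4 := h2.comp h3
    rw [zero_add] at h4
    obtain ⟨c, rfl⟩ := dv _ _ h4
    obtain ⟨w, hw, hMw⟩ := pw c
    have h5 := hMw.restrict ha hE hE' i
    rw [zero_add] at h5
    have : v = (gg i).1 * w := by
      refine eq_of_H (hH i) hv.1 h5.1 hv.2.1 h5.2.1 ?_
      rw [hv.2.2, h5.2.2]; congr 1; ring
    rw [this]
    exact mul_mem (hgG _) hw
  intro v hv
  obtain ⟨i, hi⟩ := hE _ (rr_mem hv)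
  obtain ⟨j, hj⟩ := hE _ (rr_mem (inv_mem hv))
  rcases le_total i j with h | h
  · exact main i j v h ⟨hv, hi, hj⟩
  · exact inv_mem' (main j i v⁻¹ h (Mv.inv ⟨hv, hi, hj⟩))

end Chain

section MoreMono
variable {S : Type*} [InverseSemigroup S]

theorem NG.ne {x : S} (h : NG x) (e : E S) : x ≠ e.1 := by
  rintro rfl
  exact h (by rw [inv_coe])

theorem inc_max {x : S} (h : Inc x) {t : E S} (ht : t.1 ∈ (gen {x}).1) (h1 : rr x ≤ t) :
    t = rr x := by
  rcases inc_E ht with rfl | rfl | h3 | h3 | h3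
  · rfl
  · exact absurd h1 h.1
  · exact absurd ((h1.trans h3).trans inf_le_right) h.1
  · exact le_antisymm (h3.trans (cj_le _ _)) h1
  · exact absurd ((h1.trans h3).trans (cj_le _ _)) h.1

theorem inc_R' {x s : S} (h : Inc x) (hs : s ∈ (gen {x}).1) (hr : rr x ≤ rr s) :
    s = (rr x).1 ∨ s = x := by
  have h1 := inc_max h (rr_mem hs) hr
  have := inc_R h hs hr
  rwa [gmul_of_le h1.le] at this

theorem inc_prod {x s t : S} (h : Inc x) (hs : s ∈ (gen {x}).1) (ht : t ∈ (gen {x}).1)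
    (hst : s * t = x) : s = x ∨ t = x := by
  have h1 : rr x ≤ rr s := by rw [← hst]; exact rr_mul_le _ _
  have h2 : rr x⁻¹ ≤ rr t⁻¹ := by rw [← hst, mir]; exact rr_mul_le _ _
  rcases inc_R' h hs h1 with k1 | k1
  · rcases inc_R' h.inv (by rw [gen_inv]; exact inv_mem ht) h2 with k2 | k2
    · exfalso
      have k3 : t = (rr x⁻¹).1 := by
        rw [← ii t, k2, inv_coe]
      rw [k1, k3, ← coe_inf] at hst
      exact h.ng.ne _ hst.symm
    · right; rw [← ii t, k2, ii]
  · left; exact k1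

end MoreMono

namespace LI
variable {S T : Type*} [InverseSemigroup S] [InverseSemigroup T]

theorem ex_inc (L : LI S T) {x : S} (h : Inc x) : ∃ y, L.Rel x y := by
  let W : Sb S := ⟨{s | s ∈ (gen {x}).1 ∧ s ≠ x ∧ s ≠ x⁻¹}, by
    constructor
    · rintro s ⟨hs, hs1, hs2⟩ t ⟨ht, ht1, ht2⟩
      refine ⟨mul_mem hs ht, ?_, ?_⟩
      · intro k
        rcases inc_prod h hs ht k with k | k
        · exact hs1 k
        · exact ht1 k
      · intro k
        rcases inc_prod h.inv (by rw [gen_inv]; exact hs) (by rw [gen_inv]; exact ht) k with k | k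
        · exact hs2 k
        · exact ht2 k
    · rintro s ⟨hs, hs1, hs2⟩
      refine ⟨inv_mem hs, ?_, ?_⟩
      · intro k; exact hs2 (by rw [← k, ii])
      · intro k; exact hs1 (by rw [← ii s, k, ii])⟩
  have hW : ¬ gen {x} ≤ W := by
    rw [gen1_le]; intro k; exact k.2.1 rfl
  have hW' : ∀ U : Sb S, U ≤ gen {x} → ¬ U ≤ W → U = gen {x} := by
    intro U hU hUW
    apply le_antisymm hU
    rw [gen1_le]
    obtain ⟨s, hs, hsW⟩ := Set.not_subset.1 hUW
    by_contra k
    apply hsW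
    refine ⟨hU hs, ?_, ?_⟩
    · rintro rfl; exact k hs
    · rintro rfl; exact k (inv_mem' hs)
  have hW2 : ¬ L.F (gen {x}) ≤ L.F W := by rwa [L.F.le_iff_le]
  obtain ⟨y, hy, hyW⟩ := Set.not_subset.1 hW2
  have hgen : L.F (gen {x}) = gen {y} := by
    have h1 : L.F.symm (gen {y}) ≤ gen {x} := by
      rw [OrderIso.symm_apply_le, gen1_le]; exact hy
    have h2 : ¬ L.F.symm (gen {y}) ≤ W := by
      rw [OrderIso.symm_apply_le, gen1_le]; exact hyW
    rw [← hW' _ h1 h2, OrderIso.apply_symm_apply]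
  have two : ∀ x : S, Inc x → L.F (gen {x}) = gen {y} →
      rr y = L.ψ (rr x) ∨ rr y⁻¹ = L.ψ (rr x) := by
    intro x h hgen
    have hm : (L.ψ (rr x)).1 ∈ (gen {y}).1 := by
      rw [← hgen, ← L.mem]; exact rr_mem (mem_gen1 x)
    have key : ∀ f : E T, f.1 ∈ (gen {y}).1 → L.ψ (rr x) ≤ f → f = L.ψ (rr x) := by
      intro f hf hle
      rw [← hgen] at hf
      obtain ⟨t, ht, rfl⟩ := mem_of hf
      rw [inc_max h ht (L.ψ.le_iff_le.1 hle)]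
    have k1 := key _ (rr_mem (mem_gen1 y))
    have k2 := key _ (rr_mem (inv_mem (mem_gen1 y)))
    rcases inc_E hm with h3 | h3 | h3 | h3 | h3
    · left; exact h3.symm
    · right; exact h3.symm
    · left; exact k1 (h3.trans inf_le_left)
    · left; exact k1 (h3.trans (cj_le _ _))
    · right; exact k2 (h3.trans (cj_le _ _))
  have a1 := two x h hgen
  have a2 := two x⁻¹ h.inv (by rw [gen_inv]; exact hgen)
  have hne : L.ψ (rr x) ≠ L.ψ (rr x⁻¹) := fun k => h.ng (L.ψ.injective k)
  rcases a1 with a1 | a1 <;> rcases a2 with a2 | a2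
  · exact absurd (a1.symm.trans a2) hne
  · exact ⟨y, h.ng, hgen, a1, a2⟩
  · refine ⟨y⁻¹, h.ng, by rw [gen_inv]; exact hgen, a1, by rw [ii]; exact a2⟩
  · exact absurd (a1.symm.trans a2) hne

/-- trivial subgroups in the bicyclic case -/
theorem bic_HT {x : S} (h : Bic x) (n : ℕ) : ∀ s ∈ (gen {x}).1, rr s = ic x (rr x) n →
    rr s⁻¹ = ic x (rr x) n → s = (ic x (rr x) n).1 := by
  induction n with
  | zero => intro s hs h1 h2; exact HT h.ng hs h1 h2
  | succ n ih =>
    intro s hs h1 h2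
    have hf : ic x (rr x) (n + 1) ≤ rr x⁻¹ := cj_le _ _
    have hx := mem_gen1 x
    have key := ih (x * s * x⁻¹) (mul_mem (mul_mem hx hs) (inv_mem hx))
      (by
        rw [rr_mul, cj_mul, ← cj_inf_r s, h2, inf_eq_left.2 hf, ← h2, cj_r, h1, cj_ic h])
      (by
        rw [mir, mir, ii, ← mul_assoc, rr_mul, cj_mul, ← cj_inf_r' s, h1, inf_eq_left.2 hf, ← h1,
          cj_r', h2, cj_ic h])
    have h3 : (rr x⁻¹).1 * s * (rr x⁻¹).1 = x⁻¹ * (x * s * x⁻¹) * x := by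
      simp only [← inv_mul_eq, mul_assoc]
    rw [gmul_of_le (h1.le.trans hf), mulg_of_le (h2.le.trans hf), key] at h3
    rw [h3]
    change _ = x⁻¹ * _ * x⁻¹⁻¹
    rw [ii]

theorem ex_bic (L : LI S T) {x : S} (h : Bic x) : ∃ y, L.Rel x y := by
  set V := L.F (gen {x}) with hV
  set gg : ℕ → E T := fun n => L.ψ (ic x (rr x) n) with hgg
  have ha : StrictAnti gg := fun i j hij => L.ψ.strictMono (ic_anti h hij)
  have hE : ∀ f : E T, f.1 ∈ V.1 → ∃ n, f = gg n := by
    intro f hf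
    obtain ⟨t, ht, rfl⟩ := mem_of hf
    obtain ⟨n, rfl⟩ := bic_E h ht
    exact ⟨n, rfl⟩
  have hE' : ∀ n, (gg n).1 ∈ V.1 := fun n => (L.mem _ _).1 (ic_mem x n)
  have hH : ∀ n, ∀ v ∈ V.1, rr v = gg n → rr v⁻¹ = gg n → v = (gg n).1 := fun n =>
    L.group_transfer (bic_HT h n)
  have htop : ∀ f : E T, f.1 ∈ V.1 → f ≤ gg 0 := by
    intro f hf
    obtain ⟨n, rfl⟩ := hE f hf
    exact ha.antitone (Nat.zero_le n)
  have stepA : ∃ v ∈ V.1, rr v = gg 0 ∧ v ≠ (gg 0).1 := by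
    by_contra hcon
    push Not at hcon
    let V0 : Sb T := ⟨{v | v ∈ V.1 ∧ v ≠ (gg 0).1}, by
      constructor
      · rintro v ⟨hv, hv1⟩ w ⟨hw, hw1⟩
        refine ⟨mul_mem hv hw, fun k => hv1 ?_⟩
        apply hcon v hv
        apply le_antisymm (htop _ (rr_mem hv))
        have := rr_mul_le v w
        rwa [k, rr_coe] at this
      · rintro v ⟨hv, hv1⟩
        refine ⟨inv_mem hv, fun k => hv1 ?_⟩
        rw [← ii v, k, inv_coe]⟩
    have hU0 : L.F.symm V0 ≤ gen {x} := by
      rw [OrderIso.symm_apply_le]; exact fun v hv => hv.1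
    have heU0 : (rr x).1 ∉ (L.F.symm V0).1 := by
      rw [L.mem, OrderIso.apply_symm_apply]
      exact fun k => k.2 rfl
    have hx : x ∈ (gen ({(rr x).1} ∪ (L.F.symm V0).1)).1 := by
      rw [← gen1_le, ← L.F.le_iff_le]
      intro v hv
      by_cases k : v = (gg 0).1
      · rw [k]
        exact (L.mem (rr x) _).1 (subset_gen _ (Or.inl rfl))
      · have h1 : V0 ≤ L.F (gen ({(rr x).1} ∪ (L.F.symm V0).1)) := by
          rw [← OrderIso.symm_apply_le]
          exact fun s hs => subset_gen _ (Or.inr hs)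
        exact h1 ⟨hv, k⟩
    have := walk_eq _ (rr x) (fun k => k = (rr x).1) rfl ?_ hx rfl
    · exact h.ng.ne _ this
    · rintro k c rfl - hc hr
      have hc' : c = (rr x).1 ∨ c ∈ (L.F.symm V0).1 := by
        rcases hc with (hc | hc) | (hc | hc)
        · left; exact hc
        · right; exact hc
        · left
          rw [← ii c, show c⁻¹ = (rr x).1 from hc, inv_coe]
        · right; exact inv_mem' hc
      rcases hc' with rfl | hc'
      · exact (rr x).2
      · exfalso
        rw [rr_gmul, inf_eq_left] at hr
        obtain ⟨n, hn⟩ := bic_E h (rr_mem (hU0 hc'))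
        have h2 : rr c = rr x := by
          apply le_antisymm _ hr
          rw [hn]; exact ic_le_r h n
        exact heU0 (h2 ▸ rr_mem hc')
  have hex : ∃ n, 1 ≤ n ∧ ∃ v, Mv V gg v 0 n := by
    obtain ⟨v, hv, h1, h2⟩ := stepA
    obtain ⟨m, hm⟩ := hE _ (rr_mem (inv_mem hv))
    refine ⟨m, ?_, v, hv, h1, hm⟩
    by_contra k
    have : m = 0 := by omega
    subst this
    exact h2 (hH 0 v hv h1 hm)
  classical
  obtain ⟨hn, y, hy⟩ := Nat.find_spec hex
  have hmin : ∀ m, 1 ≤ m → (∃ v, Mv V gg v 0 m) → Nat.find hex ≤ m :=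
    fun m h1 h2 => Nat.find_min' hex ⟨h1, h2⟩
  generalize Nat.find hex = n at hn hy hmin
  have hVG := chain_gen ha hE hE' hH hn hy hmin
  have hyV : gen {y} ≤ V := gen1_le.2 hy.1
  have hFs : x ∈ (L.F.symm (gen {y})).1 := by
    have hx : x ∈ (gen ((L.F.symm (gen {y})).1 ∪ {t | ∃ e : E S, t = e.1})).1 := by
      rw [← gen1_le, ← L.F.le_iff_le]
      have h1 : gen ({y} ∪ {t | ∃ k, t = (gg k).1}) ≤
          L.F (gen ((L.F.symm (gen {y})).1 ∪ {t | ∃ e : E S, t = e.1})) := by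
        rw [gen_le]
        rintro t (rfl | ⟨k, rfl⟩)
        · rw [← gen1_le, ← OrderIso.symm_apply_le]
          exact fun s hs => subset_gen _ (Or.inl hs)
        · rw [← L.mem]
          exact subset_gen _ (Or.inr ⟨_, rfl⟩)
      exact fun v hv => h1 (hVG v hv)
    refine walk_eq _ (rr x) (fun k => k ∈ (L.F.symm (gen {y})).1) ?_ ?_ hx rfl
    · rw [L.mem, OrderIso.apply_symm_apply]
      change (gg 0).1 ∈ _
      rw [← hy.2.1]; exact rr_mem (mem_gen1 y)
    · rintro k c hk hkr hc hr
      have hc' : c ∈ (L.F.symm (gen {y})).1 ∨ ∃ e : E S, c = e.1 := by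
        rcases hc with (hc | hc) | (hc | ⟨e, hc⟩)
        · left; exact hc
        · right; exact hc
        · left; exact inv_mem' hc
        · right
          exact ⟨e, by rw [← ii c, hc, inv_coe]⟩
      rcases hc' with hc' | ⟨e, rfl⟩
      · exact mul_mem hk hc'
      · rw [rr_mul, rr_coe] at hr
        rw [mul_g, hr, gmul_of_le hkr.le]
        exact hk
  have hgen : L.F (gen {x}) = gen {y} := by
    apply le_antisymm _ hyV
    rw [← OrderIso.le_symm_apply, gen1_le]
    exact hFs
  have hBy : Bic y := by
    unfold Bic
    rw [hy.2.1, hy.2.2]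
    exact ha (by omega)
  refine ⟨y, h.ng, hgen, hy.2.1, ?_⟩
  have h1 : L.ψ (rr x⁻¹) = gg 1 := by
    rw [hgg]; change _ = L.ψ (cj x⁻¹ (rr x)); rw [cj_r']
  rw [h1, hy.2.2]
  have h2 : (gg 1).1 ∈ (gen {y}).1 := by rw [← hgen]; exact hE' 1
  obtain ⟨m, hm⟩ := bic_E hBy h2
  have hm0 : m ≠ 0 := by
    rintro rfl
    change gg 1 = rr y at hm
    rw [hy.2.1] at hm
    have := ha.injective hm
    omega
  have h3 : gg 1 ≤ gg n := by
    rw [← hy.2.2, hm, ← cj_r' y]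
    exact (ic_anti hBy).antitone (show 1 ≤ m by omega)
  rw [ha.le_iff_ge] at h3
  congr 1; omega

theorem ex (L : LI S T) {x : S} (h : NG x) : ∃ y, L.Rel x y := by
  rcases tri h with h | h | h
  · exact L.ex_inc h
  · exact L.ex_bic h
  · obtain ⟨y, hy⟩ := L.ex_bic h
    have := hy.inv
    rw [ii] at this
    exact ⟨_, this⟩

end LI

end ISG

namespace ISG

/-! ### The class of `e ⊓ f` in a monogenic inverse subsemigroup -/

section EF
variable {S : Type*} [InverseSemigroup S]

theorem ef_HT_lt {x : S} (hp : cj x (rr x) < rr x ⊓ rr x⁻¹) :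
    ∀ s ∈ (gen {x}).1, rr s = rr x ⊓ rr x⁻¹ → rr s⁻¹ = rr x ⊓ rr x⁻¹ →
      s = (rr x ⊓ rr x⁻¹).1 := by
  intro s hs h1 h2
  have hL : ∀ n, rr (rp (rr x ⊓ rr x⁻¹).1 x⁻¹ (n + 1))⁻¹ ≤ cj x (rr x) := by
    have aux : ∀ n, rr (rp (rr x ⊓ rr x⁻¹).1 x⁻¹ n)⁻¹ ≤ rr x ⊓ rr x⁻¹ := by
      intro n
      induction n with
      | zero => change rr ((rr x ⊓ rr x⁻¹).1)⁻¹ ≤ _; rw [inv_coe, rr_coe]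
      | succ n ih =>
        change rr (rp (rr x ⊓ rr x⁻¹).1 x⁻¹ n * x⁻¹)⁻¹ ≤ _
        rw [mir, ii, rr_mul]
        refine (cj_mono x ih).trans ?_
        rw [cj_ef]; exact hp.le
    intro n
    change rr (rp (rr x ⊓ rr x⁻¹).1 x⁻¹ n * x⁻¹)⁻¹ ≤ _
    rw [mir, ii, rr_mul, ← cj_ef]
    exact cj_mono x (aux n)
  have hw := walk_eq {x} (rr x ⊓ rr x⁻¹)
    (fun k => k = (rr x ⊓ rr x⁻¹).1 * x ∨ ∃ n, k = rp (rr x ⊓ rr x⁻¹).1 x⁻¹ n)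
    (Or.inr ⟨0, rfl⟩) (by
      rintro k c (rfl | ⟨n, rfl⟩) - hc hr
      · rcases letter1 hc with hk | hk <;> rw [hk] at hr ⊢
        · exfalso
          rw [mul_assoc, rr_gmul, rr_mul, inf_eq_left] at hr
          exact absurd hp (not_lt_of_ge hr)
        · right; refine ⟨0, ?_⟩
          rw [mul_assoc, mul_inv_eq]
          exact inf_le_left (a := rr x) (b := rr x⁻¹)
      · rcases letter1 hc with hk | hk <;> rw [hk] at hr ⊢
        · cases n with
          | zero => left; rfl
          | succ n =>
            right; refine ⟨n, ?_⟩
            change rp (rr x ⊓ rr x⁻¹).1 x⁻¹ n * x⁻¹ * x = _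
            rw [mul_assoc, inv_mul_eq]
            cases n with
            | zero => exact inf_le_right (a := rr x) (b := rr x⁻¹)
            | succ n =>
              apply mulg_of_le
              exact (hL n).trans (hp.le.trans inf_le_right)
        · right; exact ⟨n + 1, rfl⟩) hs h1
  rcases hw with rfl | ⟨n, rfl⟩
  · exfalso
    rw [rr_gmul_inv] at h2
    have := congrArg (cj x) h2
    rw [cj_cj_inv, cj_ef] at this
    rw [← this] at hp
    refine absurd hp (not_lt_of_ge ?_)
    exact le_inf inf_le_left le_rfl
  · cases n with
    | zero => rfl
    | succ n => exact absurd hp (not_lt_of_ge (h2 ▸ hL n))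

theorem ef_HT_inc {x : S} (hp : ¬ cj x (rr x) ≤ rr x ⊓ rr x⁻¹)
    (hq : ¬ cj x⁻¹ (rr x⁻¹) ≤ rr x ⊓ rr x⁻¹) :
    ∀ s ∈ (gen {x}).1, rr s = rr x ⊓ rr x⁻¹ → rr s⁻¹ = rr x ⊓ rr x⁻¹ →
      s = (rr x ⊓ rr x⁻¹).1 := by
  intro s hs h1 h2
  have hw := walk_eq {x} (rr x ⊓ rr x⁻¹)
    (fun k => k = (rr x ⊓ rr x⁻¹).1 ∨ k = (rr x ⊓ rr x⁻¹).1 * x ∨ k = (rr x ⊓ rr x⁻¹).1 * x⁻¹)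
    (Or.inl rfl) (by
      rintro k c (rfl | rfl | rfl) - hc hr
      · rcases letter1 hc with hk | hk <;> rw [hk] at hr ⊢
        · right; left; rfl
        · right; right; rfl
      · rcases letter1 hc with hk | hk <;> rw [hk] at hr ⊢
        · exfalso
          rw [mul_assoc, rr_gmul, rr_mul, inf_eq_left] at hr
          have := cj_mono x⁻¹ hr
          rw [cj_inv_cj, cj_ef', inf_comm] at this
          exact hq this
        · left
          rw [mul_assoc, mul_inv_eq]
          exact inf_le_left (a := rr x) (b := rr x⁻¹)
      · rcases letter1 hc with hk | hk <;> rw [hk] at hr ⊢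
        · left
          rw [mul_assoc, inv_mul_eq]
          exact inf_le_right (a := rr x) (b := rr x⁻¹)
        · exfalso
          rw [mul_assoc, rr_gmul, rr_mul, inf_eq_left] at hr
          have := cj_mono x hr
          rw [cj_cj_inv, cj_ef] at this
          exact hp this) hs h1
  rcases hw with rfl | rfl | rfl
  · rfl
  · exfalso
    rw [rr_gmul_inv, cj_ef'] at h2
    exact hq h2.le
  · exfalso
    rw [rr_gmul_inv, ii, cj_ef] at h2
    exact hp h2.le

theorem ef_HT {x : S} (hq : cj x⁻¹ (rr x⁻¹) ≠ rr x ⊓ rr x⁻¹) :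
    ∀ s ∈ (gen {x}).1, rr s = rr x ⊓ rr x⁻¹ → rr s⁻¹ = rr x ⊓ rr x⁻¹ →
      s = (rr x ⊓ rr x⁻¹).1 := by
  by_cases h1 : cj x (rr x) ≤ rr x ⊓ rr x⁻¹
  · refine ef_HT_lt (lt_of_le_of_ne h1 fun k => hq ?_)
    have := congrArg (cj x⁻¹) k
    rw [cj_inv_cj, cj_ef', inf_comm] at this
    exact this.symm
  · by_cases h2 : cj x⁻¹ (rr x⁻¹) ≤ rr x ⊓ rr x⁻¹
    · have := ef_HT_lt (x := x⁻¹) (by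
        rw [ii, inf_comm]; exact lt_of_le_of_ne h2 hq)
      rw [ii, inf_comm, gen_inv] at this
      exact this
    · exact ef_HT_inc h1 h2

theorem ef_HT_idem {x : S} (hz : (rr x ⊓ rr x⁻¹).1 * x = (rr x ⊓ rr x⁻¹).1) :
    ∀ s ∈ (gen {x}).1, rr s = rr x ⊓ rr x⁻¹ → rr s⁻¹ = rr x ⊓ rr x⁻¹ →
      s = (rr x ⊓ rr x⁻¹).1 := by
  intro s hs h1 _
  refine walk_eq {x} (rr x ⊓ rr x⁻¹) (fun k => k = (rr x ⊓ rr x⁻¹).1) rfl ?_ hs h1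
  rintro k c rfl - hc -
  rcases letter1 hc with rfl | rfl
  · exact hz
  · conv_lhs => rw [← hz, mul_assoc, mul_inv_eq]
    exact inf_le_left (a := rr x) (b := rr x⁻¹)

/-- A nongroup element or an idempotent. -/
def NI (z : S) : Prop := NG z ∨ z = (rr z).1

end EF

namespace LI
variable {S T : Type*} [InverseSemigroup S] [InverseSemigroup T] {L : LI S T} {x : S} {y : T}

/-- Extended correspondence. -/
def RelE (L : LI S T) (a : S) (b : T) : Prop :=
  L.Rel a b ∨ ∃ e : E S, a = e.1 ∧ b = (L.ψ e).1

theorem RelE.inv {a : S} {b : T} (h : L.RelE a b) : L.RelE a⁻¹ b⁻¹ := by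
  rcases h with h | ⟨e, rfl, rfl⟩
  · exact Or.inl h.inv
  · exact Or.inr ⟨e, inv_coe e, inv_coe _⟩

theorem RelE.r {a : S} {b : T} (h : L.RelE a b) : rr b = L.ψ (rr a) := by
  rcases h with h | ⟨e, rfl, rfl⟩
  · exact h.2.2.1
  · rw [rr_coe, rr_coe]

theorem RelE.d {a : S} {b : T} (h : L.RelE a b) : rr b⁻¹ = L.ψ (rr a⁻¹) := h.inv.r

/-- The key comparison, when the relevant subgroup is trivial. -/
theorem key_HT (h : L.Rel x y) {g : E S} (hg : g ≤ rr x) (hgm : g.1 ∈ (gen {x}).1)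
    (hT : ∀ s ∈ (gen {x}).1, rr s = g → rr s⁻¹ = g → s = g.1)
    (hq : cj y⁻¹ (L.ψ g) = L.ψ (cj x⁻¹ g)) (hz : NI (g.1 * x)) :
    L.RelE (g.1 * x) ((L.ψ g).1 * y) := by
  have hT' := L.group_transfer hT
  rw [h.2.1] at hT'
  have hg' : L.ψ g ≤ rr y := by rw [h.2.2.1, L.ψ.le_iff_le]; exact hg
  have hgm' : (L.ψ g).1 ∈ (gen {y}).1 := by rw [← h.2.1, ← L.mem]; exact hgm
  have hm : (L.ψ g).1 * y ∈ (gen {y}).1 := mul_mem hgm' (mem_gen1 y)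
  have hr : rr ((L.ψ g).1 * y) = L.ψ g := by rw [rr_gmul, inf_eq_left.2 hg']
  have hrx : rr (g.1 * x) = g := by rw [rr_gmul, inf_eq_left.2 hg]
  rcases hz with hz | hz
  · left
    obtain ⟨w, hw⟩ := L.ex hz
    have : w = (L.ψ g).1 * y := by
      refine eq_of_H hT' ?_ hm ?_ hr ?_
      · rw [← gen1_le, ← hw.2.1, ← h.2.1]
        apply L.F.monotone
        rw [gen1_le]; exact mul_mem hgm (mem_gen1 x)
      · rw [hw.2.2.1, hrx]
      · rw [hw.2.2.2, rr_gmul_inv, rr_gmul_inv, hq]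
    rw [← this]; exact hw
  · right
    rw [hrx] at hz
    refine ⟨g, hz, hT' _ hm hr ?_⟩
    rw [rr_gmul_inv, hq, ← rr_gmul_inv, hz, inv_coe, rr_coe]

theorem C_inc (h : L.Rel x y) (hi : Inc x) (hz : NI ((rr x ⊓ rr x⁻¹).1 * x)) :
    L.RelE ((rr x ⊓ rr x⁻¹).1 * x) ((L.ψ (rr x ⊓ rr x⁻¹)).1 * y) := by
  refine key_HT h inf_le_left ?_ ?_ ?_ hz
  · rw [coe_inf]; exact mul_mem (rr_mem (mem_gen1 x)) (rr_mem (inv_mem (mem_gen1 x)))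
  · have hr : rr ((rr x ⊓ rr x⁻¹).1 * x) = rr x ⊓ rr x⁻¹ := by
      rw [rr_gmul, inf_eq_left.2 inf_le_left]
    rcases hz with hz | hz
    · refine ef_HT fun k => hz ?_
      rw [hr, rr_gmul_inv, cj_ef', k]
    · rw [hr] at hz; exact ef_HT_idem hz
  · rw [← h.ef, cj_ef', cj_ef']; exact h.q_inc hi

theorem C_bic (h : L.Rel x y) (hi : Bic x) (hz : NI ((rr x⁻¹).1 * x)) :
    L.RelE ((rr x⁻¹).1 * x) ((L.ψ (rr x⁻¹)).1 * y) := by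
  refine key_HT h hi.le (rr_mem (inv_mem (mem_gen1 x))) ?_ ?_ hz
  · have := fun s hs => LI.bic_HT hi 1 (s := s) hs
    change ∀ s ∈ _, rr s = cj x⁻¹ (rr x) → rr s⁻¹ = cj x⁻¹ (rr x) → s = (cj x⁻¹ (rr x)).1 at this
    rw [cj_r'] at this
    exact this
  · rw [← h.2.2.2]; exact h.q_bic hi

end LI

end ISG

namespace ISG

theorem NI.inv {S : Type*} [InverseSemigroup S] {z : S} (h : NI z) : NI z⁻¹ := by
  rcases h with h | h
  · exact Or.inl h.inv
  · right
    rw [h, inv_coe, rr_coe]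

theorem mul_g_eq {S : Type*} [InverseSemigroup S] {k : S} {g : E S} (h1 : rr k = g)
    (h2 : rr (k * g.1) = g) : k * g.1 = k := by
  rw [rr_mul, rr_coe] at h2
  rw [mul_g, h2]
  exact gmul_of_le h1.le

namespace LI
variable {S T : Type*} [InverseSemigroup S] [InverseSemigroup T] {L : LI S T} {x : S} {y : T}

theorem gx_inv {S : Type*} [InverseSemigroup S] (x : S) (g : E S) :
    (g.1 * x⁻¹)⁻¹ = (cj x g).1 * x := by
  rw [mir, ii, inv_coe, mul_g]

theorem inv_tr {k : E S} (h : L.RelE (k.1 * x⁻¹) ((L.ψ k).1 * y⁻¹)) :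
    L.RelE ((cj x k).1 * x) ((L.ψ (cj x k)).1 * y) := by
  have h := h.inv
  rw [gx_inv, gx_inv] at h
  have := h.r
  rw [rr_gmul, rr_gmul, inf_eq_left.2 (cj_le _ _), inf_eq_left.2 (cj_le _ _)] at this
  rwa [this] at h

theorem gx_NI {k : E S} (h : NI ((cj x k).1 * x)) : NI (k.1 * x⁻¹) := by
  rw [← gx_inv] at h
  have := h.inv
  rwa [ii] at this

theorem G_mem {g : E S} (h : L.Rel x y) {w : T} (hw : L.Rel (g.1 * x) w) :
    w ∈ (gen {y, (L.ψ g).1}).1 := by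
  rw [← L.F_gen2 h.2.1, ← gen1_le, ← hw.2.1]
  apply L.F.monotone
  rw [gen1_le]
  exact mul_mem (subset_gen _ (Or.inr rfl)) (subset_gen _ (Or.inl rfl))

theorem G_ng {g : E S} (hg : g ≤ rr x) (hgf : ¬ g ≤ rr x⁻¹) : NG (g.1 * x) := by
  intro k
  rw [rr_gmul, inf_eq_left.2 hg, rr_gmul_inv] at k
  exact hgf (k ▸ cj_le _ _)

theorem G_inc (h : L.Rel x y) (hi : Inc x) {g : E S} (hg : g ≤ rr x) (hgf : ¬ g ≤ rr x⁻¹)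
    (hgp : ¬ g ≤ cj x (rr x)) : L.Rel (g.1 * x) ((L.ψ g).1 * y) := by
  obtain ⟨w, hw⟩ := L.ex (G_ng hg hgf)
  have hr : rr w = L.ψ g := by rw [hw.2.2.1, rr_gmul, inf_eq_left.2 hg]
  have hgy : L.ψ g ≤ rr y := by rw [h.2.2.1, L.ψ.le_iff_le]; exact hg
  have hgf' : ¬ L.ψ g ≤ rr y⁻¹ := by rw [h.2.2.2, L.ψ.le_iff_le]; exact hgf
  have hgp' : ¬ L.ψ g ≤ cj y (rr y) := by
    have := h.inv.q_inc hi.inv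
    rw [ii, ii] at this
    rw [this, L.ψ.le_iff_le]; exact hgp
  have hK := walk_eq {y, (L.ψ g).1} (L.ψ g)
    (fun k => k = (L.ψ g).1 ∨ k = (L.ψ g).1 * y) (Or.inl rfl) (by
      intro k c hk hrk hc hr
      rcases letter2 hc with hc | hc | hc
      · rw [hc] at hr ⊢
        rcases hk with rfl | rfl
        · right; rfl
        · exfalso
          rw [mul_assoc, rr_gmul, rr_mul, inf_eq_left] at hr
          exact hgp' hr
      · rw [hc] at hr ⊢
        rcases hk with rfl | rfl
        · exfalso
          rw [rr_gmul, inf_eq_left] at hr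
          exact hgf' hr
        · left
          rw [mul_assoc, mul_inv_eq]
          exact hgy
      · rw [hc] at hr ⊢
        rw [mul_g_eq hrk hr]; exact hk) (G_mem h hw) hr
  rcases hK with hK | hK
  · exact absurd hK (hw.ng.ne _)
  · rw [← hK]; exact hw

theorem G_bic (h : L.Rel x y) (hi : Bic x) {g : E S} (hg : g ≤ rr x) (hgf : ¬ g ≤ rr x⁻¹) :
    L.Rel (g.1 * x) ((L.ψ g).1 * y) := by
  obtain ⟨w, hw⟩ := L.ex (G_ng hg hgf)
  have hr : rr w = L.ψ g := by rw [hw.2.2.1, rr_gmul, inf_eq_left.2 hg]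
  have hgy : L.ψ g ≤ rr y := by rw [h.2.2.1, L.ψ.le_iff_le]; exact hg
  have hgf' : ¬ L.ψ g ≤ rr y⁻¹ := by rw [h.2.2.2, L.ψ.le_iff_le]; exact hgf
  have hK := walk_eq {y, (L.ψ g).1} (L.ψ g)
    (fun k => ∃ n, k = rp (L.ψ g).1 y n) ⟨0, rfl⟩ (by
      intro k c hk hrk hc hr
      rcases letter2 hc with hc | hc | hc
      · rw [hc] at hr ⊢
        obtain ⟨n, rfl⟩ := hk
        exact ⟨n + 1, rfl⟩
      · rw [hc] at hr ⊢
        obtain ⟨n, rfl⟩ := hk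
        cases n with
        | zero =>
          exfalso
          change rr ((L.ψ g).1 * y⁻¹) = _ at hr
          rw [rr_gmul, inf_eq_left] at hr
          exact hgf' hr
        | succ n => exact ⟨n, rp_mul_inv (h.bic hi) hgy n⟩
      · rw [hc] at hr ⊢
        rw [mul_g_eq hrk hr]; exact hk) (G_mem h hw) hr
  obtain ⟨n, hK⟩ := hK
  match n, hK with
  | 0, hK => exact absurd hK (hw.ng.ne _)
  | 1, hK => 
    have hK : w = (L.ψ g).1 * y := hK
    rw [← hK]; exact hw
  | n + 2, hK =>
    exfalso
    have h1 := rp_r_le (x := y) (L.ψ g).1 n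
    have h2 := cj_mono y⁻¹ h1
    rw [← rr_mul, ← mir] at h2
    have h3 : w = rp (L.ψ g).1 y (n + 1) * y := hK
    rw [← h3, hw.2.2.2, h.q_bic hi, L.ψ.le_iff_le, rr_gmul_inv] at h2
    have h4 := cj_mono x h2
    rw [cj_cj_inv, cj_cj_inv, inf_eq_right.2 hg] at h4
    exact hgf (h4.trans inf_le_right)

/-- The main step. -/
theorem M (h : L.Rel x y) {g : E S} (hg : g < rr x)
    (hc : ∀ t : E S, t.1 ∈ (gen {x}).1 → ¬ (g < t ∧ t < rr x)) (hz : NI (g.1 * x)) :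
    L.RelE (g.1 * x) ((L.ψ g).1 * y) := by
  have hx := mem_gen1 x
  have hpm : (cj x (rr x)).1 ∈ (gen {x}).1 := cj_mem hx (rr_mem hx)
  have hcov : ∀ t : E S, t.1 ∈ (gen {x}).1 → t < rr x → g ≤ t → g = t := by
    intro t ht h1 h2
    by_contra k
    exact hc t ht ⟨lt_of_le_of_ne h2 k, h1⟩
  have hplt : ¬ rr x⁻¹ ≤ rr x → cj x (rr x) < rr x := by
    intro k
    refine lt_of_le_of_ne (cj_le _ _) fun k' => k (ge_of_cj k'.ge)
  rcases tri h.1 with hi | hi | hi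
  · by_cases h1 : g ≤ rr x⁻¹
    · have : g = rr x ⊓ rr x⁻¹ := by
        refine hcov _ ?_ ?_ (le_inf hg.le h1)
        · rw [coe_inf]; exact mul_mem (rr_mem hx) (rr_mem (inv_mem hx))
        · exact lt_of_le_of_ne inf_le_left fun k => hi.1 (inf_eq_left.1 k)
      subst this
      exact C_inc h hi hz
    · by_cases h2 : g ≤ cj x (rr x)
      · have hgp := hcov _ hpm (hplt hi.2) h2
        rw [← cj_ef] at hgp
        subst hgp
        apply inv_tr
        have := gx_NI hz
        have h3 := C_inc h.inv hi.inv
        rw [ii, inf_comm (rr x⁻¹)] at h3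
        exact h3 this
      · exact Or.inl (G_inc h hi hg.le h1 h2)
  · by_cases h1 : g ≤ rr x⁻¹
    · have := hcov _ (rr_mem (inv_mem hx)) hi h1
      subst this
      exact C_bic h hi hz
    · exact Or.inl (G_bic h hi hg.le h1)
  · have hlt : ¬ rr x⁻¹ ≤ rr x := by
      unfold Bic at hi
      rw [ii] at hi
      exact not_le_of_gt hi
    by_cases h2 : g ≤ cj x (rr x)
    · have hgp := hcov _ hpm (hplt hlt) h2
      subst hgp
      apply inv_tr
      have := gx_NI hz
      have h3 := C_bic h.inv hi
      rw [ii] at h3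
      exact h3 this
    · have h1 : g = cj x (cj x⁻¹ g) := by rw [cj_cj_inv, inf_eq_right.2 hg.le]
      rw [h1]
      apply inv_tr
      refine Or.inl (G_bic h.inv hi (cj_le _ _) ?_)
      rw [ii]
      intro k
      apply h2
      rw [h1]
      exact cj_mono x k

end LI

/-! ### From the frozen definitions -/

section Fr
variable {S : Type*} [InverseSemigroup S]

theorem lt_iff {e f : E S} : idemLt e.1 f.1 ↔ e < f := by
  rw [lt_iff_le_and_ne, le_def]
  unfold idemLt idemLe
  rw [ne_eq, ne_eq, Subtype.ext_iff]

theorem ns_iff {x : S} : x ∈ NS S ↔ NG x := by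
  change x * x⁻¹ ≠ x⁻¹ * x ↔ rr x ≠ rr x⁻¹
  rw [mul_inv_eq, inv_mul_eq, ne_eq, ne_eq, Subtype.ext_iff]

theorem tight_iff {x : S} {g : E S} (h : TightXCov x g.1) : g < rr x ∧
    (∀ t : E S, t.1 ∈ (gen {x}).1 → ¬ (g < t ∧ t < rr x)) ∧ NI (g.1 * x) := by
  refine ⟨lt_iff.1 h.1.1, fun t ht k => h.1.2 t.1 ht t.2 ⟨lt_iff.2 k.1, lt_iff.2 k.2⟩, ?_⟩
  rcases h.2 with k | k
  · exact Or.inl (ns_iff.1 k)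
  · exact Or.inr (idem_iff.1 k)

end Fr

namespace LI
variable {S T : Type*} [InverseSemigroup S] [InverseSemigroup T] {L : LI S T}

theorem ME {a : S} {b : T} (h : L.RelE a b) {g : E S} (hg : TightXCov a g.1) :
    L.RelE (g.1 * a) ((L.ψ g).1 * b) := by
  obtain ⟨h1, h2, h3⟩ := tight_iff hg
  rcases h with h | ⟨e, rfl, rfl⟩
  · exact M h h1 h2 h3
  · right
    refine ⟨g ⊓ e, (coe_inf _ _).symm, ?_⟩
    rw [map_inf, coe_inf]

theorem bypass {x : S} {y : T} (hTC : TightlyConnected S) (h : L.Rel x y) {g : E S}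
    (hg : g < rr x) : L.RelE (g.1 * x) ((L.ψ g).1 * y) := by
  obtain ⟨n, hn, es, h0, hen, hid, hk⟩ := hTC x (Or.inl (ns_iff.2 h.1)) g.1 g.2 (lt_iff.2 hg)
  have key : ∀ j, ∀ i (hi : i ≤ n), i + j = n →
      L.RelE (es i * x) ((L.ψ ⟨es i, hid i hi⟩).1 * y) := by
    intro j
    induction j with
    | zero =>
      intro i hi hij
      have hin : i = n := by omega
      subst hin
      have : (⟨es i, hid i hi⟩ : E S) = rr x := Subtype.ext hen
      rw [this, ← h.2.2.1, r_mul, hen, mul_inv_eq, r_mul]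
      exact Or.inl h
    | succ j ih =>
      intro i hi hij
      have h1 := ih (i + 1) (by omega) (by omega)
      obtain ⟨h2, h3⟩ := hk (i + 1) (by omega) (by omega)
      rw [Nat.add_sub_cancel] at h2 h3
      have h4 := ME (g := ⟨es i, hid i hi⟩) h1 h3
      have hle : (⟨es i, hid i hi⟩ : E S) ≤ ⟨es (i + 1), hid (i + 1) (by omega)⟩ :=
        le_def.2 h2.1
      have hle' := L.ψ.monotone hle
      rw [← mul_assoc, ← mul_assoc] at h4
      rw [le_def.1 hle'] at h4
      change L.RelE (es i * es (i + 1) * x) _ at h4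
      rw [le_def.1 hle] at h4
      exact h4
  have := key n 0 (Nat.zero_le _) (by omega)
  have hg0 : (⟨es 0, hid 0 (Nat.zero_le _)⟩ : E S) = g := Subtype.ext h0
  rw [hg0, h0] at this
  exact this

theorem match1 {x : S} {y : T} (hTC : TightlyConnected S) (h : L.Rel x y) (g : E S) :
    cj y⁻¹ (L.ψ g) = L.ψ (cj x⁻¹ g) := by
  have main : ∀ g ≤ rr x, cj y⁻¹ (L.ψ g) = L.ψ (cj x⁻¹ g) := by
    intro g hg
    rcases hg.lt_or_eq with hg | rfl
    · have := (bypass hTC h hg).d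
      rwa [rr_gmul_inv, rr_gmul_inv] at this
    · rw [cj_r', ← h.2.2.1, cj_r', h.2.2.2]
  have := main (rr x ⊓ g) inf_le_left
  rwa [map_inf, ← h.2.2.1, ← cj_cj_inv, ← cj_cj_inv, cj_inv_cj, cj_inv_cj,
    inf_eq_right.2 (cj_le _ _), inf_eq_right.2 (cj_le _ _)] at this

end LI

end ISG

namespace ISG
namespace LI
variable {S T : Type*} [InverseSemigroup S] [InverseSemigroup T] {L : LI S T}

/-- Two elements act compatibly on the idempotents. -/
def Mt (L : LI S T) (s : S) (t : T) : Prop :=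
  ∀ e, cj t⁻¹ (L.ψ e) = L.ψ (cj s⁻¹ e) ∧ cj t (L.ψ e) = L.ψ (cj s e)

theorem Mt.inv {s : S} {t : T} (h : L.Mt s t) : L.Mt s⁻¹ t⁻¹ := by
  intro e
  rw [ii, ii]
  exact (h e).symm

theorem Mt.r {s : S} {t : T} (h : L.Mt s t) : rr t = L.ψ (rr s) := by
  apply le_antisymm
  · have := (h (L.ψ.symm (rr t⁻¹))).2
    rw [L.ψ.apply_symm_apply, cj_r] at this
    rw [this, L.ψ.le_iff_le]
    exact cj_le _ _
  · have := (h (rr s⁻¹)).2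
    rw [cj_r] at this
    rw [← this]
    exact cj_le _ _

theorem Mt.d {s : S} {t : T} (h : L.Mt s t) : rr t⁻¹ = L.ψ (rr s⁻¹) := h.inv.r

theorem Mt.mul {s s1 : S} {t t1 : T} (h : L.Mt s t) (h1 : L.Mt s1 t1) :
    L.Mt (s * s1) (t * t1) := by
  intro e
  rw [mir, mir, cj_mul, cj_mul, cj_mul, cj_mul, (h e).1, (h1 e).2, (h1 _).1, (h _).2]
  exact ⟨rfl, rfl⟩

theorem Mt.idem (e : E S) : L.Mt e.1 (L.ψ e).1 := by
  intro g
  rw [inv_coe, inv_coe, cj_coe, cj_coe, map_inf]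
  exact ⟨rfl, rfl⟩

theorem Rel.mt {x : S} {y : T} (hTC : TightlyConnected S) (h : L.Rel x y) : L.Mt x y := by
  intro e
  refine ⟨match1 hTC h e, ?_⟩
  have := match1 hTC h.inv e
  rwa [ii, ii] at this

theorem Mt.inj {s s1 : S} {t : T} (hF : Fundamental S) (h : L.Mt s t) (h1 : L.Mt s1 t) :
    s = s1 := by
  apply hF
  intro e he
  have := L.ψ.injective (((h ⟨e, he⟩).1).symm.trans (h1 ⟨e, he⟩).1)
  have := congrArg Subtype.val this
  change s⁻¹ * e * s⁻¹⁻¹ = s1⁻¹ * e * s1⁻¹⁻¹ at this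
  rwa [ii, ii] at this

theorem ex_ng (hNI : NoIsolatedNontrivial S) {h : S} {e : E S} (hne : h ≠ e.1)
    (h1 : rr h = e) (h2 : rr h⁻¹ = e) : ∃ x : S, NG x ∧ rr x = e := by
  have hh : hRel h e.1 := by
    constructor
    · change h * h⁻¹ = e.1 * e.1⁻¹
      rw [mul_inv_eq, mul_inv_eq, h1, rr_coe]
    · change h⁻¹ * h = e.1⁻¹ * e.1
      rw [inv_mul_eq, inv_mul_eq, h2, inv_coe, rr_coe]
  obtain ⟨f, hf, hfe, c, hc1, hc2⟩ := hNI e.1 e.2 ⟨h, hne, hh⟩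
  have hc1 : e.1 * e.1⁻¹ = c * c⁻¹ := hc1
  have hc2 : c⁻¹ * c = f⁻¹ * f := hc2
  have k1 : rr c = e := by
    apply Subtype.ext
    rw [← mul_inv_eq, ← hc1, mul_inv_eq, rr_coe]
  have k2 : (rr c⁻¹).1 = f := by
    rw [← inv_mul_eq, hc2, idem_inv hf]; exact hf
  refine ⟨c, fun k => hfe ?_, k1⟩
  rw [← k2, ← k, k1]

/-- The whole semigroup. -/
def top (S : Type*) [InverseSemigroup S] : Sb S := ⟨Set.univ, fun _ _ _ _ => trivial, fun _ _ => trivial⟩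

theorem F_top (L : LI S T) (t : T) : t ∈ (L.F (top S)).1 := by
  have : top T ≤ L.F (top S) := by
    rw [← OrderIso.symm_apply_le]
    exact fun _ _ => trivial
  exact this trivial

theorem back {L : LI S T} (hNI : NoIsolatedNontrivial S) {v : T} {e : E S} (hne : v ≠ (L.ψ e).1)
    (h1 : rr v = L.ψ e) (h2 : rr v⁻¹ = L.ψ e) : ∃ x : S, NG x ∧ rr x = e := by
  by_contra k
  apply hne
  refine L.group_transfer (U := top S) (t := e) ?_ v (F_top L v) h1 h2
  intro s _ k1 k2
  by_contra hs
  exact k (ex_ng hNI hs k1 k2)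

theorem mul_mul_inv {S : Type*} [InverseSemigroup S] {h x : S} (k : rr h⁻¹ = rr x) :
    h * x * x⁻¹ = h := by
  rw [mul_assoc, mul_inv_eq]
  exact mulg_of_le k.le

theorem mul_ng {S : Type*} [InverseSemigroup S] {h x : S} (hx : NG x) (k : rr h⁻¹ = rr x)
    (k' : rr h = rr x) : NG (h * x) := by
  intro m
  apply hx
  rw [mir, rr_mul, rr_mul, k, cj_r', ← k, cj_r] at m
  rw [← k', m]

theorem total (L : LI S T) (hTC : TightlyConnected S) (hNI : NoIsolatedNontrivial S) (s : S) :
    ∃ t, L.Mt s t := by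
  have hN : ∀ s, NG s → ∃ t, L.Mt s t := by
    intro s hs
    obtain ⟨t, ht⟩ := L.ex hs
    exact ⟨t, ht.mt hTC⟩
  by_cases hs : NG s
  · exact hN s hs
  · by_cases hi : s = (rr s).1
    · rw [hi]; exact ⟨_, Mt.idem _⟩
    · have hd : rr s⁻¹ = rr s := by
        by_contra k; exact hs fun k' => k k'.symm
      obtain ⟨x, hx, hxr⟩ := ex_ng hNI hi rfl hd
      obtain ⟨y, hy⟩ := hN x hx
      have k : rr s⁻¹ = rr x := by rw [hd, hxr]
      obtain ⟨w, hw⟩ := hN (s * x) (mul_ng hx k hxr.symm)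
      have := hw.mul hy.inv
      rw [mul_mul_inv k] at this
      exact ⟨_, this⟩

theorem surj_ng (L : LI S T) {t : T} (ht : NG t) : ∃ s, L.Rel s t := by
  obtain ⟨s, hs⟩ := L.symm.ex ht
  exact ⟨s, hs.symm⟩

theorem surj (L : LI S T) (hTC : TightlyConnected S) (hNI : NoIsolatedNontrivial S) (t : T) :
    ∃ s, L.Mt s t := by
  have hN : ∀ t, NG t → ∃ s, L.Mt s t := by
    intro t ht
    obtain ⟨s, hs⟩ := L.surj_ng ht
    exact ⟨s, hs.mt hTC⟩
  obtain ⟨e, he⟩ : ∃ e, rr t = L.ψ e := ⟨_, (L.ψ.apply_symm_apply _).symm⟩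
  by_cases hs : NG t
  · exact hN t hs
  · by_cases hi : t = (rr t).1
    · rw [hi, he]; exact ⟨_, Mt.idem _⟩
    · have hd : rr t⁻¹ = rr t := by
        by_contra k; exact hs fun k' => k k'.symm
      obtain ⟨x, hx, hxr⟩ := back hNI (by rwa [← he]) he (hd.trans he)
      obtain ⟨y, hy⟩ := L.ex hx
      have k' : rr t = rr y := by rw [hy.2.2.1, hxr, he]
      have k : rr t⁻¹ = rr y := by rw [hd, k']
      obtain ⟨w, hw⟩ := hN (t * y) (mul_ng hy.ng k k')
      have := hw.mul (hy.mt hTC).inv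
      rw [mul_mul_inv k] at this
      exact ⟨_, this⟩

theorem uniq_ng (hTC : TightlyConnected S) (hF : Fundamental S) {s : S}
    {t t1 : T} (hs : NG s) (h : L.Mt s t) (h1 : L.Mt s t1) : t = t1 := by
  have key : ∀ t, L.Mt s t → L.Rel s t := by
    intro t h
    have ht : NG t := by
      intro k
      rw [h.r, h.d] at k
      exact hs (L.ψ.injective k)
    obtain ⟨x, hx⟩ := L.surj_ng ht
    rwa [(hx.mt hTC).inj hF h] at hx
  exact (key t h).uniq (key t1 h1)

theorem uniq (hTC : TightlyConnected S) (hF : Fundamental S) (hNI : NoIsolatedNontrivial S)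
    {s : S} {t t1 : T} (h : L.Mt s t) (h1 : L.Mt s t1) : t = t1 := by
  by_cases hs : NG s
  · exact uniq_ng hTC hF hs h h1
  · have hd : rr s⁻¹ = rr s := by
      by_contra k; exact hs fun k' => k k'.symm
    by_contra hne
    have hex : ∃ x : S, NG x ∧ rr x = rr s := by
      by_contra k
      have aux : ∀ t, L.Mt s t → t = (L.ψ (rr s)).1 := by
        intro t h
        by_contra k'
        exact k (back hNI k' h.r (by rw [h.d, hd]))
      exact hne ((aux t h).trans (aux t1 h1).symm)
    obtain ⟨x, hx, hxr⟩ := hex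
    obtain ⟨y, hy⟩ := L.ex hx
    have hm := hy.mt hTC
    have e := uniq_ng hTC hF (mul_ng hx (hd.trans hxr.symm) hxr.symm) (h.mul hm) (h1.mul hm)
    apply hne
    rw [← mul_mul_inv (h := t) (x := y) (by rw [h.d, hy.2.2.1, hd, hxr]),
      ← mul_mul_inv (h := t1) (x := y) (by rw [h1.d, hy.2.2.1, hd, hxr]), e]

theorem final (L : LI S T) (hTC : TightlyConnected S) (hF : Fundamental S)
    (hNI : NoIsolatedNontrivial S) :
    ∃ φ : S → T, Function.Bijective φ ∧ (∀ a b : S, φ (a * b) = φ a * φ b) ∧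
      ∀ e : E S, φ e.1 = (L.ψ e).1 := by
  choose φ hφ using L.total hTC hNI
  refine ⟨φ, ⟨fun a b hab => ?_, fun t => ?_⟩, fun a b => ?_, fun e => ?_⟩
  · exact (hφ a).inj hF (hab ▸ hφ b)
  · obtain ⟨s, hs⟩ := L.surj hTC hNI t
    exact ⟨s, uniq hTC hF hNI (hφ s) hs⟩
  · exact uniq hTC hF hNI (hφ _) ((hφ a).mul (hφ b))
  · exact uniq hTC hF hNI (hφ _) (Mt.idem e)

end LI
end ISG


/-- if `S` is a tightly connected fundamental inverse semigroup with
no isolated nontrivial subgroups, `T` an inverse semigroup, and `Ψ` a lattice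
isomorphism of `S` onto `T` whose associated `E`-bijection `ψE` is a semilattice
isomorphism of `E_S` onto `E_T`, then there is an isomorphism of `S` onto `T`
restricting to `ψE` on `E_S`; in particular `S ≅ T`. -/
theorem stmt6 {S T : Type*} [InverseSemigroup S] [InverseSemigroup T]
    (hTC : TightlyConnected S) (hF : Fundamental S) (hNI : NoIsolatedNontrivial S)
    -- `Ψ` is a lattice isomorphism of `S` onto `T`:
    (Ψ : {U : Set S // IsInvSub U} → {V : Set T // IsInvSub V})
    (hΨbij : Function.Bijective Ψ)
    (hΨord : ∀ U V : {U : Set S // IsInvSub U}, U.1 ⊆ V.1 ↔ (Ψ U).1 ⊆ (Ψ V).1)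
    -- `ψE` is the associated `E`-bijection:
    (ψE : S → T)
    (hΨE : ∀ e : S, IsIdempotentElem e → ∀ h : IsInvSub ({e} : Set S),
      (Ψ ⟨{e}, h⟩).1 = {ψE e})
    -- `ψE` is a semilattice isomorphism of `E_S` onto `E_T`:
    (hE1 : ∀ e : S, IsIdempotentElem e → IsIdempotentElem (ψE e))
    (hE2 : ∀ e f : S, IsIdempotentElem e → IsIdempotentElem f → ψE e = ψE f → e = f)
    (hE3 : ∀ f : T, IsIdempotentElem f → ∃ e : S, IsIdempotentElem e ∧ ψE e = f)
    (hE4 : ∀ e f : S, IsIdempotentElem e → IsIdempotentElem f →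
      ψE (e * f) = ψE e * ψE f) :
    ∃ φ : S → T, Function.Bijective φ ∧ (∀ a b : S, φ (a * b) = φ a * φ b) ∧
      ∀ e : S, IsIdempotentElem e → φ e = ψE e := by
  have hle : ∀ e f : S, IsIdempotentElem e → IsIdempotentElem f →
      (ψE e * ψE f = ψE e ↔ e * f = e) := by
    intro e f he hf
    rw [← hE4 e f he hf]
    exact ⟨fun h => hE2 _ _ (ISG.idem_mul he hf) he h, fun h => by rw [h]⟩
  let F : ISG.Sb S ≃o ISG.Sb T :=
    { toEquiv := Equiv.ofBijective Ψ hΨbij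
      map_rel_iff' := fun {U V} => (hΨord U V).symm }
  let ψ0 : ISG.E S → ISG.E T := fun e => ⟨ψE e.1, hE1 e.1 e.2⟩
  have hψ0 : Function.Bijective ψ0 := by
    constructor
    · intro a b hab
      exact Subtype.ext (hE2 _ _ a.2 b.2 (congrArg Subtype.val hab))
    · intro f
      obtain ⟨e, he, hef⟩ := hE3 f.1 f.2
      exact ⟨⟨e, he⟩, Subtype.ext hef⟩
  let ψ : ISG.E S ≃o ISG.E T :=
    { toEquiv := Equiv.ofBijective ψ0 hψ0
      map_rel_iff' := fun {e f} => hle e.1 f.1 e.2 f.2 }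
  let L : ISG.LI S T :=
    { F := F
      ψ := ψ
      mem := by
        intro e U
        have hs : IsInvSub ({e.1} : Set S) :=
          ⟨by rintro a rfl b rfl; exact e.2, by rintro a rfl; exact ISG.inv_coe e⟩
        have h := hΨord ⟨{e.1}, hs⟩ U
        rw [hΨE e.1 e.2 hs, Set.singleton_subset_iff, Set.singleton_subset_iff] at h
        exact h }
  obtain ⟨φ, h1, h2, h3⟩ := L.final hTC hF hNI
  exact ⟨φ, h1, h2, fun e he => h3 ⟨e, he⟩⟩
end

section
/- Let S be a shortly connected combinatorial inverse semigroup, T an inverse semigroup, and Ψ a lattice isomorphism of S onto T whose associated E-bijection ψ_E is a semilattice isomorphism of E_S onto E_T. Then there exists a unique isomorphism φ of S onto T inducing Ψ, i.e. such that HΨ equals the image of H under φ for every inverse subsemigroup H of S. -/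
namespace ISg

open InverseSemigroup

section Basic

variable {S : Type*} [InverseSemigroup S]

theorem inv_inv' (a : S) : a⁻¹⁻¹ = a :=
  (InverseSemigroup.inv_unique a⁻¹ a (inv_mul_inv a) (mul_inv_mul a)).symm

theorem idem_inv {e : S} (he : IsIdempotentElem e) : e⁻¹ = e :=
  (InverseSemigroup.inv_unique e e (by rw [he.eq, he.eq]) (by rw [he.eq, he.eq])).symm

theorem idem_mul {e f : S} (he : IsIdempotentElem e) (hf : IsIdempotentElem f) :
    IsIdempotentElem (e * f) := by
  set z := (e * f)⁻¹ with hz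
  have h1 : e * f * z * (e * f) = e * f := mul_inv_mul _
  have h2 : z * (e * f) * z = z := inv_mul_inv _
  have hff : ∀ a : S, f * (f * a) = f * a := fun a => by rw [← mul_assoc, hf.eq]
  have hee : ∀ a : S, e * (e * a) = e * a := fun a => by rw [← mul_assoc, he.eq]
  have h3 : f * z * e = z := by
    apply InverseSemigroup.inv_unique
    · simp only [mul_assoc, hff, hee] at h1 ⊢
      exact h1
    · simp only [mul_assoc, hff, hee] at h2 ⊢
      have := congrArg (fun t => f * t * e) h2
      simpa only [mul_assoc] using this
  have h4 : IsIdempotentElem z := by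
    have : z * z = f * (z * (e * f) * z) * e := by
      conv_lhs => rw [← h3]
      simp only [mul_assoc]
    rw [IsIdempotentElem, this, h2, h3]
  have h5 : e * f = z := by
    rw [← inv_inv' (e * f), ← hz, idem_inv h4]
  rw [h5]; exact h4

theorem idem_comm {e f : S} (he : IsIdempotentElem e) (hf : IsIdempotentElem f) :
    e * f = f * e := by
  have hff : ∀ a : S, f * (f * a) = f * a := fun a => by rw [← mul_assoc, hf.eq]
  have hee : ∀ a : S, e * (e * a) = e * a := fun a => by rw [← mul_assoc, he.eq]
  have h1 := (idem_mul he hf).eq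
  have h2 := (idem_mul hf he).eq
  have h3 : f * e = (e * f)⁻¹ := by
    apply InverseSemigroup.inv_unique
    · simp only [mul_assoc, hff, hee] at h1 ⊢; exact h1
    · simp only [mul_assoc, hff, hee] at h2 ⊢; exact h2
  rw [h3, idem_inv (idem_mul he hf)]

theorem idem_r (a : S) : IsIdempotentElem (a * a⁻¹) := by
  rw [IsIdempotentElem, ← mul_assoc, mul_inv_mul]

theorem idem_l (a : S) : IsIdempotentElem (a⁻¹ * a) := by
  rw [IsIdempotentElem, ← mul_assoc, inv_mul_inv]

theorem mul_inv' (a b : S) : (a * b)⁻¹ = b⁻¹ * a⁻¹ := by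
  symm
  have h := idem_comm (idem_r b) (idem_l a)
  apply InverseSemigroup.inv_unique
  · calc a * b * (b⁻¹ * a⁻¹) * (a * b) = a * ((b * b⁻¹) * (a⁻¹ * a)) * b := by
          simp only [mul_assoc]
      _ = (a * a⁻¹ * a) * (b * b⁻¹ * b) := by rw [h]; simp only [mul_assoc]
      _ = a * b := by rw [mul_inv_mul, mul_inv_mul]
  · calc b⁻¹ * a⁻¹ * (a * b) * (b⁻¹ * a⁻¹) = b⁻¹ * ((a⁻¹ * a) * (b * b⁻¹)) * a⁻¹ := by
          simp only [mul_assoc]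
      _ = (b⁻¹ * b * b⁻¹) * (a⁻¹ * a * a⁻¹) := by rw [← h]; simp only [mul_assoc]
      _ = b⁻¹ * a⁻¹ := by rw [inv_mul_inv, inv_mul_inv]

/-- conjugation of an idempotent -/
theorem cj_mul {e f : S} (a : S) (he : IsIdempotentElem e) :
    a⁻¹ * (e * f) * a = (a⁻¹ * e * a) * (a⁻¹ * f * a) := by
  have h := idem_comm he (idem_r a)
  calc a⁻¹ * (e * f) * a = (a⁻¹ * a * a⁻¹) * (e * f) * a := by rw [inv_mul_inv]
    _ = a⁻¹ * ((a * a⁻¹) * e) * (f * a) := by simp only [mul_assoc]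
    _ = a⁻¹ * (e * (a * a⁻¹)) * (f * a) := by rw [h]
    _ = _ := by simp only [mul_assoc]

theorem cj_idem {e : S} (a : S) (he : IsIdempotentElem e) :
    IsIdempotentElem (a⁻¹ * e * a) := by
  rw [IsIdempotentElem, ← cj_mul a he, he.eq]

theorem cj_idem' {e : S} (a : S) (he : IsIdempotentElem e) :
    IsIdempotentElem (a * e * a⁻¹) := by
  have := cj_idem a⁻¹ he
  rwa [inv_inv'] at this

theorem cj_mul' {e f : S} (a : S) (he : IsIdempotentElem e) :
    a * (e * f) * a⁻¹ = (a * e * a⁻¹) * (a * f * a⁻¹) := by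
  have := cj_mul (f := f) a⁻¹ he
  rwa [inv_inv'] at this

theorem cj_cj {e : S} (a : S) (he : IsIdempotentElem e) :
    a * (a⁻¹ * e * a) * a⁻¹ = e * (a * a⁻¹) := by
  have h := idem_comm he (idem_r a)
  calc a * (a⁻¹ * e * a) * a⁻¹ = (a * a⁻¹) * e * (a * a⁻¹) := by simp only [mul_assoc]
    _ = e * (a * a⁻¹) := by rw [← h, mul_assoc, (idem_r a).eq]

theorem cj_cj' {e : S} (a : S) (he : IsIdempotentElem e) :
    a⁻¹ * (a * e * a⁻¹) * a = e * (a⁻¹ * a) := by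
  have := cj_cj a⁻¹ he
  rwa [inv_inv'] at this

theorem cj_top (a : S) : a⁻¹ * (a * a⁻¹) * a = a⁻¹ * a := by
  rw [← mul_assoc, inv_mul_inv]

theorem cj_top' (a : S) : a * (a⁻¹ * a) * a⁻¹ = a * a⁻¹ := by
  rw [← mul_assoc, mul_inv_mul]

theorem rr_mul (a b : S) : (a * b) * (a * b)⁻¹ = a * (b * b⁻¹) * a⁻¹ := by
  rw [mul_inv']; simp only [mul_assoc]

theorem ll_mul (a b : S) : (a * b)⁻¹ * (a * b) = b⁻¹ * (a⁻¹ * a) * b := by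
  rw [mul_inv']; simp only [mul_assoc]

theorem le_trans' {e f g : S} (h1 : idemLe e f) (h2 : idemLe f g) : idemLe e g := by
  unfold idemLe at *; rw [← h1, mul_assoc, h2]

theorem le_refl' {e : S} (he : IsIdempotentElem e) : idemLe e e := he

theorem le_antisymm' {e f : S} (he : IsIdempotentElem e) (hf : IsIdempotentElem f)
    (h1 : idemLe e f) (h2 : idemLe f e) : e = f := by
  unfold idemLe at *; rw [← h1, idem_comm he hf, h2]

theorem mul_le_right {e f : S} (hf : IsIdempotentElem f) : idemLe (e * f) f := by
  unfold idemLe; rw [mul_assoc, hf.eq]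

theorem mul_le_left {e f : S} (he : IsIdempotentElem e) (hf : IsIdempotentElem f) :
    idemLe (e * f) e := by
  rw [idem_comm he hf]; exact mul_le_right he

theorem le_mul {e f g : S} (h1 : idemLe e f) (h2 : idemLe e g) : idemLe e (f * g) := by
  unfold idemLe at *; rw [← mul_assoc, h1, h2]

theorem cj_mono {e f : S} (a : S) (he : IsIdempotentElem e) (h : idemLe e f) :
    idemLe (a⁻¹ * e * a) (a⁻¹ * f * a) := by
  unfold idemLe at *; rw [← cj_mul a he, h]

theorem cj_mono' {e f : S} (a : S) (he : IsIdempotentElem e) (h : idemLe e f) :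
    idemLe (a * e * a⁻¹) (a * f * a⁻¹) := by
  unfold idemLe at *; rw [← cj_mul' a he, h]

theorem cj_le {e : S} (a : S) : idemLe (a⁻¹ * e * a) (a⁻¹ * a) := by
  unfold idemLe
  calc a⁻¹ * e * a * (a⁻¹ * a) = a⁻¹ * e * (a * a⁻¹ * a) := by simp only [mul_assoc]
    _ = _ := by rw [mul_inv_mul]

theorem cj_le' {e : S} (a : S) : idemLe (a * e * a⁻¹) (a * a⁻¹) := by
  have := cj_le (e := e) a⁻¹
  rwa [inv_inv'] at this

theorem rr_mul_le (a b : S) : idemLe ((a * b) * (a * b)⁻¹) (a * a⁻¹) := by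
  rw [rr_mul]; exact cj_le' a

theorem ll_mul_le (a b : S) : idemLe ((a * b)⁻¹ * (a * b)) (b⁻¹ * b) := by
  rw [ll_mul]; exact cj_le b

/-- `a = (a a⁻¹) * w` when `a = i w`. -/
theorem below_eq {i a w : S} (hi : IsIdempotentElem i) (h : a = i * w) : a = (a * a⁻¹) * w := by
  have : a * a⁻¹ = i * (w * w⁻¹) := by
    rw [h, rr_mul, idem_inv hi, mul_assoc, idem_comm (idem_r w) hi, ← mul_assoc, hi.eq]
  rw [this, mul_assoc, mul_inv_mul, h]

theorem rr_emul {e x : S} (he : IsIdempotentElem e) (h : idemLe e (x * x⁻¹)) :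
    (e * x) * (e * x)⁻¹ = e := by
  rw [rr_mul, idem_inv he]
  unfold idemLe at h
  rw [h, he.eq]

theorem ll_emul {e x : S} (he : IsIdempotentElem e) :
    (e * x)⁻¹ * (e * x) = x⁻¹ * e * x := by
  rw [ll_mul, idem_inv he, he.eq]

/-! ### generated inverse subsemigroups -/

theorem gen_sub (X : Set S) : IsInvSub (genInv X) := by
  constructor
  · intro a ha b hb U hU
    exact hU.1.1 a (ha U hU) b (hb U hU)
  · intro a ha U hU
    exact hU.1.2 a (ha U hU)

theorem subset_gen (X : Set S) : X ⊆ genInv X := fun _ hx _ hU => hU.2 hx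

theorem gen_le {X U : Set S} (hU : IsInvSub U) (h : X ⊆ U) : genInv X ⊆ U :=
  fun _ ha => ha U ⟨hU, h⟩

theorem mem_gen (x : S) : x ∈ genInv ({x} : Set S) := subset_gen _ rfl

theorem inv_mem_gen (x : S) : x⁻¹ ∈ genInv ({x} : Set S) := (gen_sub _).2 _ (mem_gen x)

theorem gen1_le {x : S} {U : Set S} (hU : IsInvSub U) (h : x ∈ U) : genInv ({x} : Set S) ⊆ U :=
  gen_le hU (by rintro _ rfl; exact h)

theorem gen1_le_iff {x : S} {U : Set S} (hU : IsInvSub U) : genInv ({x} : Set S) ⊆ U ↔ x ∈ U :=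
  ⟨fun h => h (mem_gen x), gen1_le hU⟩

theorem gen_inv (x : S) : genInv ({x⁻¹} : Set S) = genInv {x} := by
  apply Set.Subset.antisymm
  · exact gen1_le (gen_sub _) (inv_mem_gen x)
  · apply gen1_le (gen_sub _)
    have := inv_mem_gen x⁻¹
    rwa [inv_inv'] at this

theorem singleton_sub {e : S} (he : IsIdempotentElem e) : IsInvSub ({e} : Set S) := by
  constructor
  · rintro _ rfl _ rfl; exact he
  · rintro _ rfl; exact idem_inv he

theorem r_mem {U : Set S} (hU : IsInvSub U) {a : S} (h : a ∈ U) : a * a⁻¹ ∈ U :=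
  hU.1 _ h _ (hU.2 _ h)

theorem l_mem {U : Set S} (hU : IsInvSub U) {a : S} (h : a ∈ U) : a⁻¹ * a ∈ U :=
  hU.1 _ (hU.2 _ h) _ h

/-- Word induction for a monogenic inverse semigroup. -/
theorem gen_induction {x : S} {P : S → Prop} (h1 : P x) (h2 : P x⁻¹)
    (h3 : ∀ a, P a → P (a * x)) (h4 : ∀ a, P a → P (a * x⁻¹)) :
    ∀ a ∈ genInv ({x} : Set S), P a := by
  let Q : Set S := {a | (P a ∧ ∀ b, P b → P (b * a)) ∧ (P a⁻¹ ∧ ∀ b, P b → P (b * a⁻¹))}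
  have hQ : IsInvSub Q := by
    constructor
    · rintro a ⟨⟨a1, a2⟩, a3, a4⟩ b ⟨⟨b1, b2⟩, b3, b4⟩
      refine ⟨⟨b2 _ a1, fun c hc => ?_⟩, ?_, fun c hc => ?_⟩
      · rw [← mul_assoc]; exact b2 _ (a2 _ hc)
      · rw [mul_inv']; exact a4 _ b3
      · rw [mul_inv', ← mul_assoc]; exact a4 _ (b4 _ hc)
    · rintro a ⟨ha, hb⟩
      refine ⟨hb, ?_⟩
      rw [inv_inv']; exact ha
  intro a ha
  exact (gen1_le (U := Q) hQ ⟨⟨h1, h3⟩, h2, h4⟩ ha).1.1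

/-- An idempotent of `⟨x⟩` lies below `x x⁻¹` or `x⁻¹ x`. -/
theorem gen_rr_le {x a : S} (ha : a ∈ genInv ({x} : Set S)) :
    idemLe (a * a⁻¹) (x * x⁻¹) ∨ idemLe (a * a⁻¹) (x⁻¹ * x) := by
  revert a
  apply gen_induction
  · exact Or.inl (idem_r x)
  · rw [inv_inv']; exact Or.inr (idem_l x)
  · rintro a (h | h)
    · exact Or.inl (le_trans' (rr_mul_le _ _) h)
    · exact Or.inr (le_trans' (rr_mul_le _ _) h)
  · rintro a (h | h)
    · exact Or.inl (le_trans' (rr_mul_le _ _) h)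
    · exact Or.inr (le_trans' (rr_mul_le _ _) h)

theorem rr_of_idem {e : S} (he : IsIdempotentElem e) : e * e⁻¹ = e := by
  rw [idem_inv he, he.eq]

theorem ll_of_idem {e : S} (he : IsIdempotentElem e) : e⁻¹ * e = e := by
  rw [idem_inv he, he.eq]

theorem gen_idem_le {x a : S} (ha : a ∈ genInv ({x} : Set S)) (hi : IsIdempotentElem a) :
    idemLe a (x * x⁻¹) ∨ idemLe a (x⁻¹ * x) := by
  have := gen_rr_le ha
  rwa [rr_of_idem hi] at this

/-- If `S` is combinatorial, `x x⁻¹ = x⁻¹ x` forces `x` idempotent. -/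
theorem comb_idem (hC : Combinatorial S) {x : S} (h : x * x⁻¹ = x⁻¹ * x) :
    IsIdempotentElem x := by
  have : x = x * x⁻¹ := by
    apply hC
    · rw [rr_of_idem (idem_r x)]
    · rw [ll_of_idem (idem_r x), h]
  rw [this]; exact idem_r x

theorem comb_of_group (hC : ∀ x : S, x * x⁻¹ = x⁻¹ * x → IsIdempotentElem x) :
    Combinatorial S := by
  intro a b h1 h2
  have hr : (a * b⁻¹) * (a * b⁻¹)⁻¹ = a * a⁻¹ := by
    rw [rr_mul, inv_inv', ← h2, cj_top']
  have hl : (a * b⁻¹)⁻¹ * (a * b⁻¹) = a * a⁻¹ := by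
    rw [ll_mul, inv_inv', h2, cj_top', h1]
  have hi := hC _ (hr.trans hl.symm)
  have h3 : a * b⁻¹ = a * a⁻¹ := by rw [← hr, rr_of_idem hi]
  calc a = a * (a⁻¹ * a) := by rw [← mul_assoc, mul_inv_mul]
    _ = (a * b⁻¹) * b := by rw [h2, mul_assoc]
    _ = (a * a⁻¹) * b := by rw [h3]
    _ = b := by rw [h1, mul_inv_mul]

/-- Elements of `⟨e, x⟩` lie below elements of `⟨x⟩`. -/
theorem gen2_below {e x : S} (he : IsIdempotentElem e) (hle : idemLe e (x * x⁻¹)) {u : S}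
    (hu : u ∈ genInv ({e, x} : Set S)) :
    ∃ w ∈ genInv ({x} : Set S), u = (u * u⁻¹) * w := by
  let Q : Set S := {a | ∃ w ∈ genInv ({x} : Set S), ∃ i, IsIdempotentElem i ∧ a = i * w}
  have hQ : IsInvSub Q := by
    constructor
    · rintro a ⟨w, hw, i, hi, rfl⟩ b ⟨v, hv, j, hj, rfl⟩
      refine ⟨w * v, (gen_sub _).1 _ hw _ hv, i * (w * j * w⁻¹),
        idem_mul hi (cj_idem' w hj), ?_⟩
      have h := idem_comm hj (idem_l w)
      calc i * w * (j * v) = i * (w * w⁻¹ * w) * (j * v) := by rw [mul_inv_mul]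
        _ = i * w * ((w⁻¹ * w) * j) * v := by simp only [mul_assoc]
        _ = _ := by rw [← h]; simp only [mul_assoc]
    · rintro a ⟨w, hw, i, hi, rfl⟩
      refine ⟨w⁻¹, (gen_sub _).2 _ hw, w⁻¹ * i * w, cj_idem w hi, ?_⟩
      have h := idem_comm hi (idem_r w)
      rw [mul_inv', idem_inv hi]
      calc w⁻¹ * i = (w⁻¹ * w * w⁻¹) * i := by rw [inv_mul_inv]
        _ = w⁻¹ * ((w * w⁻¹) * i) := by simp only [mul_assoc]
        _ = _ := by rw [← h]; simp only [mul_assoc]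
  obtain ⟨w, hw, i, hi, h⟩ : u ∈ Q := by
    refine gen_le hQ ?_ hu
    rintro a (rfl | rfl)
    · exact ⟨x * x⁻¹, r_mem (gen_sub _) (mem_gen x), a, he, hle.symm⟩
    · exact ⟨a, mem_gen a, a * a⁻¹, idem_r a, (mul_inv_mul a).symm⟩
  exact ⟨w, hw, below_eq hi h⟩

end Basic

section Incomp

variable {S : Type*} [InverseSemigroup S]

/-- the lower part of the idempotents of `⟨x⟩` -/
def JJ (x p : S) : Prop :=
  idemLe p (x * (x * x⁻¹) * x⁻¹) ∨ idemLe p ((x * x⁻¹) * (x⁻¹ * x)) ∨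
    idemLe p (x⁻¹ * (x⁻¹ * x) * x)

theorem JJ_symm {x p : S} (h : JJ x p) : JJ x⁻¹ p := by
  unfold JJ
  rw [inv_inv', idem_comm (idem_l x) (idem_r x)]
  rcases h with h | h | h
  · exact Or.inr (Or.inr h)
  · exact Or.inr (Or.inl h)
  · exact Or.inl h

theorem JJ_le {x p q : S} (h : idemLe p q) (hq : JJ x q) : JJ x p := by
  rcases hq with hq | hq | hq
  · exact Or.inl (le_trans' h hq)
  · exact Or.inr (Or.inl (le_trans' h hq))
  · exact Or.inr (Or.inr (le_trans' h hq))

theorem JJ_cj {x p : S} (hp : IsIdempotentElem p) (h : JJ x p) : JJ x (x⁻¹ * p * x) := by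
  rcases h with h | h | h
  · have := cj_mono x hp h
    rw [cj_cj' x (idem_r x)] at this
    exact Or.inr (Or.inl this)
  · have := cj_mono x hp h
    rw [cj_mul x (idem_r x)] at this
    exact Or.inr (Or.inr (le_trans' this (mul_le_right (cj_idem x (idem_l x)))))
  · exact Or.inr (Or.inr (cj_mono x hp (le_trans' h (cj_le x))))

def HH (x a : S) : Prop :=
  a = x ∨ a = x⁻¹ ∨ a = x * x⁻¹ ∨ a = x⁻¹ * x ∨ (JJ x (a * a⁻¹) ∧ JJ x (a⁻¹ * a))

theorem HH_symm {x a : S} (h : HH x a) : HH x⁻¹ a := by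
  unfold HH; rw [inv_inv']
  rcases h with h | h | h | h | ⟨h1, h2⟩
  · exact Or.inr (Or.inl h)
  · exact Or.inl h
  · exact Or.inr (Or.inr (Or.inr (Or.inl h)))
  · exact Or.inr (Or.inr (Or.inl h))
  · exact Or.inr (Or.inr (Or.inr (Or.inr ⟨JJ_symm h1, JJ_symm h2⟩)))

theorem HH_mul {x a : S} (h : HH x a) : HH x (a * x) := by
  rcases h with h | h | h | h | ⟨h1, h2⟩
  · subst h
    refine Or.inr (Or.inr (Or.inr (Or.inr ⟨Or.inl ?_, Or.inr (Or.inr ?_)⟩)))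
    · rw [rr_mul]; exact cj_idem' _ (idem_r _)
    · rw [ll_mul]; exact cj_idem _ (idem_l _)
  · subst h; exact Or.inr (Or.inr (Or.inr (Or.inl rfl)))
  · subst h; exact Or.inl (mul_inv_mul x)
  · subst h
    refine Or.inr (Or.inr (Or.inr (Or.inr ⟨Or.inr (Or.inl ?_), Or.inr (Or.inr ?_)⟩)))
    · rw [rr_mul, idem_inv (idem_l x), idem_comm (idem_l x) (idem_r x), mul_assoc, (idem_l x).eq]
      exact idem_mul (idem_r _) (idem_l _)
    · rw [ll_emul (idem_l x)]; exact cj_idem _ (idem_l _)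
  · refine Or.inr (Or.inr (Or.inr (Or.inr ⟨JJ_le (rr_mul_le _ _) h1, ?_⟩)))
    rw [ll_mul]; exact JJ_cj (idem_l a) h2

theorem gen_HH {x a : S} (ha : a ∈ genInv ({x} : Set S)) : HH x a := by
  revert a
  apply gen_induction
  · exact Or.inl rfl
  · exact Or.inr (Or.inl rfl)
  · intro a h; exact HH_mul h
  · intro a h
    have := HH_symm (HH_mul (HH_symm h))
    rwa [inv_inv'] at this

/-- `x x⁻¹` and `x⁻¹ x` are incomparable. -/
def Inc (x : S) : Prop := ¬ idemLe (x * x⁻¹) (x⁻¹ * x) ∧ ¬ idemLe (x⁻¹ * x) (x * x⁻¹)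

theorem Inc_symm {x : S} (h : Inc x) : Inc x⁻¹ := by
  unfold Inc; rw [inv_inv']; exact ⟨h.2, h.1⟩

theorem Inc_s {x : S} (h : Inc x) : ¬ idemLe (x * x⁻¹) (x * (x * x⁻¹) * x⁻¹) := by
  intro h1
  apply h.2
  have := cj_mono x (idem_r x) h1
  rw [cj_cj' x (idem_r x), cj_top] at this
  exact le_trans' this (mul_le_left (idem_r x) (idem_l x))

theorem Inc_m {x : S} (h : Inc x) : ¬ idemLe (x * x⁻¹) ((x * x⁻¹) * (x⁻¹ * x)) := by
  intro h1
  exact h.1 (le_trans' h1 (mul_le_right (idem_l x)))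

theorem Inc_JJ {x : S} (h : Inc x) : ¬ JJ x (x * x⁻¹) := by
  rintro (h1 | h1 | h1)
  · exact Inc_s h h1
  · exact Inc_m h h1
  · exact h.1 (le_trans' h1 (cj_le x))

/-- maximality -/
theorem Inc_max {x r : S} (h : Inc x) (hr : r ∈ genInv ({x} : Set S)) (hi : IsIdempotentElem r)
    (hle : idemLe (x * x⁻¹) r) : r = x * x⁻¹ := by
  rcases gen_idem_le hr hi with h1 | h1
  · exact le_antisymm' hi (idem_r x) h1 hle
  · exact absurd (le_trans' hle h1) h.1

theorem Inc_R {x w : S} (h : Inc x) (hw : w ∈ genInv ({x} : Set S)) (hr : w * w⁻¹ = x * x⁻¹) :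
    w = x ∨ w = x * x⁻¹ := by
  rcases gen_HH hw with h1 | h1 | h1 | h1 | ⟨h1, _⟩
  · exact Or.inl h1
  · exfalso; subst h1
    rw [inv_inv'] at hr
    apply h.1; rw [hr]; exact idem_r x
  · exact Or.inr h1
  · exfalso; subst h1
    rw [rr_of_idem (idem_l x)] at hr
    apply h.1; rw [hr]; exact idem_r x
  · rw [hr] at h1; exact absurd h1 (Inc_JJ h)

/-- idempotents strictly below `x x⁻¹` -/
theorem Inc_below {x p : S} (h : Inc x) (hp : p ∈ genInv ({x} : Set S)) (hi : IsIdempotentElem p)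
    (hle : idemLe p (x * x⁻¹)) (hne : p ≠ x * x⁻¹) :
    idemLe p (x * (x * x⁻¹) * x⁻¹) ∨ idemLe p ((x * x⁻¹) * (x⁻¹ * x)) := by
  rcases gen_HH hp with h1 | h1 | h1 | h1 | ⟨h1, _⟩
  · exfalso; apply hne
    rw [← h1, rr_of_idem hi]
  · exfalso; apply hne
    have : p⁻¹ = x := by rw [h1, inv_inv']
    rw [← this, inv_inv', ll_of_idem hi]
  · exact absurd h1 hne
  · rw [h1] at hle; exact absurd hle h.2
  · rw [rr_of_idem hi] at h1
    rcases h1 with h1 | h1 | h1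
    · exact Or.inl h1
    · exact Or.inr h1
    · exact Or.inr (le_mul hle (le_trans' h1 (cj_le x)))

/-- removing `x`, `x⁻¹` leaves an inverse subsemigroup -/
theorem Inc_sub {x : S} (h : Inc x) :
    IsInvSub {a : S | a ∈ genInv ({x} : Set S) ∧ a ≠ x ∧ a ≠ x⁻¹} := by
  have key : ∀ z : S, Inc z → ∀ a ∈ genInv ({z} : Set S), ∀ b ∈ genInv ({z} : Set S),
      a ≠ z → b ≠ z → a * b ≠ z := by
    intro z hz a ha b hb haz hbz hab
    have h1 : a * a⁻¹ = z * z⁻¹ := by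
      apply Inc_max hz (r_mem (gen_sub _) ha) (idem_r a)
      rw [← hab]; exact rr_mul_le a b
    have h2 : b⁻¹ * b = z⁻¹ * z := by
      have := Inc_max (Inc_symm hz) (r := b⁻¹ * b)
        (by rw [gen_inv]; exact l_mem (gen_sub _) hb) (idem_l b)
        (by rw [inv_inv', ← hab]; exact ll_mul_le a b)
      rwa [inv_inv'] at this
    have h3 : a = z * z⁻¹ := (Inc_R hz ha h1).resolve_left haz
    have h4 : b = z⁻¹ * z := by
      have h5 := Inc_R (Inc_symm hz) (w := b⁻¹)
        (by rw [gen_inv]; exact (gen_sub _).2 _ hb)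
        (by rw [inv_inv', inv_inv', h2])
      rw [inv_inv'] at h5
      rcases h5 with h5 | h5
      · exfalso; apply hbz; rw [← inv_inv' b, h5, inv_inv']
      · rw [← inv_inv' b, h5, idem_inv (idem_l z)]
    have h5 : IsIdempotentElem z := by
      rw [← hab, h3, h4]; exact idem_mul (idem_r z) (idem_l z)
    apply hz.1
    rw [rr_of_idem h5, ll_of_idem h5]; exact h5
  constructor
  · rintro a ⟨ha, ha1, ha2⟩ b ⟨hb, hb1, hb2⟩
    refine ⟨(gen_sub _).1 _ ha _ hb, key x h a ha b hb ha1 hb1, ?_⟩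
    exact key x⁻¹ (Inc_symm h) a (by rwa [gen_inv]) b (by rwa [gen_inv]) ha2 hb2
  · rintro a ⟨ha, ha1, ha2⟩
    refine ⟨(gen_sub _).2 _ ha, ?_, ?_⟩
    · rintro h; apply ha2; rw [← h, inv_inv']
    · intro h; apply ha1; rw [← inv_inv' a, h, inv_inv']

end Incomp

section NatRel

variable {R : ℕ → ℕ → Prop}

theorem nat_rel2 (hrefl : ∀ n, R n n) (hsymm : ∀ n m, R n m → R m n)
    (htrans : ∀ n m k, R n m → R m k → R n k) (hshift : ∀ n m k, R n m → R (n + k) (m + k))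
    {d : ℕ} (hd : R 0 d) {n m : ℕ} (h : n ≡ m [MOD d]) : R n m := by
  have h0 : ∀ k, R 0 (d * k) := by
    intro k
    induction k with
    | zero => exact hrefl 0
    | succ k ih =>
      have := hshift _ _ (d * k) hd
      rw [Nat.zero_add] at this
      have h2 := htrans _ _ _ ih this
      rwa [show d * (k + 1) = d + d * k by ring]
  have key : ∀ n m, n ≤ m → n ≡ m [MOD d] → R n m := by
    intro n m hnm h
    obtain ⟨k, hk⟩ := (Nat.modEq_iff_dvd' hnm).1 h
    have := hshift _ _ n (h0 k)
    rw [← hk, Nat.zero_add, Nat.sub_add_cancel hnm] at this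
    exact this
  rcases le_total n m with hnm | hnm
  · exact key _ _ hnm h
  · exact hsymm _ _ (key _ _ hnm h.symm)

theorem nat_rel1 (hrefl : ∀ n, R n n) (hsymm : ∀ n m, R n m → R m n)
    (htrans : ∀ n m k, R n m → R m k → R n k) (hshift : ∀ n m k, R n m → R (n + k) (m + k))
    {d : ℕ} (hpos : 0 < d) (hd : R 0 d) (hmin : ∀ e, 0 < e → R 0 e → d ≤ e)
    {n m : ℕ} (h : R n m) : n ≡ m [MOD d] := by
  have key : ∀ n s, R n (n + s) → n ≡ n + s [MOD d] := by
    intro n s h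
    have hdn : n ≤ d * n := Nat.le_mul_of_pos_left n hpos
    have h1 : R 0 (d * n) := nat_rel2 hrefl hsymm htrans hshift hd
      ((Nat.modEq_zero_iff_dvd.2 (Dvd.intro _ rfl)).symm)
    have h2 := hshift _ _ (d * n - n) h
    rw [show n + (d * n - n) = d * n by omega, show n + s + (d * n - n) = d * n + s by omega] at h2
    have h3 := hshift _ _ s h1
    rw [Nat.zero_add] at h3
    have h4 : R 0 s := htrans _ _ _ h1 (htrans _ _ _ h2 (hsymm _ _ h3))
    have h5 : R s (s % d) := nat_rel2 hrefl hsymm htrans hshift hd (Nat.mod_modEq s d).symm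
    have h6 := htrans _ _ _ h4 h5
    have h7 : s % d = 0 := by
      by_contra hne
      have := hmin _ (Nat.pos_of_ne_zero hne) h6
      exact absurd (Nat.mod_lt s hpos) (by omega)
    rw [Nat.modEq_iff_dvd' (by omega)]
    simpa using Nat.dvd_of_mod_eq_zero h7
  rcases le_total n m with hnm | hnm
  · obtain ⟨s, rfl⟩ := Nat.exists_eq_add_of_le hnm
    exact key _ _ h
  · obtain ⟨s, rfl⟩ := Nat.exists_eq_add_of_le hnm
    exact (key _ _ (hsymm _ _ h)).symm

end NatRel

section ChainSec

variable {S : Type*} [InverseSemigroup S]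

structure Chn (U : Set S) (F : ℕ → S) : Prop where
  sub : IsInvSub U
  mem : ∀ n, F n ∈ U
  idem : ∀ n, IsIdempotentElem (F n)
  mul : ∀ m n, F m * F n = F (max m n)
  inj : Function.Injective F
  all : ∀ a ∈ U, IsIdempotentElem a → ∃ n, a = F n

theorem Chn.le_iff {U : Set S} {F : ℕ → S} (h : Chn U F) (m n : ℕ) :
    idemLe (F m) (F n) ↔ n ≤ m := by
  unfold idemLe
  rw [h.mul, h.inj.eq_iff]; omega

theorem Chn.half {U : Set S} {F : ℕ → S} (h : Chn U F) {a : S} (ha : a ∈ U) {i j : ℕ}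
    (hi : a * a⁻¹ = F i) (hj : a⁻¹ * a = F j) :
    ∃ g : ℕ → ℕ, StrictMono g ∧ ∀ k, a⁻¹ * F (i + k) * a = F (j + g k) := by
  have h1 : ∀ k, ∃ g, a⁻¹ * F (i + k) * a = F (j + g) := by
    intro k
    obtain ⟨n, hn⟩ := h.all (a⁻¹ * F (i + k) * a)
      (h.sub.1 _ (h.sub.1 _ (h.sub.2 _ ha) _ (h.mem _)) _ ha) (cj_idem a (h.idem _))
    have h2 := cj_le (e := F (i + k)) a
    rw [hn, hj, h.le_iff] at h2
    exact ⟨n - j, by rw [hn, Nat.add_sub_cancel' h2]⟩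
  choose g hg using h1
  refine ⟨g, ?_, hg⟩
  intro k l hkl
  have h3 : idemLe (F (i + l)) (F (i + k)) := (h.le_iff _ _).2 (by omega)
  have h4 := cj_mono a (h.idem _) h3
  rw [hg, hg, h.le_iff] at h4
  rcases Nat.lt_or_ge (g k) (g l) with h5 | h5
  · exact h5
  · exfalso
    have h6 : g k = g l := by omega
    have h7 : ∀ k, a * F (j + g k) * a⁻¹ = F (i + k) := by
      intro k
      rw [← hg, cj_cj a (h.idem _), hi, h.mul]; congr 1; omega
    have h8 := h7 k
    rw [h6, h7 l] at h8
    have := h.inj h8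
    omega

theorem Chn.shift {U : Set S} {F : ℕ → S} (h : Chn U F) {a : S} (ha : a ∈ U) {i j : ℕ}
    (hi : a * a⁻¹ = F i) (hj : a⁻¹ * a = F j) (k : ℕ) : a⁻¹ * F (i + k) * a = F (j + k) := by
  obtain ⟨g, hg, hg1⟩ := h.half ha hi hj
  obtain ⟨g', hg', hg2⟩ := h.half (h.sub.2 _ ha) (i := j) (j := i)
    (by rw [inv_inv', hj]) (by rw [inv_inv', hi])
  have h1 : g' (g k) = k := by
    have := hg2 (g k)
    rw [inv_inv', ← hg1, cj_cj a (h.idem _), hi, h.mul] at this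
    have := h.inj this
    omega
  have h2 := hg.le_apply (x := k)
  have h3 := hg'.le_apply (x := g k)
  rw [hg1, show g k = k by omega]

theorem Chn.shift' {U : Set S} {F : ℕ → S} (h : Chn U F) {a : S} (ha : a ∈ U) {i j : ℕ}
    (hi : a * a⁻¹ = F i) (hj : a⁻¹ * a = F j) (k : ℕ) : a * F (j + k) * a⁻¹ = F (i + k) := by
  rw [← h.shift ha hi hj, cj_cj a (h.idem _), hi, h.mul]; congr 1; omega

theorem Chn.ex {U : Set S} {F : ℕ → S} (h : Chn U F) {a : S} (ha : a ∈ U) :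
    ∃ i j, a * a⁻¹ = F i ∧ a⁻¹ * a = F j := by
  obtain ⟨i, hi⟩ := h.all _ (r_mem h.sub ha) (idem_r a)
  obtain ⟨j, hj⟩ := h.all _ (l_mem h.sub ha) (idem_l a)
  exact ⟨i, j, hi, hj⟩

def Rl (U : Set S) (F : ℕ → S) (i j : ℕ) : Prop := ∃ a ∈ U, a * a⁻¹ = F i ∧ a⁻¹ * a = F j

theorem Chn.prod {U : Set S} {F : ℕ → S} (h : Chn U F) {a b : S} (ha : a ∈ U) (hb : b ∈ U)
    {i j k l : ℕ} (hi : a * a⁻¹ = F i) (hj : a⁻¹ * a = F j)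
    (hk : b * b⁻¹ = F k) (hl : b⁻¹ * b = F l) :
    (a * b) * (a * b)⁻¹ = F (i + (max j k - j)) ∧ (a * b)⁻¹ * (a * b) = F (l + (max j k - k)) := by
  constructor
  · rw [rr_mul, ← h.shift' ha hi hj, hk, ← mul_inv_mul a]
    have : j + (max j k - j) = max j k := by omega
    rw [this, ← h.mul, ← hj]
    simp only [mul_assoc]
    simp only [← mul_assoc, mul_inv_mul]
  · rw [ll_mul, hj, ← h.shift hb hk hl]
    have : k + (max j k - k) = max k j := by omega
    rw [this, ← h.mul, ← hk]
    simp only [← mul_assoc, inv_mul_inv]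

theorem Chn.rel_refl {U : Set S} {F : ℕ → S} (h : Chn U F) (n : ℕ) : Rl U F n n :=
  ⟨F n, h.mem n, rr_of_idem (h.idem n), ll_of_idem (h.idem n)⟩

theorem Chn.rel_symm {U : Set S} {F : ℕ → S} (h : Chn U F) (n m : ℕ) (hr : Rl U F n m) :
    Rl U F m n := by
  obtain ⟨a, ha, h1, h2⟩ := hr
  exact ⟨a⁻¹, h.sub.2 _ ha, by rw [inv_inv', h2], by rw [inv_inv', h1]⟩

theorem Chn.rel_trans {U : Set S} {F : ℕ → S} (h : Chn U F) (n m k : ℕ) (hr : Rl U F n m)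
    (hs : Rl U F m k) : Rl U F n k := by
  obtain ⟨a, ha, h1, h2⟩ := hr
  obtain ⟨b, hb, h3, h4⟩ := hs
  have := h.prod ha hb h1 h2 h3 h4
  simp only [max_self, Nat.sub_self, Nat.add_zero] at this
  exact ⟨a * b, h.sub.1 _ ha _ hb, this⟩

theorem Chn.rel_shift {U : Set S} {F : ℕ → S} (h : Chn U F) (n m k : ℕ) (hr : Rl U F n m) :
    Rl U F (n + k) (m + k) := by
  obtain ⟨a, ha, h1, h2⟩ := hr
  refine ⟨F (n + k) * a, h.sub.1 _ (h.mem _) _ ha, ?_, ?_⟩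
  · rw [rr_emul (h.idem _)]
    rw [h1, h.le_iff]; omega
  · rw [ll_emul (h.idem _), h.shift ha h1 h2]

/-- comparison of two chain subsemigroups -/
theorem Chn.le_of {U V : Set S} {F : ℕ → S} (hC : Combinatorial S) (h : Chn U F) 
    (hr : ∀ i j, Rl U F i j → Rl V F i j) : U ⊆ V := by
  intro a ha
  obtain ⟨i, j, hi, hj⟩ := h.ex ha
  obtain ⟨b, hb, h1, h2⟩ := hr i j ⟨a, ha, hi, hj⟩
  rw [hC a b (hi.trans h1.symm) (hj.trans h2.symm)]; exact hb

/-- subsets of a chain subsemigroup defined by congruences -/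
theorem Chn.mod_sub {U : Set S} {F : ℕ → S} (h : Chn U F) (d : ℕ) :
    IsInvSub {a | a ∈ U ∧ ∃ i j, a * a⁻¹ = F i ∧ a⁻¹ * a = F j ∧ i ≡ j [MOD d]} := by
  constructor
  · rintro a ⟨ha, i, j, hi, hj, hij⟩ b ⟨hb, k, l, hk, hl, hkl⟩
    obtain ⟨h1, h2⟩ := h.prod ha hb hi hj hk hl
    refine ⟨h.sub.1 _ ha _ hb, _, _, h1, h2, ?_⟩
    have e1 : i + (max j k - j) ≡ j + (max j k - j) [MOD d] := hij.add_right _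
    have e2 : k + (max j k - k) ≡ l + (max j k - k) [MOD d] := hkl.add_right _
    rw [show j + (max j k - j) = max j k by omega] at e1
    rw [show k + (max j k - k) = max j k by omega] at e2
    exact e1.trans e2
  · rintro a ⟨ha, i, j, hi, hj, hij⟩
    exact ⟨h.sub.2 _ ha, j, i, by rw [inv_inv', hj], by rw [inv_inv', hi], hij.symm⟩

theorem Chn.dvd_sub {U : Set S} {F : ℕ → S} (h : Chn U F) (d : ℕ) :
    IsInvSub {a | a ∈ U ∧ ∃ i j, a * a⁻¹ = F i ∧ a⁻¹ * a = F j ∧ d ∣ i ∧ d ∣ j} := by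
  constructor
  · rintro a ⟨ha, i, j, hi, hj, di, dj⟩ b ⟨hb, k, l, hk, hl, dk, dl⟩
    obtain ⟨h1, h2⟩ := h.prod ha hb hi hj hk hl
    have dm : d ∣ max j k := by rcases max_choice j k with e | e <;> rw [e] <;> assumption
    exact ⟨h.sub.1 _ ha _ hb, _, _, h1, h2, dvd_add di (Nat.dvd_sub dm dj),
      dvd_add dl (Nat.dvd_sub dm dk)⟩
  · rintro a ⟨ha, i, j, hi, hj, di, dj⟩
    exact ⟨h.sub.2 _ ha, j, i, by rw [inv_inv', hj], by rw [inv_inv', hi], dj, di⟩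

/-- the idempotents `x⁻ⁿ xⁿ` -/
def fs (x : S) : ℕ → S
  | 0 => x * x⁻¹
  | n + 1 => x⁻¹ * fs x n * x

theorem fs_idem (x : S) (n : ℕ) : IsIdempotentElem (fs x n) := by
  induction n with
  | zero => exact idem_r x
  | succ n ih => exact cj_idem x ih

theorem fs_one (x : S) : fs x 1 = x⁻¹ * x := cj_top x

theorem fs_mem {x : S} (n : ℕ) : fs x n ∈ genInv ({x} : Set S) := by
  induction n with
  | zero => exact r_mem (gen_sub _) (mem_gen x)
  | succ n ih => exact (gen_sub _).1 _ ((gen_sub _).1 _ (inv_mem_gen x) _ ih) _ (mem_gen x)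

theorem fs_step {x : S} (h : idemLe (x⁻¹ * x) (x * x⁻¹)) (n : ℕ) :
    idemLe (fs x (n + 1)) (fs x n) := by
  induction n with
  | zero => rw [fs_one]; exact h
  | succ n ih => exact cj_mono x (fs_idem x _) ih

theorem fs_anti {x : S} (h : idemLe (x⁻¹ * x) (x * x⁻¹)) (n k : ℕ) :
    idemLe (fs x (n + k)) (fs x n) := by
  induction k with
  | zero => exact fs_idem x n
  | succ k ih => exact le_trans' (fs_step h (n + k)) ih

theorem fs_back {x : S} (h : idemLe (x⁻¹ * x) (x * x⁻¹)) (n : ℕ) :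
    x * fs x (n + 1) * x⁻¹ = fs x n := by
  have h2 := fs_anti h 0 n
  rw [Nat.zero_add] at h2
  exact (cj_cj x (fs_idem x n)).trans h2

theorem fs_strict {x : S} (h : idemLe (x⁻¹ * x) (x * x⁻¹)) (hne : x⁻¹ * x ≠ x * x⁻¹) (n : ℕ) :
    fs x (n + 1) ≠ fs x n := by
  induction n with
  | zero => rw [fs_one]; exact hne
  | succ n ih =>
    intro h1; apply ih
    rw [← fs_back h (n + 1), h1, fs_back h n]

theorem fs_chn {x : S} (h : idemLe (x⁻¹ * x) (x * x⁻¹)) (hne : x⁻¹ * x ≠ x * x⁻¹) :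
    Chn (genInv ({x} : Set S)) (fs x) where
  sub := gen_sub _
  mem := fs_mem
  idem := fs_idem x
  mul := by
    intro m n
    rcases le_total m n with hmn | hmn
    · obtain ⟨k, rfl⟩ := Nat.exists_eq_add_of_le hmn
      rw [max_eq_right hmn, idem_comm (fs_idem x _) (fs_idem x _)]
      exact fs_anti h _ _
    · obtain ⟨k, rfl⟩ := Nat.exists_eq_add_of_le hmn
      rw [max_eq_left hmn]
      exact fs_anti h _ _
  inj := by
    have key : ∀ m k, fs x (m + (k + 1)) ≠ fs x m := by
      intro m k he
      apply fs_strict h hne m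
      apply le_antisymm' (fs_idem x _) (fs_idem x _) (fs_step h m)
      rw [← he, show m + (k + 1) = m + 1 + k by omega]
      exact fs_anti h _ _
    intro m n he
    rcases lt_trichotomy m n with hmn | hmn | hmn
    · obtain ⟨k, rfl⟩ := Nat.exists_eq_add_of_lt hmn
      exact absurd he.symm (key m k)
    · exact hmn
    · obtain ⟨k, rfl⟩ := Nat.exists_eq_add_of_lt hmn
      exact absurd he (key n k)
  all := by
    have key : ∀ a ∈ genInv ({x} : Set S), ∃ n m, a⁻¹ * a = fs x m ∧
        ∀ k, a * fs x (m + k) * a⁻¹ = fs x (n + k) := by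
      apply gen_induction
      · refine ⟨0, 1, (fs_one x).symm, fun k => ?_⟩
        rw [Nat.add_comm 1 k, fs_back h, Nat.zero_add]
      · refine ⟨1, 0, by rw [inv_inv']; rfl, fun k => ?_⟩
        rw [inv_inv', Nat.add_comm 1 k, Nat.zero_add]; rfl
      · rintro a ⟨n, m, h1, h2⟩
        refine ⟨n, m + 1, by rw [ll_mul, h1]; rfl, fun k => ?_⟩
        rw [← h2 k, ← fs_back h (m + k), mul_inv', show m + 1 + k = m + k + 1 by omega]
        simp only [mul_assoc]
      · rintro a ⟨n, m, h1, h2⟩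
        cases m with
        | zero =>
          refine ⟨n + 1, 0, ?_, fun k => ?_⟩
          · rw [ll_mul, h1, inv_inv']
            change x * (x * x⁻¹) * x⁻¹ = x * x⁻¹
            have h3 : x * (x * x⁻¹) = x := by
              calc x * (x * x⁻¹) = x * ((x⁻¹ * x) * (x * x⁻¹)) := by
                    simp only [← mul_assoc, mul_inv_mul]
                _ = x := by rw [show (x⁻¹ * x) * (x * x⁻¹) = x⁻¹ * x from h, ← mul_assoc, mul_inv_mul]
            rw [h3]
          · have h3 := h2 (k + 1)
            rw [show n + 1 + k = n + (k + 1) by omega, ← h3, mul_inv', inv_inv', Nat.zero_add,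
              Nat.zero_add]
            change _ = a * (x⁻¹ * fs x k * x) * a⁻¹
            simp only [mul_assoc]
        | succ m =>
          refine ⟨n, m, by rw [ll_mul, h1, inv_inv', fs_back h], fun k => ?_⟩
          rw [← h2 k, mul_inv', inv_inv', show m + 1 + k = m + k + 1 by omega]
          change _ = a * (x⁻¹ * fs x (m + k) * x) * a⁻¹
          simp only [mul_assoc]
    intro a ha hi
    obtain ⟨_, m, h1, _⟩ := key a ha
    exact ⟨m, by rw [← h1, ll_of_idem hi]⟩

end ChainSec

section LISec

universe u v

structure LI (S : Type u) (T : Type v) [InverseSemigroup S] [InverseSemigroup T] where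
  combS : Combinatorial S
  combT : Combinatorial T
  F : Set S → Set T
  G : Set T → Set S
  F_sub : ∀ {U}, IsInvSub U → IsInvSub (F U)
  G_sub : ∀ {U}, IsInvSub U → IsInvSub (G U)
  FG : ∀ {V}, IsInvSub V → F (G V) = V
  GF : ∀ {U}, IsInvSub U → G (F U) = U
  F_mono : ∀ {U V}, IsInvSub U → IsInvSub V → U ⊆ V → F U ⊆ F V
  G_mono : ∀ {U V}, IsInvSub U → IsInvSub V → U ⊆ V → G U ⊆ G V
  p : S → T
  q : T → S
  p_idem : ∀ {e}, IsIdempotentElem e → IsIdempotentElem (p e)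
  q_idem : ∀ {e}, IsIdempotentElem e → IsIdempotentElem (q e)
  qp : ∀ {e}, IsIdempotentElem e → q (p e) = e
  pq : ∀ {e}, IsIdempotentElem e → p (q e) = e
  p_mul : ∀ {e f}, IsIdempotentElem e → IsIdempotentElem f → p (e * f) = p e * p f
  q_mul : ∀ {e f}, IsIdempotentElem e → IsIdempotentElem f → q (e * f) = q e * q f
  F_single : ∀ {e}, IsIdempotentElem e → F {e} = {p e}
  G_single : ∀ {e}, IsIdempotentElem e → G {e} = {q e}

variable {S : Type u} {T : Type v} [InverseSemigroup S] [InverseSemigroup T]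

namespace LI

def symm (L : LI S T) : LI T S where
  combS := L.combT
  combT := L.combS
  F := L.G
  G := L.F
  F_sub := L.G_sub
  G_sub := L.F_sub
  FG := L.GF
  GF := L.FG
  F_mono := L.G_mono
  G_mono := L.F_mono
  p := L.q
  q := L.p
  p_idem := L.q_idem
  q_idem := L.p_idem
  qp := L.pq
  pq := L.qp
  p_mul := L.q_mul
  q_mul := L.p_mul
  F_single := L.G_single
  G_single := L.F_single

variable (L : LI S T)

theorem F_le {U V : Set S} (hU : IsInvSub U) (hV : IsInvSub V) (h : L.F U ⊆ L.F V) : U ⊆ V := by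
  have := L.G_mono (L.F_sub hU) (L.F_sub hV) h
  rwa [L.GF hU, L.GF hV] at this

theorem mem_iff {U : Set S} (hU : IsInvSub U) {e : S} (he : IsIdempotentElem e) :
    L.p e ∈ L.F U ↔ e ∈ U := by
  have h1 : ({e} : Set S) ⊆ U ↔ L.F {e} ⊆ L.F U :=
    ⟨L.F_mono (singleton_sub he) hU, L.F_le (singleton_sub he) hU⟩
  rw [L.F_single he, Set.singleton_subset_iff, Set.singleton_subset_iff] at h1
  exact h1.symm

theorem p_inj {e f : S} (he : IsIdempotentElem e) (hf : IsIdempotentElem f)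
    (h : L.p e = L.p f) : e = f := by
  rw [← L.qp he, h, L.qp hf]

theorem p_le {e f : S} (he : IsIdempotentElem e) (hf : IsIdempotentElem f) :
    idemLe (L.p e) (L.p f) ↔ idemLe e f := by
  unfold idemLe
  rw [← L.p_mul he hf]
  exact ⟨fun h => L.p_inj (idem_mul he hf) he h, fun h => by rw [h]⟩

theorem adj {U : Set S} {V : Set T} (hU : IsInvSub U) (hV : IsInvSub V) :
    L.F U ⊆ V ↔ U ⊆ L.G V := by
  constructor
  · intro h
    have := L.G_mono (L.F_sub hU) hV h
    rwa [L.GF hU] at this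
  · intro h
    have := L.F_mono hU (L.G_sub hV) h
    rwa [L.FG hV] at this

theorem adj' {U : Set S} {V : Set T} (hU : IsInvSub U) (hV : IsInvSub V) :
    V ⊆ L.F U ↔ L.G V ⊆ U := (L.symm.adj hV hU).symm

def Mt (x : S) (y : T) : Prop :=
  y * y⁻¹ = L.p (x * x⁻¹) ∧ y⁻¹ * y = L.p (x⁻¹ * x) ∧
    L.F (genInv {x}) = genInv {y}

variable {L}

theorem Mt.inv {x : S} {y : T} (h : L.Mt x y) : L.Mt x⁻¹ y⁻¹ := by
  obtain ⟨h1, h2, h3⟩ := h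
  refine ⟨?_, ?_, ?_⟩
  · rw [inv_inv', inv_inv', h2]
  · rw [inv_inv', inv_inv', h1]
  · rw [gen_inv, gen_inv, h3]

theorem Mt.symm {x : S} {y : T} (h : L.Mt x y) : L.symm.Mt y x := by
  obtain ⟨h1, h2, h3⟩ := h
  refine ⟨?_, ?_, ?_⟩
  · rw [h1]; exact (L.qp (idem_r x)).symm
  · rw [h2]; exact (L.qp (idem_l x)).symm
  · rw [← h3]; exact L.GF (gen_sub _)

theorem Mt.mem {x : S} {y : T} (h : L.Mt x y) {U : Set S} (hU : IsInvSub U) :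
    y ∈ L.F U ↔ x ∈ U := by
  rw [← gen1_le_iff (L.F_sub hU), ← h.2.2, ← gen1_le_iff hU]
  exact ⟨L.F_le (gen_sub _) hU, L.F_mono (gen_sub _) hU⟩

theorem Mt.inc {x : S} {y : T} (h : L.Mt x y) (hi : Inc x) : Inc y := by
  unfold Inc
  rw [h.1, h.2.1, L.p_le (idem_r x) (idem_l x), L.p_le (idem_l x) (idem_r x)]
  exact hi

theorem mt_idem {e : S} (he : IsIdempotentElem e) : L.Mt e (L.p e) := by
  refine ⟨?_, ?_, ?_⟩
  · rw [rr_of_idem he, rr_of_idem (L.p_idem he)]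
  · rw [ll_of_idem he, ll_of_idem (L.p_idem he)]
  · have h : ∀ {R : Type _} [InverseSemigroup R] {e : R}, IsIdempotentElem e →
        genInv {e} = {e} := by
      intro R _ e he
      exact Set.Subset.antisymm (gen_le (singleton_sub he) le_rfl) (subset_gen _)
    have h' : ∀ {R : Type _} [InverseSemigroup R] {e : R}, IsIdempotentElem e →
        genInv {e} = {e} := by
      intro R _ e he
      exact Set.Subset.antisymm (gen_le (singleton_sub he) le_rfl) (subset_gen _)
    rw [h he, h' (L.p_idem he), L.F_single he]

theorem exists_inc {x : S} (hx : Inc x) : ∃ y, L.Mt x y := by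
  have hK := Inc_sub hx
  set K : Set S := {a : S | a ∈ genInv ({x} : Set S) ∧ a ≠ x ∧ a ≠ x⁻¹} with hKdef
  have hx1 : ¬ L.F (genInv {x}) ⊆ L.F K := by
    intro h
    have := L.F_le (gen_sub _) hK h (mem_gen x)
    exact this.2.1 rfl
  obtain ⟨y, hy, hyK⟩ := Set.not_subset.1 hx1
  have h1 : L.G (genInv {y}) ⊆ genInv {x} := by
    rw [← L.adj' (gen_sub _) (gen_sub _)]
    exact gen1_le (L.F_sub (gen_sub _)) hy
  have h2 : ¬ L.G (genInv {y}) ⊆ K := by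
    rw [← L.adj' hK (gen_sub _)]
    intro h; exact hyK (h (mem_gen y))
  obtain ⟨a, ha, haK⟩ := Set.not_subset.1 h2
  have h3 : x ∈ L.G (genInv {y}) := by
    have : a = x ∨ a = x⁻¹ := by
      by_contra hcon
      push Not at hcon
      exact haK ⟨h1 ha, hcon⟩
    rcases this with rfl | rfl
    · exact ha
    · have := (L.G_sub (gen_sub {y})).2 _ ha
      rwa [inv_inv'] at this
  have h4 : L.F (genInv {x}) = genInv {y} := by
    have : L.G (genInv {y}) = genInv {x} :=
      Set.Subset.antisymm h1 (gen1_le (L.G_sub (gen_sub _)) h3)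
    rw [← this, L.FG (gen_sub _)]
  -- idempotents
  have ier := L.p_idem (idem_r x)
  have iel := L.p_idem (idem_l x)
  have m1 : L.p (x * x⁻¹) ∈ genInv {y} := by
    rw [← h4, L.mem_iff (gen_sub _) (idem_r x)]; exact r_mem (gen_sub _) (mem_gen x)
  have m2 : L.p (x⁻¹ * x) ∈ genInv {y} := by
    rw [← h4, L.mem_iff (gen_sub _) (idem_l x)]; exact l_mem (gen_sub _) (mem_gen x)
  have back : ∀ r ∈ genInv {y}, IsIdempotentElem r →
      idemLe r (L.p (x * x⁻¹)) ∨ idemLe r (L.p (x⁻¹ * x)) := by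
    intro r hr hi
    have hq := L.q_idem hi
    have : L.q r ∈ genInv {x} := by
      rw [← L.mem_iff (gen_sub _) hq, L.pq hi, h4]; exact hr
    rcases gen_idem_le this hq with h | h
    · left; rw [← L.p_le hq (idem_r x), L.pq hi] at h; exact h
    · right; rw [← L.p_le hq (idem_l x), L.pq hi] at h; exact h
  have n1 : ¬ idemLe (L.p (x * x⁻¹)) (L.p (x⁻¹ * x)) := by
    rw [L.p_le (idem_r x) (idem_l x)]; exact hx.1
  have n2 : ¬ idemLe (L.p (x⁻¹ * x)) (L.p (x * x⁻¹)) := by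
    rw [L.p_le (idem_l x) (idem_r x)]; exact hx.2
  have fin : ∀ z : T, genInv {z} = genInv {y} → idemLe (L.p (x * x⁻¹)) (z * z⁻¹) →
      L.Mt x z := by
    intro z hz hle
    have e1 : z * z⁻¹ = L.p (x * x⁻¹) := by
      rcases back (z * z⁻¹) (by rw [← hz]; exact r_mem (gen_sub _) (mem_gen z)) (idem_r z) with h | h
      · exact le_antisymm' (idem_r z) ier h hle
      · exact absurd (le_trans' hle h) n1
    have e2 : z⁻¹ * z = L.p (x⁻¹ * x) := by
      rw [← hz] at m2
      rcases gen_idem_le m2 iel with h | h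
      · rw [e1] at h; exact absurd h n2
      · rcases back (z⁻¹ * z) (by rw [← hz]; exact l_mem (gen_sub _) (mem_gen z)) (idem_l z)
          with h' | h'
        · exact absurd (le_trans' h h') n2
        · exact le_antisymm' (idem_l z) iel h' h
    exact ⟨e1, e2, by rw [h4, hz]⟩
  rcases gen_idem_le m1 ier with h | h
  · exact ⟨y, fin y rfl h⟩
  · exact ⟨y⁻¹, fin y⁻¹ (gen_inv y) (by rwa [inv_inv'])⟩

theorem chn_map {U : Set S} {f : ℕ → S} (h : Chn U f) : Chn (L.F U) (fun n => L.p (f n)) where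
  sub := L.F_sub h.sub
  mem n := (L.mem_iff h.sub (h.idem n)).2 (h.mem n)
  idem n := L.p_idem (h.idem n)
  mul m n := by rw [← L.p_mul (h.idem m) (h.idem n), h.mul]
  inj m n hmn := h.inj (L.p_inj (h.idem m) (h.idem n) hmn)
  all a ha hi := by
    have hq := L.q_idem hi
    obtain ⟨n, hn⟩ := h.all (L.q a) ((L.mem_iff h.sub hq).1 (by rwa [L.pq hi])) hq
    exact ⟨n, by rw [← hn, L.pq hi]⟩

theorem chn_of_sub {U V : Set S} {f : ℕ → S} (h : Chn U f) (hV : IsInvSub V) (hVU : V ⊆ U)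
    (hm : ∀ n, f n ∈ V) : Chn V f where
  sub := hV
  mem := hm
  idem := h.idem
  mul := h.mul
  inj := h.inj
  all a ha := h.all a (hVU ha)

theorem bic_step1 {x : S} (hle : idemLe (x⁻¹ * x) (x * x⁻¹)) (hne : x⁻¹ * x ≠ x * x⁻¹) :
    ∃ d, 0 < d ∧ Rl (L.F (genInv {x})) (fun n => L.p (fs x n)) 0 d := by
  by_contra hcon
  push Not at hcon
  have hx := fs_chn hle hne
  have hU := chn_map (L := L) hx
  set f' : ℕ → T := fun n => L.p (fs x n) with hf'
  set U := L.F (genInv {x}) with hUdef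
  have iso : ∀ a ∈ U, a * a⁻¹ = f' 0 → a = f' 0 := by
    intro a ha h0
    obtain ⟨j, hj⟩ := hU.all _ (l_mem hU.sub ha) (idem_l a)
    have : j = 0 := by
      by_contra hj0
      exact hcon j (Nat.pos_of_ne_zero hj0) ⟨a, ha, h0, hj⟩
    subst this
    have hai := comb_idem L.combT (h0.trans hj.symm)
    rw [← h0, rr_of_idem hai]
  have hV' : IsInvSub {a | a ∈ U ∧ a ≠ f' 0} := by
    constructor
    · rintro a ⟨ha, ha0⟩ b ⟨hb, hb0⟩
      refine ⟨hU.sub.1 _ ha _ hb, fun hab => ha0 (iso a ha ?_)⟩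
      obtain ⟨i, hi⟩ := hU.all _ (r_mem hU.sub ha) (idem_r a)
      have h1 := rr_mul_le a b
      rw [hab, rr_of_idem (hU.idem 0), hi, hU.le_iff] at h1
      rw [hi, Nat.le_zero.1 h1]
    · rintro a ⟨ha, ha0⟩
      refine ⟨hU.sub.2 _ ha, fun h => ha0 ?_⟩
      rw [← inv_inv' a, h, idem_inv (hU.idem 0)]
  set V' : Set T := {a | a ∈ U ∧ a ≠ f' 0} with hV'def
  have hW : IsInvSub {a : S | a = x * x⁻¹ ∨
      (idemLe (a * a⁻¹) (x⁻¹ * x) ∧ idemLe (a⁻¹ * a) (x⁻¹ * x))} := by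
    constructor
    · rintro a (rfl | ⟨ha1, ha2⟩) b (rfl | ⟨hb1, hb2⟩)
      · left; exact idem_r x
      · right
        have h1 : x * x⁻¹ * b = b := by
          have h2 : idemLe (b * b⁻¹) (x * x⁻¹) := le_trans' hb1 hle
          calc x * x⁻¹ * b = (x * x⁻¹) * (b * b⁻¹) * b := by rw [mul_assoc (x * x⁻¹), mul_inv_mul]
            _ = b := by rw [idem_comm (idem_r x) (idem_r b), h2, mul_inv_mul]
        rw [h1]; exact ⟨hb1, hb2⟩
      · right
        have h1 : a * (x * x⁻¹) = a := by
          have h2 : idemLe (a⁻¹ * a) (x * x⁻¹) := le_trans' ha2 hle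
          calc a * (x * x⁻¹) = a * ((a⁻¹ * a) * (x * x⁻¹)) := by
                simp only [← mul_assoc, mul_inv_mul]
            _ = a := by rw [h2, ← mul_assoc, mul_inv_mul]
        rw [h1]; exact ⟨ha1, ha2⟩
      · right
        exact ⟨le_trans' (rr_mul_le _ _) ha1, le_trans' (ll_mul_le _ _) hb2⟩
    · rintro a (rfl | ⟨ha1, ha2⟩)
      · left; exact idem_inv (idem_r x)
      · right; rw [inv_inv']; exact ⟨ha2, ha1⟩
  set W : Set S := {a : S | a = x * x⁻¹ ∨
      (idemLe (a * a⁻¹) (x⁻¹ * x) ∧ idemLe (a⁻¹ * a) (x⁻¹ * x))} with hWdef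
  have hGV : L.G V' ⊆ genInv {x} := by
    rw [← L.adj' (gen_sub _) hV']
    exact fun a ha => ha.1
  have hn0 : fs x 0 ∉ L.G V' := by
    rw [← L.mem_iff (L.G_sub hV') (hx.idem 0), L.FG hV']
    exact fun h => h.2 rfl
  have hVW : L.G V' ⊆ W := by
    intro a ha
    right
    obtain ⟨i, j, hi, hj⟩ := hx.ex (hGV ha)
    rw [← fs_one, hi, hj, hx.le_iff, hx.le_iff]
    constructor
    · rw [Nat.one_le_iff_ne_zero]; rintro rfl
      apply hn0; rw [← hi]; exact r_mem (L.G_sub hV') ha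
    · rw [Nat.one_le_iff_ne_zero]; rintro rfl
      apply hn0; rw [← hj]; exact l_mem (L.G_sub hV') ha
  have hUW : U ⊆ L.F W := by
    intro a ha
    by_cases h0 : a = f' 0
    · rw [h0]; exact (L.mem_iff hW (idem_r x)).2 (Or.inl rfl)
    · exact (L.adj' hW hV').2 hVW ⟨ha, h0⟩
  have hxW : x ∈ W := L.F_le (gen_sub _) hW hUW (mem_gen x)
  rcases hxW with h | ⟨h, _⟩
  · apply hne
    have hi : IsIdempotentElem x := by rw [h]; exact idem_r x
    rw [rr_of_idem hi, ll_of_idem hi]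
  · exact hne (le_antisymm' (idem_l x) (idem_r x) hle h)

theorem exists_bic {x : S} (hle : idemLe (x⁻¹ * x) (x * x⁻¹)) (hne : x⁻¹ * x ≠ x * x⁻¹) :
    ∃ y, L.Mt x y := by
  classical
  have hx := fs_chn hle hne
  have hU := chn_map (L := L) hx
  have hex := bic_step1 (L := L) hle hne
  set f' : ℕ → T := fun n => L.p (fs x n) with hf'
  set U := L.F (genInv {x}) with hUdef
  obtain ⟨hdpos, y, hyU, hyr, hyl⟩ := Nat.find_spec hex
  have hmin : ∀ e, 0 < e → Rl U f' 0 e → Nat.find hex ≤ e :=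
    fun e h1 h2 => Nat.find_min' hex ⟨h1, h2⟩
  set d := Nat.find hex with hd
  have hgy : genInv {y} ⊆ U := gen1_le hU.sub hyU
  have hW := hx.mod_sub d
  set W : Set S := {a | a ∈ genInv {x} ∧
    ∃ i j, a * a⁻¹ = fs x i ∧ a⁻¹ * a = fs x j ∧ i ≡ j [MOD d]} with hWdef
  have hdv : ∀ i, f' i ∈ genInv {y} → d ∣ i := by
    intro i hi
    obtain ⟨_, i', j', h1, h2, h3, h4⟩ := gen1_le (hU.dvd_sub d)
      ⟨hyU, 0, d, hyr, hyl, dvd_zero d, dvd_refl d⟩ hi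
    rw [rr_of_idem (hU.idem i)] at h1
    rw [hU.inj h1]; exact h3
  have hGy : L.G (genInv {y}) ⊆ W := by
    intro a ha
    have hax : a ∈ genInv {x} := (L.adj' (gen_sub _) (gen_sub _)).1 hgy ha
    obtain ⟨i, j, hi, hj⟩ := hx.ex hax
    have key : ∀ n, fs x n ∈ L.G (genInv {y}) → d ∣ n := by
      intro n hn
      apply hdv
      have := (L.mem_iff (L.G_sub (gen_sub _)) (hx.idem n)).2 hn
      rwa [L.FG (gen_sub _)] at this
    have di := key i (by rw [← hi]; exact r_mem (L.G_sub (gen_sub _)) ha)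
    have dj := key j (by rw [← hj]; exact l_mem (L.G_sub (gen_sub _)) ha)
    exact ⟨hax, i, j, hi, hj,
      (Nat.modEq_zero_iff_dvd.2 di).trans (Nat.modEq_zero_iff_dvd.2 dj).symm⟩
  have hyW : y ∈ L.F W := (L.adj' hW (gen_sub _)).2 hGy (mem_gen y)
  have hFW : Chn (L.F W) f' := by
    apply chn_of_sub hU (L.F_sub hW)
    · exact L.F_mono hW (gen_sub _) (fun a ha => ha.1)
    · intro n
      rw [L.mem_iff hW (hx.idem n)]
      exact ⟨fs_mem n, n, n, rr_of_idem (hx.idem n), ll_of_idem (hx.idem n), rfl⟩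
  have hUW : U ⊆ L.F W := by
    apply hU.le_of L.combT
    intro i j hij
    have h1 := nat_rel1 hU.rel_refl hU.rel_symm hU.rel_trans hU.rel_shift hdpos
      ⟨y, hyU, hyr, hyl⟩ hmin hij
    exact nat_rel2 hFW.rel_refl hFW.rel_symm hFW.rel_trans hFW.rel_shift
      ⟨y, hyW, hyr, hyl⟩ h1
  obtain ⟨_, i, j, hi, hj, hij⟩ : x ∈ W := L.F_le (gen_sub _) hW hUW (mem_gen x)
  have hi0 : 0 = i := hx.inj hi
  have hj1 : 1 = j := hx.inj ((fs_one x).trans hj)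
  subst hi0 hj1
  have hd1 : d = 1 := by
    have := (Nat.modEq_iff_dvd' (Nat.zero_le 1)).1 hij
    simpa using this
  rw [hd1] at hyl
  have hfy : ∀ n, f' n ∈ genInv {y} := by
    intro n
    induction n with
    | zero => rw [← hyr]; exact r_mem (gen_sub _) (mem_gen y)
    | succ n ih =>
      have := hU.shift hyU hyr hyl n
      rw [Nat.zero_add, Nat.add_comm 1 n] at this
      rw [← this]
      exact (gen_sub _).1 _ ((gen_sub _).1 _ (inv_mem_gen y) _ ih) _ (mem_gen y)
  have hCy : Chn (genInv {y}) f' := chn_of_sub hU (gen_sub _) hgy hfy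
  refine ⟨y, hyr, by rw [hyl, ← fs_one], Set.Subset.antisymm ?_ hgy⟩
  apply hU.le_of L.combT
  intro i j _
  exact nat_rel2 hCy.rel_refl hCy.rel_symm hCy.rel_trans hCy.rel_shift
      ⟨y, mem_gen y, hyr, hyl⟩ (Nat.modEq_one)

theorem exists_mt (x : S) : ∃ y, L.Mt x y := by
  by_cases hx : x * x⁻¹ = x⁻¹ * x
  · exact ⟨_, mt_idem (comb_idem L.combS hx)⟩
  by_cases h1 : idemLe (x⁻¹ * x) (x * x⁻¹)
  · exact exists_bic h1 (Ne.symm hx)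
  by_cases h2 : idemLe (x * x⁻¹) (x⁻¹ * x)
  · obtain ⟨y, hy⟩ := exists_bic (L := L) (x := x⁻¹) (by rwa [inv_inv']) (by rwa [inv_inv'])
    refine ⟨y⁻¹, ?_⟩
    have := hy.inv
    rwa [inv_inv'] at this
  · exact exists_inc ⟨h2, h1⟩

end LI

end LISec

section KeySec

universe u v

variable {S : Type u} {T : Type v} [InverseSemigroup S] [InverseSemigroup T]

namespace LI

variable {L : LI S T}

theorem cj_m (x : S) : x⁻¹ * ((x * x⁻¹) * (x⁻¹ * x)) * x = x⁻¹ * (x⁻¹ * x) * x := by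
  simp only [← mul_assoc, inv_mul_inv]

theorem below_tr {x : S} {y : T} (h : L.Mt x y) (hi : Inc x) :
    idemLe (L.p (x * (x * x⁻¹) * x⁻¹)) (y * (y * y⁻¹) * y⁻¹) ∨
      idemLe (x * (x * x⁻¹) * x⁻¹) ((x * x⁻¹) * (x⁻¹ * x)) := by
  have is := cj_idem' x (idem_r x)
  have hne : x * (x * x⁻¹) * x⁻¹ ≠ x * x⁻¹ := by
    intro he; apply Inc_s hi; rw [he]; exact idem_r x
  have hmem : x * (x * x⁻¹) * x⁻¹ ∈ genInv {x} :=
    (gen_sub _).1 _ ((gen_sub _).1 _ (mem_gen x) _ (r_mem (gen_sub _) (mem_gen x))) _ (inv_mem_gen x)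
  have h1 := Inc_below (h.inc hi) (p := L.p (x * (x * x⁻¹) * x⁻¹))
    (by rw [← h.2.2, L.mem_iff (gen_sub _) is]; exact hmem)
    (L.p_idem is)
    (by rw [h.1, L.p_le is (idem_r x)]; exact cj_le' x)
    (by rw [h.1]; exact fun he => hne (L.p_inj is (idem_r x) he))
  rcases h1 with h1 | h1
  · exact Or.inl h1
  · right
    rwa [h.1, h.2.1, ← L.p_mul (idem_r x) (idem_l x),
      L.p_le is (idem_mul (idem_r x) (idem_l x))] at h1

theorem key_s {x : S} {y : T} (h : L.Mt x y) (hi : Inc x)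
    (hc : XCov x (x * (x * x⁻¹) * x⁻¹)) :
    L.p (x⁻¹ * (x * (x * x⁻¹) * x⁻¹) * x) = y⁻¹ * L.p (x * (x * x⁻¹) * x⁻¹) * y := by
  have hiy := h.inc hi
  have is := cj_idem' x (idem_r x)
  have is' := cj_idem' y (idem_r y)
  have it' := cj_idem y (idem_l y)
  have im := idem_mul (idem_r x) (idem_l x)
  have im' := idem_mul (idem_r y) (idem_l y)
  have pm : L.p ((x * x⁻¹) * (x⁻¹ * x)) = (y * y⁻¹) * (y⁻¹ * y) := by
    rw [L.p_mul (idem_r x) (idem_l x), h.1, h.2.1]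
  have sm := cj_cj' x (idem_r x)
  have sm' := cj_cj' y (idem_r y)
  have mem_m : (x * x⁻¹) * (x⁻¹ * x) ∈ genInv {x} :=
    (gen_sub _).1 _ (r_mem (gen_sub _) (mem_gen x)) _ (l_mem (gen_sub _) (mem_gen x))
  have hm : (x * x⁻¹) * (x⁻¹ * x) ≠ x * x⁻¹ := by
    intro he; apply Inc_m hi; rw [he]; exact idem_r x
  have A := below_tr h hi
  have B := below_tr h.symm hiy
  have C := below_tr h.symm.inv (Inc_symm hiy)
  have B' : idemLe (y * (y * y⁻¹) * y⁻¹) (L.p (x * (x * x⁻¹) * x⁻¹)) ∨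
      idemLe (y * (y * y⁻¹) * y⁻¹) ((y * y⁻¹) * (y⁻¹ * y)) := by
    refine B.imp_left fun B => ?_
    have := (L.p_le (L.q_idem is') is).2 B
    rwa [L.pq is'] at this
  have C' : idemLe (y⁻¹ * (y⁻¹ * y) * y) (L.p (x⁻¹ * (x⁻¹ * x) * x)) ∨
      idemLe (y⁻¹ * (y⁻¹ * y) * y) ((y * y⁻¹) * (y⁻¹ * y)) := by
    rw [inv_inv', inv_inv', idem_comm (idem_l y) (idem_r y)] at C
    refine C.imp_left fun C => ?_
    have := (L.p_le (L.q_idem it') (cj_idem x (idem_l x))).2 C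
    rwa [L.pq it'] at this
  have main : idemLe (x * (x * x⁻¹) * x⁻¹) ((x * x⁻¹) * (x⁻¹ * x)) →
      L.p (x⁻¹ * (x * (x * x⁻¹) * x⁻¹) * x) = y⁻¹ * L.p (x * (x * x⁻¹) * x⁻¹) * y := by
    intro hle
    have e1 : x * (x * x⁻¹) * x⁻¹ = (x * x⁻¹) * (x⁻¹ * x) := by
      by_contra hne
      exact hc.2 _ mem_m im ⟨⟨hle, hne⟩, mul_le_left (idem_r x) (idem_l x), hm⟩
    have e2 : x⁻¹ * (x⁻¹ * x) * x = (x * x⁻¹) * (x⁻¹ * x) := by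
      rw [← cj_m, ← e1, sm, e1]
    have s1 : idemLe (y * (y * y⁻¹) * y⁻¹) ((y * y⁻¹) * (y⁻¹ * y)) := by
      rcases B' with B' | B'
      · rwa [e1, pm] at B'
      · exact B'
    have t1 : idemLe (y⁻¹ * (y⁻¹ * y) * y) ((y * y⁻¹) * (y⁻¹ * y)) := by
      rcases C' with C' | C'
      · rwa [e2, pm] at C'
      · exact C'
    have t2 := cj_mono y is' s1
    rw [sm', cj_m] at t2
    have t3 := le_antisymm' it' im' t1 t2
    rw [e1, cj_m, e2, pm, cj_m, t3]
  rcases A with A | A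
  · rcases B' with B' | B'
    · have e : L.p (x * (x * x⁻¹) * x⁻¹) = y * (y * y⁻¹) * y⁻¹ :=
        le_antisymm' (L.p_idem is) is' A B'
      rw [e, sm, sm', pm]
    · apply main
      rw [← L.p_le is im, pm]
      exact le_trans' A B'
  · exact main A

theorem xcov_symm {x e : S} (he : IsIdempotentElem e) (hc : XCov x e) :
    XCov x⁻¹ (x⁻¹ * e * x) := by
  obtain ⟨⟨h1, h2⟩, h3⟩ := hc
  have hb : x * (x⁻¹ * e * x) * x⁻¹ = e := (cj_cj x he).trans h1
  refine ⟨⟨?_, ?_⟩, ?_⟩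
  · rw [inv_inv']; exact cj_le x
  · rw [inv_inv']; intro h
    rw [h, cj_top'] at hb
    exact h2 hb.symm
  · rw [gen_inv, inv_inv']
    rintro r hr hi ⟨⟨r1, r2⟩, r3, r4⟩
    have hrb : x⁻¹ * (x * r * x⁻¹) * x = r := (cj_cj' x hi).trans r3
    refine h3 (x * r * x⁻¹)
      ((gen_sub _).1 _ ((gen_sub _).1 _ (mem_gen x) _ hr) _ (inv_mem_gen x))
      (cj_idem' x hi) ⟨⟨?_, ?_⟩, cj_le' x, ?_⟩
    · have := cj_mono' x (cj_idem x he) r1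
      rwa [hb] at this
    · intro h; apply r2; rw [h, hrb]
    · intro h; apply r4; rw [← hrb, h, cj_top]

theorem key_symm {x e : S} {y : T} (h : L.Mt x y) (he : IsIdempotentElem e)
    (hle : idemLe e (x * x⁻¹))
    (hk : L.p (x⁻¹⁻¹ * (x⁻¹ * e * x) * x⁻¹) = y⁻¹⁻¹ * L.p (x⁻¹ * e * x) * y⁻¹) :
    L.p (x⁻¹ * e * x) = y⁻¹ * L.p e * y := by
  rw [inv_inv', inv_inv', cj_cj x he, show e * (x * x⁻¹) = e from hle] at hk
  have ig := cj_idem x he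
  rw [hk, cj_cj' y (L.p_idem ig), h.2.1]
  exact ((L.p_le ig (idem_l x)).2 (cj_le x)).symm

theorem key0 {x e : S} {y : T} (h : L.Mt x y) (he : IsIdempotentElem e)
    (hle : idemLe e (x * x⁻¹)) :
    ∃ w ∈ genInv {x}, idemLe e (w * w⁻¹) ∧ L.p (w⁻¹ * e * w) = y⁻¹ * L.p e * y := by
  obtain ⟨u, hu⟩ := exists_mt (L := L.symm) (L.p e * y)
  have ie := L.p_idem he
  have hu1 : u * u⁻¹ = e := by
    rw [hu.1, rr_emul ie (by rw [h.1, L.p_le he (idem_r x)]; exact hle)]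
    exact L.qp he
  have hu2 : L.p (u⁻¹ * u) = y⁻¹ * L.p e * y := by
    rw [hu.2.1, ll_emul ie]
    exact L.pq (cj_idem y ie)
  have hsub := gen_sub ({e, x} : Set S)
  have hmem : u ∈ genInv {e, x} := by
    rw [← hu.symm.mem hsub]
    apply (L.F_sub hsub).1
    · rw [L.mem_iff hsub he]; exact subset_gen _ (Or.inl rfl)
    · rw [h.mem hsub]; exact subset_gen _ (Or.inr rfl)
  obtain ⟨w, hw, huw⟩ := gen2_below he hle hmem
  rw [hu1] at huw
  refine ⟨w, hw, ?_, ?_⟩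
  · have h1 : u * u⁻¹ = e * (w * w⁻¹) * e := by rw [huw, rr_mul, idem_inv he]
    rw [hu1, mul_assoc, idem_comm (idem_r w) he, ← mul_assoc, he.eq] at h1
    exact h1.symm
  · rw [← hu2, huw, ll_emul he]

theorem key_inc {x e : S} {y : T} (h : L.Mt x y) (hi : Inc x) (he : IsIdempotentElem e)
    (hc : XCov x e) : L.p (x⁻¹ * e * x) = y⁻¹ * L.p e * y := by
  have im := idem_mul (idem_r x) (idem_l x)
  have mem_m : (x * x⁻¹) * (x⁻¹ * x) ∈ genInv {x} :=
    (gen_sub _).1 _ (r_mem (gen_sub _) (mem_gen x)) _ (l_mem (gen_sub _) (mem_gen x))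
  have hm : (x * x⁻¹) * (x⁻¹ * x) ≠ x * x⁻¹ := by
    intro he; apply Inc_m hi; rw [he]; exact idem_r x
  have lem : idemLe e ((x * x⁻¹) * (x⁻¹ * x)) → e = (x * x⁻¹) * (x⁻¹ * x) := by
    intro hle
    by_contra hne
    exact hc.2 _ mem_m im ⟨⟨hle, hne⟩, mul_le_left (idem_r x) (idem_l x), hm⟩
  by_cases hex : e ∈ genInv {x}
  · rcases Inc_below hi hex he hc.1.1 hc.1.2 with h1 | h1
    · have e1 : e = x * (x * x⁻¹) * x⁻¹ := by
        by_contra hne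
        refine hc.2 (x * (x * x⁻¹) * x⁻¹) ?_ (cj_idem' x (idem_r x)) ⟨⟨h1, hne⟩, cj_le' x, ?_⟩
        · exact (gen_sub _).1 _ ((gen_sub _).1 _ (mem_gen x) _
            (r_mem (gen_sub _) (mem_gen x))) _ (inv_mem_gen x)
        · intro he; apply Inc_s hi; rw [he]; exact idem_r x
      subst e1
      exact key_s h hi hc
    · have e1 := lem h1
      apply key_symm h he hc.1.1
      have hc' := xcov_symm he hc
      have e2 : x⁻¹ * e * x = x⁻¹ * (x⁻¹ * x⁻¹⁻¹) * x⁻¹⁻¹ := by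
        rw [e1, cj_m, inv_inv']
      rw [e2] at hc' ⊢
      exact key_s h.inv (Inc_symm hi) hc'
  · obtain ⟨w, hw, h1, h2⟩ := key0 h he hc.1.1
    have hww : w * w⁻¹ ∈ genInv {x} := r_mem (gen_sub _) hw
    have ir := idem_mul (idem_r w) (idem_r x)
    have h3 : (w * w⁻¹) * (x * x⁻¹) = x * x⁻¹ := by
      by_contra hne
      have hr : (w * w⁻¹) * (x * x⁻¹) ∈ genInv {x} :=
        (gen_sub _).1 _ hww _ (r_mem (gen_sub _) (mem_gen x))
      refine hc.2 _ hr ir ⟨⟨le_mul h1 hc.1.1, ?_⟩, mul_le_right (idem_r x), hne⟩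
      intro h; apply hex; rw [h]; exact hr
    have h4 : w * w⁻¹ = x * x⁻¹ := by
      apply Inc_max hi hww (idem_r w)
      unfold idemLe
      rw [idem_comm (idem_r x) (idem_r w)]; exact h3
    rcases Inc_R hi hw h4 with h5 | h5
    · rw [h5] at h2; exact h2
    · exfalso
      have e1 : w⁻¹ * e * w = e := by
        rw [h5, idem_inv (idem_r x), idem_comm (idem_r x) he,
          show e * (x * x⁻¹) = e from hc.1.1, hc.1.1]
      rw [e1] at h2
      have h6 : idemLe (L.p e) (L.p (x⁻¹ * x)) := by
        rw [h2, ← h.2.1]; exact cj_le y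
      rw [L.p_le he (idem_l x)] at h6
      have h7 := lem (le_mul hc.1.1 h6)
      apply hex; rw [h7]; exact mem_m

theorem key_bic {x e : S} {y : T} (h : L.Mt x y) (hle : idemLe (x⁻¹ * x) (x * x⁻¹))
    (hne : x⁻¹ * x ≠ x * x⁻¹) (he : IsIdempotentElem e)
    (hc : XCov x e) : L.p (x⁻¹ * e * x) = y⁻¹ * L.p e * y := by
  have hx := fs_chn hle hne
  have hU := chn_map (L := L) hx
  have hyU : y ∈ L.F (genInv {x}) := (h.mem (gen_sub _)).2 (mem_gen x)
  have hyl : y⁻¹ * y = L.p (fs x 1) := by rw [fs_one, h.2.1]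
  have h2 : y⁻¹ * L.p (fs x 1) * y = L.p (fs x 2) := hU.shift (i := 0) (j := 1) hyU h.1 hyl 1
  have ie := L.p_idem he
  by_cases h1 : idemLe e (fs x 1)
  · have e1 : e = fs x 1 := by
      by_contra hne'
      refine hc.2 (fs x 1) (fs_mem 1) (fs_idem x 1) ⟨⟨h1, hne'⟩, ?_, ?_⟩
      · rw [fs_one]; exact hle
      · rw [fs_one]; exact hne
    rw [e1, h2]; rfl
  · obtain ⟨w, hw, hw1, hw2⟩ := key0 h he hc.1.1
    obtain ⟨i, j, hi, hj⟩ := hx.ex hw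
    have hi0 : i = 0 := by
      by_contra hi0
      apply h1
      rw [hi] at hw1
      exact le_trans' hw1 ((hx.le_iff _ _).2 (Nat.pos_of_ne_zero hi0))
    subst hi0
    have ig := cj_idem w he
    have hj1 : j ≤ 1 := by
      by_contra hj1
      have h3 : idemLe (w⁻¹ * e * w) (fs x 2) := by
        have := cj_le (e := e) w
        rw [hj] at this
        exact le_trans' this ((hx.le_iff _ _).2 (by omega))
      rw [← L.p_le ig (fs_idem x 2), hw2, ← h2] at h3
      have h4 := cj_mono' y (cj_idem y ie) h3
      have h5 : idemLe (L.p e) (y * y⁻¹) := by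
        rw [h.1, L.p_le he (idem_r x)]; exact hc.1.1
      rw [cj_cj y ie, show L.p e * (y * y⁻¹) = L.p e from h5, cj_cj y (L.p_idem (fs_idem x 1))] at h4
      have h6 := le_trans' h4 (mul_le_left (L.p_idem (fs_idem x 1)) (idem_r y))
      rw [L.p_le he (fs_idem x 1)] at h6
      exact h1 h6
    have hj01 : j = 0 ∨ j = 1 := by omega
    rcases hj01 with rfl | rfl
    · exfalso
      have hwi := comb_idem L.combS (hi.trans hj.symm)
      have e0 : w = x * x⁻¹ := by rw [← rr_of_idem hwi, hi]; rfl
      have e1 : w⁻¹ * e * w = e := by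
        rw [e0, idem_inv (idem_r x), idem_comm (idem_r x) he,
          show e * (x * x⁻¹) = e from hc.1.1, hc.1.1]
      rw [e1] at hw2
      apply h1
      rw [← L.p_le he (fs_idem x 1), hw2, ← hyl]; exact cj_le y
    · have : w = x := L.combS _ _ hi (hj.trans (fs_one x))
      rw [this] at hw2; exact hw2

theorem key {x e : S} {y : T} (h : L.Mt x y) (he : IsIdempotentElem e)
    (hc : XCov x e) : L.p (x⁻¹ * e * x) = y⁻¹ * L.p e * y := by
  by_cases hx : x * x⁻¹ = x⁻¹ * x
  · have hi := comb_idem L.combS hx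
    have hyi : y = L.p x := L.combT _ _ (h.1.trans (mt_idem (L := L) hi).1.symm)
      (h.2.1.trans (mt_idem (L := L) hi).2.1.symm)
    rw [hyi, idem_inv hi, idem_inv (L.p_idem hi), L.p_mul (idem_mul hi he) hi, L.p_mul hi he]
  by_cases h1 : idemLe (x⁻¹ * x) (x * x⁻¹)
  · exact key_bic h h1 (Ne.symm hx) he hc
  by_cases h2 : idemLe (x * x⁻¹) (x⁻¹ * x)
  · apply key_symm h he hc.1.1
    exact key_bic h.inv (by rwa [inv_inv']) (by rwa [inv_inv']) (cj_idem x he) (xcov_symm he hc)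
  · exact key_inc h ⟨h2, h1⟩ he hc

theorem mt_unique {x : S} {y z : T} (h : L.Mt x y) (h' : L.Mt x z) : y = z :=
  L.combT _ _ (h.1.trans h'.1.symm) (h.2.1.trans h'.2.1.symm)

theorem mt_emul {x e : S} {y : T} (h : L.Mt x y) (he : IsIdempotentElem e)
    (hle : idemLe e (x * x⁻¹)) (hk : L.p (x⁻¹ * e * x) = y⁻¹ * L.p e * y) :
    L.Mt (e * x) (L.p e * y) := by
  obtain ⟨z, hz⟩ := exists_mt (L := L) (e * x)
  have : z = L.p e * y := by
    apply L.combT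
    · rw [hz.1, rr_emul he hle, rr_emul (L.p_idem he)]
      rw [h.1, L.p_le he (idem_r x)]; exact hle
    · rw [hz.2.1, ll_emul he, ll_emul (L.p_idem he), hk]
  rwa [← this]

theorem key_all (hSC : ShortlyConnected S) {x e : S} {y : T} (h : L.Mt x y)
    (he : IsIdempotentElem e) (hle : idemLe e (x * x⁻¹)) :
    L.p (x⁻¹ * e * x) = y⁻¹ * L.p e * y := by
  by_cases hee : e = x * x⁻¹
  · subst hee
    rw [cj_top, ← h.1, cj_top, h.2.1]
  obtain ⟨n, hn, es, h0, hn', hid, hst⟩ := hSC x e he ⟨hle, hee⟩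
  have main : ∀ k, k ≤ n → idemLe (es (n - k)) (x * x⁻¹) ∧
      L.p (x⁻¹ * es (n - k) * x) = y⁻¹ * L.p (es (n - k)) * y := by
    intro k
    induction k with
    | zero =>
      intro _
      rw [Nat.sub_zero, hn', cj_top, ← h.1, cj_top, h.2.1]
      exact ⟨idem_r x, rfl⟩
    | succ k ih =>
      intro hk
      obtain ⟨i1, i2⟩ := ih (by omega)
      obtain ⟨⟨s1, s2⟩, s3⟩ := hst (n - k) (by omega) (by omega)
      rw [show n - k - 1 = n - (k + 1) by omega] at s1 s3
      have ik := hid (n - k) (by omega)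
      have ik' := hid (n - (k + 1)) (by omega)
      refine ⟨le_trans' s1 i1, ?_⟩
      have h1 := key (mt_emul h ik i1 i2) ik' s3
      have h2 : ∀ {R : Type u} [InverseSemigroup R] (a b c : R), IsIdempotentElem a →
          IsIdempotentElem b → idemLe b a → (a * c)⁻¹ * b * (a * c) = c⁻¹ * b * c := by
        intro R _ a b c ha hb hab
        rw [mul_inv', idem_inv ha]
        calc c⁻¹ * a * b * (a * c) = c⁻¹ * (a * b * a) * c := by simp only [mul_assoc]
          _ = _ := by rw [idem_comm ha hb, hab, hab]
      have h3 : ∀ {R : Type v} [InverseSemigroup R] (a b c : R), IsIdempotentElem a →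
          IsIdempotentElem b → idemLe b a → (a * c)⁻¹ * b * (a * c) = c⁻¹ * b * c := by
        intro R _ a b c ha hb hab
        rw [mul_inv', idem_inv ha]
        calc c⁻¹ * a * b * (a * c) = c⁻¹ * (a * b * a) * c := by simp only [mul_assoc]
          _ = _ := by rw [idem_comm ha hb, hab, hab]
      rwa [h2 _ _ _ ik ik' s1, h3 _ _ _ (L.p_idem ik) (L.p_idem ik')
        ((L.p_le ik' ik).2 s1)] at h1
  have := (main n le_rfl).2
  rwa [Nat.sub_self, h0] at this

theorem key_all' (hSC : ShortlyConnected S) {x e : S} {y : T} (h : L.Mt x y)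
    (he : IsIdempotentElem e) :
    L.p (x⁻¹ * e * x) = y⁻¹ * L.p e * y := by
  have h1 := key_all hSC h (idem_mul he (idem_r x)) (mul_le_right (idem_r x))
  have e1 : ∀ {R : Type u} [InverseSemigroup R] (c b : R),
      c⁻¹ * (b * (c * c⁻¹)) * c = c⁻¹ * b * c := by
    intro R _ c b
    calc c⁻¹ * (b * (c * c⁻¹)) * c = c⁻¹ * b * (c * c⁻¹ * c) := by simp only [mul_assoc]
      _ = _ := by rw [InverseSemigroup.mul_inv_mul]
  have e2 : ∀ {R : Type v} [InverseSemigroup R] (c b : R),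
      c⁻¹ * (b * (c * c⁻¹)) * c = c⁻¹ * b * c := by
    intro R _ c b
    calc c⁻¹ * (b * (c * c⁻¹)) * c = c⁻¹ * b * (c * c⁻¹ * c) := by simp only [mul_assoc]
      _ = _ := by rw [InverseSemigroup.mul_inv_mul]
  rw [e1, L.p_mul he (idem_r x), ← h.1, e2] at h1
  exact h1

theorem main (hSC : ShortlyConnected S) :
    ∃ φ : S → T, (∀ x, L.Mt x (φ x)) ∧ Function.Bijective φ ∧ (∀ a b, φ (a * b) = φ a * φ b) ∧
      ∀ U : Set S, IsInvSub U → L.F U = φ '' U := by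
  choose φ hφ using exists_mt (L := L)
  have hsurj : Function.Surjective φ := by
    intro y
    obtain ⟨x, hx⟩ := exists_mt (L := L.symm) y
    exact ⟨x, mt_unique (hφ x) hx.symm⟩
  refine ⟨φ, hφ, ⟨?_, hsurj⟩, ?_, ?_⟩
  · intro a b hab
    have ha := (hφ a).symm
    rw [hab] at ha
    exact mt_unique ha (hφ b).symm
  · intro a b
    apply L.combT
    · rw [(hφ (a * b)).1, rr_mul, rr_mul, (hφ b).1]
      have := key_all' hSC (hφ a).inv (idem_r b)
      rwa [inv_inv', inv_inv'] at this
    · rw [(hφ (a * b)).2.1, ll_mul, ll_mul, (hφ a).2.1]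
      exact key_all' hSC (hφ b) (idem_l a)
  · intro U hU
    ext y
    constructor
    · intro hy
      obtain ⟨x, rfl⟩ := hsurj y
      exact ⟨x, ((hφ x).mem hU).1 hy, rfl⟩
    · rintro ⟨x, hx, rfl⟩
      exact ((hφ x).mem hU).2 hx

end LI

end KeySec

end ISg

/-- if `S` is a shortly connected combinatorial inverse semigroup,
`T` an inverse semigroup, and `Ψ` a lattice isomorphism of `S` onto `T` whose
associated `E`-bijection is a semilattice isomorphism of `E_S` onto `E_T`, then
there is a unique isomorphism of `S` onto `T` inducing `Ψ`. -/
theorem stmt7 {S T : Type*} [InverseSemigroup S] [InverseSemigroup T]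
    (hSC : ShortlyConnected S) (hComb : Combinatorial S)
    -- `Ψ` is a lattice isomorphism of `S` onto `T`:
    (Ψ : {U : Set S // IsInvSub U} → {V : Set T // IsInvSub V})
    (hΨbij : Function.Bijective Ψ)
    (hΨord : ∀ U V : {U : Set S // IsInvSub U}, U.1 ⊆ V.1 ↔ (Ψ U).1 ⊆ (Ψ V).1)
    -- `ψE` is the associated `E`-bijection:
    (ψE : S → T)
    (hΨE : ∀ e : S, IsIdempotentElem e → ∀ h : IsInvSub ({e} : Set S),
      (Ψ ⟨{e}, h⟩).1 = {ψE e})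
    -- `ψE` is a semilattice isomorphism of `E_S` onto `E_T`:
    (hE1 : ∀ e : S, IsIdempotentElem e → IsIdempotentElem (ψE e))
    (hE2 : ∀ e f : S, IsIdempotentElem e → IsIdempotentElem f → ψE e = ψE f → e = f)
    (hE3 : ∀ f : T, IsIdempotentElem f → ∃ e : S, IsIdempotentElem e ∧ ψE e = f)
    (hE4 : ∀ e f : S, IsIdempotentElem e → IsIdempotentElem f →
      ψE (e * f) = ψE e * ψE f) :
    ∃! φ : S → T, Function.Bijective φ ∧ (∀ a b : S, φ (a * b) = φ a * φ b) ∧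
      ∀ (U : Set S) (h : IsInvSub U), (Ψ ⟨U, h⟩).1 = φ '' U := by
  classical
  have hmem : ∀ (U : {U : Set S // IsInvSub U}) (e : S), IsIdempotentElem e →
      (e ∈ U.1 ↔ ψE e ∈ (Ψ U).1) := by
    intro U e he
    have := hΨord ⟨{e}, ISg.singleton_sub he⟩ U
    rw [hΨE e he] at this
    simpa only [Set.singleton_subset_iff] using this
  have combT : Combinatorial T := by
    apply ISg.comb_of_group
    intro y hy
    -- all elements of `⟨y⟩` share the same idempotent
    have hone : ∀ a ∈ genInv ({y} : Set T), a * a⁻¹ = y * y⁻¹ ∧ a⁻¹ * a = y * y⁻¹ := by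
      apply ISg.gen_induction
      · exact ⟨rfl, hy.symm⟩
      · rw [ISg.inv_inv']; exact ⟨hy.symm, rfl⟩
      · rintro a ⟨h1, h2⟩
        constructor
        · rw [ISg.rr_mul, ← h2, ISg.cj_top', h1, h2]
        · rw [ISg.ll_mul, h2, ISg.cj_top, hy]
      · rintro a ⟨h1, h2⟩
        constructor
        · rw [ISg.rr_mul, ISg.inv_inv', ← hy, ← h2, ISg.cj_top', h1, h2]
        · rw [ISg.ll_mul, ISg.inv_inv', h2, hy, ISg.cj_top', hy]
    obtain ⟨U, hU⟩ := hΨbij.2 ⟨genInv {y}, ISg.gen_sub _⟩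
    obtain ⟨e, he, hey⟩ := hE3 _ (ISg.idem_r y)
    have hid : ∀ g ∈ U.1, IsIdempotentElem g → g = e := by
      intro g hg hi
      apply hE2 g e hi he
      have h1 := (hmem U g hi).1 hg
      rw [hU] at h1
      have h2 := (hone _ h1).1
      rw [ISg.rr_of_idem (hE1 g hi)] at h2
      rw [h2, hey]
    have hUe : U.1 ⊆ {e} := by
      intro a ha
      have h1 := hid _ (ISg.r_mem U.2 ha) (ISg.idem_r a)
      have h2 := hid _ (ISg.l_mem U.2 ha) (ISg.idem_l a)
      exact hid a ha (ISg.comb_idem hComb (h1.trans h2.symm))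
    have h3 := (hΨord U ⟨{e}, ISg.singleton_sub he⟩).1 hUe
    rw [hU, hΨE e he] at h3
    have h4 : y = ψE e := h3 (ISg.mem_gen y)
    rw [h4]; exact hE1 e he
  let Θ := Equiv.ofBijective Ψ hΨbij
  have hΘ : ∀ U, Θ U = Ψ U := fun _ => rfl
  have hΘs : ∀ V, Ψ (Θ.symm V) = V := fun V => Θ.apply_symm_apply V
  have hΘs' : ∀ U, Θ.symm (Ψ U) = U := fun U => Θ.symm_apply_apply U
  have hq : ∀ f : T, ∃ e : S, IsIdempotentElem f → IsIdempotentElem e ∧ ψE e = f := by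
    intro f
    by_cases hf : IsIdempotentElem f
    · obtain ⟨e, he⟩ := hE3 f hf
      exact ⟨e, fun _ => he⟩
    · obtain ⟨e, he⟩ := hE3 (f * f⁻¹) (ISg.idem_r f)
      exact ⟨e, fun h => absurd h hf⟩
  choose q hq using hq
  let L : ISg.LI S T :=
    { combS := hComb
      combT := combT
      F := fun U => if h : IsInvSub U then (Ψ ⟨U, h⟩).1 else ∅
      G := fun V => if h : IsInvSub V then (Θ.symm ⟨V, h⟩).1 else ∅
      F_sub := fun {U} h => by simp only [dif_pos h]; exact (Ψ ⟨U, h⟩).2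
      G_sub := fun {V} h => by simp only [dif_pos h]; exact (Θ.symm ⟨V, h⟩).2
      FG := fun {V} h => by
        simp only [dif_pos h]
        rw [dif_pos (Θ.symm ⟨V, h⟩).2]
        simp only [Subtype.coe_eta, hΘs]
      GF := fun {U} h => by
        simp only [dif_pos h]
        rw [dif_pos (Ψ ⟨U, h⟩).2]
        simp only [Subtype.coe_eta, hΘs']
      F_mono := fun {U V} hU hV h => by
        simp only [dif_pos hU, dif_pos hV]
        exact (hΨord ⟨U, hU⟩ ⟨V, hV⟩).1 h
      G_mono := fun {U V} hU hV h => by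
        simp only [dif_pos hU, dif_pos hV]
        rw [hΨord, hΘs, hΘs]; exact h
      p := ψE
      q := q
      p_idem := fun {e} he => hE1 e he
      q_idem := fun {f} hf => (hq f hf).1
      qp := fun {e} he => hE2 _ _ (hq _ (hE1 e he)).1 he (hq _ (hE1 e he)).2
      pq := fun {f} hf => (hq f hf).2
      p_mul := fun {e f} he hf => hE4 e f he hf
      q_mul := fun {e f} he hf => by
        apply hE2 _ _ (hq _ (ISg.idem_mul he hf)).1 (ISg.idem_mul (hq e he).1 (hq f hf).1)
        rw [(hq _ (ISg.idem_mul he hf)).2, hE4 _ _ (hq e he).1 (hq f hf).1, (hq e he).2, (hq f hf).2]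
      F_single := fun {e} he => by
        rw [dif_pos (ISg.singleton_sub he)]; exact hΨE e he _
      G_single := fun {f} hf => by
        rw [dif_pos (ISg.singleton_sub hf)]
        have h1 : (⟨{f}, ISg.singleton_sub hf⟩ : {V : Set T // IsInvSub V}) =
            Ψ ⟨{q f}, ISg.singleton_sub (hq f hf).1⟩ := by
          apply Subtype.ext
          rw [hΨE _ (hq f hf).1, (hq f hf).2]
        rw [h1, hΘs'] }
  obtain ⟨φ, hMt, hbij, hmul, himg⟩ := ISg.LI.main (L := L) hSC
  refine ⟨φ, ⟨hbij, hmul, fun U h => ?_⟩, ?_⟩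
  · have := himg U h
    rw [← this]
    change (Ψ ⟨U, h⟩).1 = (if h : IsInvSub U then (Ψ ⟨U, h⟩).1 else ∅)
    rw [dif_pos h]
  · rintro φ' ⟨hbij', hmul', himg'⟩
    have hE : ∀ e, IsIdempotentElem e → φ' e = ψE e := by
      intro e he
      have h1 := himg' {e} (ISg.singleton_sub he)
      rw [hΨE e he, Set.image_singleton] at h1
      exact (Set.singleton_eq_singleton_iff.1 h1).symm
    have hinv : ∀ x, φ' x⁻¹ = (φ' x)⁻¹ := by
      intro x
      apply InverseSemigroup.inv_unique
      · rw [← hmul', ← hmul', InverseSemigroup.mul_inv_mul]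
      · rw [← hmul', ← hmul', InverseSemigroup.inv_mul_inv]
    funext x
    apply combT
    · rw [← hinv, ← hmul', hE _ (ISg.idem_r x)]
      exact (hMt x).1.symm
    · rw [← hinv, ← hmul', hE _ (ISg.idem_l x)]
      exact (hMt x).2.1.symm
end
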